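/- Let F be a totally real number field and L a positive definite integral O_F-lattice, and let n be a positive integer. Then L is globally n-ADC if and only if L is n-regular and locally n-ADC. -/

import Mathlib

/-
Quadratic lattices over (local and global) fields, following
"On n-ADC integral quadratic lattices over totally real number fields".

A non-archimedean local field of characteristic ≠ 2 is formalized as a field `K`
together with a valuation subring `O` of `K` which is a complete discrete valuation
ring with finite residue field (completeness is expressed as adic completeness with
respect to the maximal ideal); `K` is automatically the fraction field of `O`.
-/

noncomputable section

namespace QLat

variable {K : Type} [Field K]

/-- The bilinear form associated to a quadratic form `Q`, i.e. `B x y = (Q(x+y)-Q(x)-Q(y))/2`,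
so that `B x x = Q x`. -/
def bil {V : Type} [AddCommGroup V] [Module K V] (Q : QuadraticForm K V) (x y : V) : K :=
  (2 : K)⁻¹ * QuadraticMap.polar (⇑Q) x y

/-- A quadratic form (space) is nondegenerate. -/
def Nondeg {V : Type} [AddCommGroup V] [Module K V] (Q : QuadraticForm K V) : Prop :=
  ∀ x : V, (∀ y : V, QuadraticMap.polar (⇑Q) x y = 0) → x = 0

/-- The `O`-span of a subset `t` of a `K`-vector space: all finite `O`-linear
combinations of elements of `t`. -/
def ospan (O : Subring K) {V : Type} [AddCommGroup V] [Module K V] (t : Set V) : Set V :=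
  {x | ∃ (m : ℕ) (c : Fin m → K) (g : Fin m → V),
    (∀ i, c i ∈ O) ∧ (∀ i, g i ∈ t) ∧ x = ∑ i, c i • g i}

/-- An `O`-lattice in `V`: a finitely generated `O`-submodule of `V`. -/
def IsLattice (O : Subring K) {V : Type} [AddCommGroup V] [Module K V] (L : Set V) : Prop :=
  ∃ t : Finset V, L = ospan O (t : Set V)

/-- An `O`-lattice on `V`: a finitely generated `O`-submodule of `V` spanning `V` over `K`. -/
def IsLatticeOn (O : Subring K) {V : Type} [AddCommGroup V] [Module K V] (L : Set V) : Prop :=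
  IsLattice O L ∧ Submodule.span K L = ⊤

/-- The lattice `L` is integral: `𝔫(L) ⊆ O`, i.e. all values of `Q` on `L` lie in `O`. -/
def IsIntegral (O : Subring K) {V : Type} [AddCommGroup V] [Module K V]
    (Q : QuadraticForm K V) (L : Set V) : Prop :=
  ∀ x ∈ L, Q x ∈ O

/-- The quadratic space `(V,Q)` represents the quadratic space `(W,Q')`. -/
def SpaceRep {W V : Type} [AddCommGroup W] [Module K W] [AddCommGroup V] [Module K V]
    (Q' : QuadraticForm K W) (Q : QuadraticForm K V) : Prop :=
  ∃ σ : W →ₗ[K] V, Function.Injective σ ∧ ∀ x, Q (σ x) = Q' x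

/-- The quadratic spaces `(W,Q')` and `(V,Q)` are isometric. -/
def SpaceIsom {W V : Type} [AddCommGroup W] [Module K W] [AddCommGroup V] [Module K V]
    (Q' : QuadraticForm K W) (Q : QuadraticForm K V) : Prop :=
  ∃ σ : W ≃ₗ[K] V, ∀ x, Q (σ x) = Q' x

/-- The lattice `M` (in `(V,Q)`) represents the lattice `N` (a full lattice in `(W,Q')`):
there is an injective form-preserving `K`-linear map carrying `N` into `M`.  (For a full
lattice `N` this is equivalent to the existence of an injective form-preserving
`O`-linear map `N → M`, since `K` is the fraction field of `O`.) -/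
def LatRep {W V : Type} [AddCommGroup W] [Module K W] [AddCommGroup V] [Module K V]
    (Q' : QuadraticForm K W) (Q : QuadraticForm K V) (N : Set W) (M : Set V) : Prop :=
  ∃ σ : W →ₗ[K] V, Function.Injective σ ∧ (∀ x, Q (σ x) = Q' x) ∧ σ '' N ⊆ M

/-- The lattices `N` (full in `(W,Q')`) and `M` (in `(V,Q)`) are isometric. -/
def LatIsom {W V : Type} [AddCommGroup W] [Module K W] [AddCommGroup V] [Module K V]
    (Q' : QuadraticForm K W) (Q : QuadraticForm K V) (N : Set W) (M : Set V) : Prop :=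
  ∃ σ : W →ₗ[K] V, Function.Injective σ ∧ (∀ x, Q (σ x) = Q' x) ∧ σ '' N = M

/-- The lattice `L` is `O`-maximal: it is integral and is not properly contained in any
(finitely generated) lattice on the same subspace with integral norm. -/
def IsMaximal (O : Subring K) {V : Type} [AddCommGroup V] [Module K V]
    (Q : QuadraticForm K V) (L : Set V) : Prop :=
  IsIntegral O Q L ∧
    ∀ L' : Set V, IsLattice O L' → Submodule.span K L' = Submodule.span K L →
      L ⊆ L' → IsIntegral O Q L' → L' = L

/-- The lattice `L` is `n`-ADC: every integral `O`-lattice `N` of rank `n` (on a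
nondegenerate quadratic space `W` of dimension `n`) whose ambient space is represented by
the space `(V,Q) = K·L` is represented by `L`. -/
def IsADC (O : Subring K) {V : Type} [AddCommGroup V] [Module K V]
    (Q : QuadraticForm K V) (L : Set V) (n : ℕ) : Prop :=
  ∀ (W : Type) [AddCommGroup W] [Module K W] (Q' : QuadraticForm K W),
    Nondeg Q' → Module.finrank K W = n →
    ∀ N : Set W, IsLatticeOn O N → IsIntegral O Q' N →
      SpaceRep Q' Q → LatRep Q' Q N L

/-- The lattice `L` is `n`-universal: it represents every integral `O`-lattice of rank `n`. -/
def IsUniversal (O : Subring K) {V : Type} [AddCommGroup V] [Module K V]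
    (Q : QuadraticForm K V) (L : Set V) (n : ℕ) : Prop :=
  ∀ (W : Type) [AddCommGroup W] [Module K W] (Q' : QuadraticForm K W),
    Nondeg Q' → Module.finrank K W = n →
    ∀ N : Set W, IsLatticeOn O N → IsIntegral O Q' N → LatRep Q' Q N L

end QLat

open scoped TensorProduct
open IsDedekindDomain

namespace QGlob

/-- Scalar-commutation instance for the completed field, registered to help instance
search for modules over `F_v`. -/
noncomputable instance (F : Type) [Field F] [NumberField F]
    (v : HeightOneSpectrum (NumberField.RingOfIntegers F)) :
    SMulCommClass F (v.adicCompletion F) (v.adicCompletion F) :=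
  Algebra.to_smulCommClass


variable (F : Type) [Field F] [NumberField F]

/-- `F` is totally real: every infinite place of `F` is real. -/
def TotallyReal : Prop := ∀ v : NumberField.InfinitePlace F, v.IsReal

/-- The ring of integers `O_F` of `F`, as a subring of `F`. -/
def OF : Subring F := (integralClosure ℤ F).toSubring

/-- A quadratic form over the totally real field `F` is positive definite if its values
at nonzero vectors are positive under every real embedding of `F`. -/
def PosDef {V : Type} [AddCommGroup V] [Module F V] (Q : QuadraticForm F V) : Prop :=
  ∀ (φ : F →+* ℝ) (x : V), x ≠ 0 → 0 < φ (Q x)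

/-- The completion `F_v` of `F` at a finite place `v`. -/
abbrev Fv (v : HeightOneSpectrum (NumberField.RingOfIntegers F)) : Type :=
  v.adicCompletion F

/-- The ring of integers of `F_v`, as a subring of `F_v`. -/
def Ov (v : HeightOneSpectrum (NumberField.RingOfIntegers F)) : Subring (Fv F v) :=
  (v.adicCompletionIntegers F).toSubring

/-- The completion `V_v = F_v ⊗_F V` of a quadratic space `V` over `F` at `v`. -/
abbrev Vv (V : Type) [AddCommGroup V] [Module F V]
    (v : HeightOneSpectrum (NumberField.RingOfIntegers F)) : Type :=
  (Fv F v) ⊗[F] V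

/-- The extension of a quadratic form `Q` on `V` to `V_v`. -/
noncomputable def Qv {V : Type} [AddCommGroup V] [Module F V] (Q : QuadraticForm F V)
    (v : HeightOneSpectrum (NumberField.RingOfIntegers F)) :
    QuadraticForm (Fv F v) (Vv F V v) :=
  letI : Invertible (2 : F) := invertibleOfNonzero two_ne_zero
  Q.baseChange (Fv F v)

/-- The canonical map `V → V_v`. -/
noncomputable def toVv {V : Type} [AddCommGroup V] [Module F V]
    (v : HeightOneSpectrum (NumberField.RingOfIntegers F)) : V → Vv F V v :=
  fun x => (1 : Fv F v) ⊗ₜ[F] x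

/-- The completion `L_v = O_{F_v} ⊗ L` of a lattice `L ⊆ V` at `v`, i.e. the
`O_{F_v}`-span of the image of `L` in `V_v`. -/
noncomputable def Lv {V : Type} [AddCommGroup V] [Module F V] (L : Set V)
    (v : HeightOneSpectrum (NumberField.RingOfIntegers F)) : Set (Vv F V v) :=
  QLat.ospan (Ov F v) (toVv F v '' L)

variable {V : Type} [AddCommGroup V] [Module F V]

/-- `L` is globally `n`-ADC: every positive definite integral `O_F`-lattice `N` of rank
`n` whose ambient space `F·N` is represented by `F·L` is represented by `L`. -/
def IsGlobADC (Q : QuadraticForm F V) (L : Set V) (n : ℕ) : Prop :=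
  ∀ (W : Type) [AddCommGroup W] [Module F W] (Q' : QuadraticForm F W),
    QLat.Nondeg Q' → PosDef F Q' → Module.finrank F W = n →
    ∀ N : Set W, QLat.IsLatticeOn (OF F) N → QLat.IsIntegral (OF F) Q' N →
      QLat.SpaceRep Q' Q → QLat.LatRep Q' Q N L

/-- `L` is globally `n`-universal: it represents every positive definite integral
`O_F`-lattice of rank `n`. -/
def IsGlobUniversal (Q : QuadraticForm F V) (L : Set V) (n : ℕ) : Prop :=
  ∀ (W : Type) [AddCommGroup W] [Module F W] (Q' : QuadraticForm F W),
    QLat.Nondeg Q' → PosDef F Q' → Module.finrank F W = n →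
    ∀ N : Set W, QLat.IsLatticeOn (OF F) N → QLat.IsIntegral (OF F) Q' N →
      QLat.LatRep Q' Q N L

/-- `L` is `n`-regular: it represents every positive definite integral `O_F`-lattice `N`
of rank `n` which is represented by `L` locally at every finite place. -/
def IsNRegular (Q : QuadraticForm F V) (L : Set V) (n : ℕ) : Prop :=
  ∀ (W : Type) [AddCommGroup W] [Module F W] (Q' : QuadraticForm F W),
    QLat.Nondeg Q' → PosDef F Q' → Module.finrank F W = n →
    ∀ N : Set W, QLat.IsLatticeOn (OF F) N → QLat.IsIntegral (OF F) Q' N →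
      (∀ v : HeightOneSpectrum (NumberField.RingOfIntegers F),
        QLat.LatRep (Qv F Q' v) (Qv F Q v) (Lv F N v) (Lv F L v)) →
      QLat.LatRep Q' Q N L

/-- `L` is locally `n`-ADC: `L_v` is `n`-ADC for every finite place `v`. -/
def IsLocADC (Q : QuadraticForm F V) (L : Set V) (n : ℕ) : Prop :=
  ∀ v : HeightOneSpectrum (NumberField.RingOfIntegers F),
    QLat.IsADC (Ov F v) (Qv F Q v) (Lv F L v) n

/-- `L` is locally `n`-universal: `L_v` is `n`-universal for every finite place `v`. -/
def IsLocUniversal (Q : QuadraticForm F V) (L : Set V) (n : ℕ) : Prop :=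
  ∀ v : HeightOneSpectrum (NumberField.RingOfIntegers F),
    QLat.IsUniversal (Ov F v) (Qv F Q v) (Lv F L v) n

/-- `L` has class number one: every `O_F`-lattice in the genus of `L` (i.e. every lattice
on a space isometric to `F·L` which is isometric to `L` at every finite place) is
isometric to `L`. -/
def ClassNumberOne (Q : QuadraticForm F V) (L : Set V) : Prop :=
  ∀ (W : Type) [AddCommGroup W] [Module F W] (Q' : QuadraticForm F W),
    QLat.Nondeg Q' →
    ∀ N : Set W, QLat.IsLatticeOn (OF F) N →
      QLat.SpaceIsom Q' Q →
      (∀ v : HeightOneSpectrum (NumberField.RingOfIntegers F),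
        QLat.LatIsom (Qv F Q' v) (Qv F Q v) (Lv F N v) (Lv F L v)) →
      QLat.LatIsom Q' Q N L

end QGlob

section
open scoped TensorProduct
open IsDedekindDomain
open scoped WithZero

namespace HM

section Norm
variable {k : Type} [Field k]

/-- Norm group of `k(√a)`. -/
def Nm (a : k) : Subgroup kˣ where
  carrier := {b | ∃ x y : k, (b : k) = x ^ 2 - a * y ^ 2}
  one_mem' := ⟨1, 0, by simp⟩
  mul_mem' := by
    rintro b c ⟨x, y, h⟩ ⟨z, w, h'⟩
    exact ⟨x * z + a * y * w, x * w + y * z, by push_cast; rw [h, h']; ring⟩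
  inv_mem' := by
    rintro b ⟨x, y, h⟩
    refine ⟨x / b, y / b, ?_⟩
    have hb : (b : k) ≠ 0 := b.ne_zero
    rw [Units.val_inv_eq_inv_val, div_pow, div_pow]
    field_simp
    exact h

lemma mem_Nm {a : k} {b : kˣ} : b ∈ Nm a ↔ ∃ x y : k, (b : k) = x ^ 2 - a * y ^ 2 := Iff.rfl

end Norm

section Local
variable {k : Type} [Field k] (v : Valuation k ℤᵐ⁰)

lemma v_two_le : v 2 ≤ 1 := by
  have := v.map_add 1 1
  simpa [one_add_one_eq_two] using this

lemma v_four : v 4 = v 2 ^ 2 := by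
  rw [← map_pow]; norm_num

lemma v_four_le : v 4 ≤ 1 := by
  rw [v_four]; exact pow_le_one₀ zero_le (v_two_le v)

/-- units close to one -/
lemma v_one_add {x : k} (h : v x < 1) : v (1 + x) = 1 := by
  rw [v.map_add_eq_of_lt_left] <;> simp [h]

/-- the subgroup `1 + 4 m`. -/
def U4 : Subgroup kˣ where
  carrier := {c | v ((c : k) - 1) < v 4 ∨ c = 1}
  one_mem' := by simp
  mul_mem' := by
    rintro b c (hb | rfl) (hc | rfl)
    · left
      have : ((b * c : kˣ) : k) - 1 = ((b : k) - 1) * ((c : k) - 1) + ((b : k) - 1) + ((c : k) - 1) := by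
        push_cast; ring
      rw [this]
      refine v.map_add_lt (v.map_add_lt ?_ hb) hc
      rw [map_mul]
      calc _ ≤ v ((b : k) - 1) * 1 := by
            gcongr; exact (hc.trans_le (v_four_le v)).le
        _ < _ := by simpa using hb
    · left; simpa using hb
    · left; simpa using hc
    · right; simp
  inv_mem' := by
    rintro b (hb | rfl)
    · left
      have h1 : v (b : k) = 1 := by
        have := v_one_add v (hb.trans_le (v_four_le v))
        simpa using this
      have : ((b⁻¹ : kˣ) : k) - 1 = - (((b : k) - 1) * ((b⁻¹ : kˣ) : k)) := by
        have := b.mul_inv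
        rw [sub_mul, this]; ring
      rw [this, Valuation.map_neg, map_mul, Units.val_inv_eq_inv_val, map_inv₀, h1]
      simpa using hb
    · right; simp

/-- the local squares -/
def Sq : Subgroup kˣ := (powMonoidHom 2 : kˣ →* kˣ).range ⊔ U4 v

lemma mem_U4 {c : kˣ} (h : v ((c : k) - 1) < v 4) : c ∈ U4 v := Or.inl h

lemma mem_Sq {c : kˣ} : c ∈ Sq v ↔ ∃ s u : kˣ, u ∈ U4 v ∧ s ^ 2 * u = c := by
  rw [Sq, Subgroup.mem_sup]
  constructor
  · rintro ⟨_, ⟨s, rfl⟩, u, hu, rfl⟩; exact ⟨s, u, hu, rfl⟩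
  · rintro ⟨s, u, hu, rfl⟩; exact ⟨_, ⟨s, rfl⟩, u, hu, rfl⟩

lemma sq_mem_Sq (s : kˣ) : s ^ 2 ∈ Sq v := (mem_Sq v).2 ⟨s, 1, one_mem _, by simp⟩
lemma U4_le_Sq : U4 v ≤ Sq v := le_sup_right

variable {v} in
lemma U4_val (h4 : v 4 ≠ 0) {u : kˣ} (h : u ∈ U4 v) : v ((u : k) - 1) < v 4 := by
  rcases h with h | rfl
  · exact h
  · simpa using zero_lt_iff.2 h4

variable {v} in
lemma U4_val_one {u : kˣ} (h : u ∈ U4 v) : v (u : k) = 1 := by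
  rcases h with h | rfl
  · simpa using v_one_add v (h.trans_le (v_four_le v))
  · simp

/-- `v 2 ≠ 0` from `2 ≠ 0`. -/
lemma Sq_val {c : kˣ} (h : c ∈ Sq v) : IsSquare (v (c : k)) := by
  obtain ⟨s, u, hu, rfl⟩ := (mem_Sq v).1 h
  refine ⟨v s, ?_⟩
  push_cast
  rw [map_mul, map_pow, U4_val_one hu, mul_one, sq]

/-- "unramified" parameter: no root of `t²+t=δ` modulo the maximal ideal. -/
def Unr (δ : k) : Prop := v δ ≤ 1 ∧ ∀ t : k, v t ≤ 1 → v (t ^ 2 + t - δ) = 1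

variable {v}

lemma Unr.congr {δ δ' : k} (h : Unr v δ) (h' : v (δ' - δ) < 1) : Unr v δ' := by
  refine ⟨?_, fun t ht => ?_⟩
  · have : δ' = δ + (δ' - δ) := by ring
    rw [this]; exact v.map_add_le h.1 h'.le
  · have : t ^ 2 + t - δ' = (t ^ 2 + t - δ) - (δ' - δ) := by ring
    rw [this, v.map_sub_eq_of_lt_left]
    · exact h.2 t ht
    · rw [h.2 t ht]; exact h'

lemma Unr.ne {δ : k} (h : Unr v δ) (t : k) : t ^ 2 + t - δ ≠ 0 ∧ IsSquare (v (t ^ 2 + t - δ)) := by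
  by_cases ht : v t ≤ 1
  · have := h.2 t ht
    refine ⟨fun h0 => by simp [h0] at this, by rw [this]; exact ⟨1, by simp⟩⟩
  · push Not at ht
    have h1 : v (t ^ 2 + t - δ) = v t ^ 2 := by
      have hlt : v t < v t ^ 2 := by
        rw [sq]; nth_rw 1 [← mul_one (v t)]
        exact mul_lt_mul_of_pos_left ht (zero_lt_one.trans ht)
      have : t ^ 2 + t - δ = t ^ 2 + (t - δ) := by ring
      rw [this, v.map_add_eq_of_lt_left, map_pow]
      rw [map_pow]
      exact v.map_sub_lt hlt (lt_of_le_of_lt h.1 (ht.trans hlt))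
    refine ⟨fun h0 => ?_, ⟨v t, by rw [h1, sq]⟩⟩
    rw [h0, map_zero] at h1
    have : v t ^ 2 ≠ 0 := pow_ne_zero _ (zero_lt_one.trans ht).ne'
    exact this h1.symm

/-- norms from the unramified extension have even valuation. -/
lemma Unr.norm_even (h2 : (2 : k) ≠ 0) {δ : k} (h : Unr v δ) (x y : k) (hxy : ¬ (x = 0 ∧ y = 0)) :
    x ^ 2 - (1 + 4 * δ) * y ^ 2 ≠ 0 ∧ IsSquare (v (x ^ 2 - (1 + 4 * δ) * y ^ 2)) := by
  by_cases hy : y = 0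
  · subst hy
    have hx : x ≠ 0 := by simpa using hxy
    refine ⟨by simpa using hx, ⟨v x, ?_⟩⟩
    simp [sq]
  · set t := (x / y - 1) / 2 with ht
    have e : x ^ 2 - (1 + 4 * δ) * y ^ 2 = (2 * y) ^ 2 * (t ^ 2 + t - δ) := by
      rw [ht]; field_simp; ring
    obtain ⟨h1, g, hg⟩ := h.ne t
    rw [e]
    refine ⟨mul_ne_zero (pow_ne_zero _ (mul_ne_zero h2 hy)) h1, ⟨v (2 * y) * g, ?_⟩⟩
    rw [map_mul, map_pow, hg]
    generalize v (2 * y) = A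
    rw [sq]; ac_rfl

/-- Basic hypotheses on a local valuation. -/
structure Good (v : Valuation k ℤᵐ⁰) : Prop where
  two : (2 : k) ≠ 0
  surj : Function.Surjective v
  res : ∃ X : Finset k, ∀ x, v x ≤ 1 → ∃ y ∈ X, v y ≤ 1 ∧ v (x - y) < 1

lemma Good.v2 (h : Good v) : v 2 ≠ 0 := (Valuation.ne_zero_iff v).2 h.two
lemma Good.v4 (h : Good v) : v 4 ≠ 0 := by rw [v_four]; exact pow_ne_zero _ h.v2
lemma Good.four (h : Good v) : (4 : k) ≠ 0 := (Valuation.ne_zero_iff v).1 h.v4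

lemma Good.finite_res (h : Good v) : Finite (IsLocalRing.ResidueField v.valuationSubring) := by
  obtain ⟨X, hX⟩ := h.res
  classical
  let f : {y : k // y ∈ X ∧ v y ≤ 1} → IsLocalRing.ResidueField v.valuationSubring :=
    fun y => IsLocalRing.residue _ ⟨y.1, y.2.2⟩
  have : Finite {y : k // y ∈ X ∧ v y ≤ 1} :=
    Finite.of_injective (fun y => (⟨y.1, y.2.1⟩ : X)) (fun a b hab => by
      apply Subtype.ext; simpa using hab)
  refine Finite.of_surjective f fun z => ?_
  obtain ⟨⟨x, hx⟩, rfl⟩ := IsLocalRing.residue_surjective z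
  obtain ⟨y, hy, hy1, hlt⟩ := hX x hx
  refine ⟨⟨y, hy, hy1⟩, ?_⟩
  rw [← sub_eq_zero, ← map_sub, IsLocalRing.residue_eq_zero_iff]
  rw [Valuation.mem_maximalIdeal_iff]
  simpa [Valuation.map_sub_swap] using hlt

lemma residue_eq_iff {x y : k} (hx : v x ≤ 1) (hy : v y ≤ 1) :
    IsLocalRing.residue v.valuationSubring ⟨x, hx⟩ = IsLocalRing.residue _ ⟨y, hy⟩ ↔ v (x - y) < 1 := by
  rw [← sub_eq_zero, ← map_sub, IsLocalRing.residue_eq_zero_iff,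
    Valuation.mem_maximalIdeal_iff]
  rfl

lemma Good.exists_unr (h : Good v) : ∃ δ, Unr v δ := by
  have := h.finite_res
  let κ := IsLocalRing.ResidueField v.valuationSubring
  let f : κ → κ := fun t => t ^ 2 + t
  have hf : ¬ Function.Surjective f := by
    rw [← Finite.injective_iff_surjective]
    intro hi
    have : f 0 = f (-1) := by simp [f]
    have := hi this
    simp at this
  simp only [Function.Surjective, not_forall, not_exists] at hf
  obtain ⟨d, hd⟩ := hf
  obtain ⟨⟨δ, hδ⟩, rfl⟩ := IsLocalRing.residue_surjective d
  refine ⟨δ, hδ, fun t ht => ?_⟩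
  have hle : v (t ^ 2 + t - δ) ≤ 1 := by
    refine v.map_sub_le (v.map_add_le ?_ ht) hδ
    rw [map_pow]; exact pow_le_one₀ zero_le ht
  refine le_antisymm hle (not_lt.1 fun hlt => hd (IsLocalRing.residue _ ⟨t, ht⟩) ?_)
  have hle' : v (t ^ 2 + t) ≤ 1 := by
    refine v.map_add_le ?_ ht
    rw [map_pow]; exact pow_le_one₀ zero_le ht
  have := (residue_eq_iff hle' hδ).2 hlt
  rw [← this]
  simp only [f, ← map_pow, ← map_add]
  rfl

lemma Good.sqrt_res (h : Good v) (hd : v 2 < 1) (u : k) (hu : v u ≤ 1) :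
    ∃ w, v w ≤ 1 ∧ v (u - w ^ 2) < 1 := by
  have := h.finite_res
  let κ := IsLocalRing.ResidueField v.valuationSubring
  have h2 : (2 : κ) = 0 := by
    have := (residue_eq_iff (v_two_le v) (x := 2) (y := 0) (by simp)).2 (by simpa using hd)
    rw [show (⟨0, by simp⟩ : v.valuationSubring) = 0 from rfl, map_zero] at this
    rw [← this]
    exact (map_ofNat (IsLocalRing.residue v.valuationSubring) 2).symm
  let f : κ → κ := fun t => t ^ 2
  have hf : Function.Surjective f := by
    rw [← Finite.injective_iff_surjective]
    intro a b hab
    have : (a - b) ^ 2 = 0 := by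
      have h3 : (a - b) ^ 2 = a ^ 2 - b ^ 2 - 2 * (a * b - b ^ 2) := by ring
      rw [h3, h2]; simp only [f] at hab; rw [hab]; ring
    exact sub_eq_zero.1 (pow_eq_zero_iff (two_ne_zero)|>.1 this)
  obtain ⟨w, hw⟩ := hf (IsLocalRing.residue _ ⟨u, hu⟩)
  obtain ⟨⟨w, hw1⟩, rfl⟩ := IsLocalRing.residue_surjective w
  refine ⟨w, hw1, ?_⟩
  have hle : v (w ^ 2) ≤ 1 := by rw [map_pow]; exact pow_le_one₀ zero_le hw1
  refine (residue_eq_iff hu hle).1 ?_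
  rw [← hw]
  simp only [f, ← map_pow]
  rfl

end Local
end HM

end

section
open scoped TensorProduct
open IsDedekindDomain
open scoped WithZero

namespace HM

section Local
variable {k : Type} [Field k] {v : Valuation k ℤᵐ⁰}

lemma isSq_mul_sq {g h : ℤᵐ⁰} (hh : h ≠ 0) : IsSquare (g * h ^ 2) ↔ IsSquare g := by
  constructor
  · rintro ⟨r, hr⟩
    refine ⟨r * h⁻¹, ?_⟩
    have : g = g * h ^ 2 * (h⁻¹) ^ 2 := by
      rw [mul_assoc, ← mul_pow, mul_inv_cancel₀ hh, one_pow, mul_one]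
    rw [this, hr, sq]
    ac_rfl
  · rintro ⟨r, rfl⟩
    exact ⟨r * h, by rw [sq]; ac_rfl⟩

lemma Nm_sq_mul (a : k) {s : k} (hs : s ≠ 0) : Nm (s ^ 2 * a) = Nm a := by
  ext b
  constructor
  · rintro ⟨x, y, h⟩
    exact ⟨x, s * y, by rw [h]; ring⟩
  · rintro ⟨x, y, h⟩
    exact ⟨x, y / s, by rw [h]; field_simp⟩

lemma mem_LNm {a : k} {b : kˣ} :
    b ∈ Nm a ⊔ Sq v ↔ ∃ u ∈ U4 v, ∃ x y : k, (b : k) * (u : kˣ) = x ^ 2 - a * y ^ 2 := by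
  rw [Subgroup.mem_sup]
  constructor
  · rintro ⟨c, ⟨x, y, hc⟩, d, hd, rfl⟩
    obtain ⟨s, u, hu, rfl⟩ := (mem_Sq v).1 hd
    refine ⟨u⁻¹, inv_mem hu, x * s, y * s, ?_⟩
    push_cast
    have := u.ne_zero
    rw [hc]; field_simp
  · rintro ⟨u, hu, x, y, h⟩
    refine ⟨b * u, ⟨x, y, by push_cast; exact h⟩, u⁻¹, U4_le_Sq v (inv_mem hu), by simp⟩

/-- Normal form of an element modulo squares. -/
lemma normal_form_aux (h : Good v) (n : ℕ) : ∀ (s α : k), s ≠ 0 → v (1 + α) = 1 → v α ≤ 1 →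
    v α ≤ v 4 * WithZero.exp (n : ℤ) →
    (∃ s' u : k, s' ≠ 0 ∧ v (u - 1) < v 4 ∧ s ^ 2 * (1 + α) = s' ^ 2 * u) ∨
    (∃ s' δ : k, s' ≠ 0 ∧ Unr v δ ∧ s ^ 2 * (1 + α) = s' ^ 2 * (1 + 4 * δ)) ∨
    (∃ s' β : k, s' ≠ 0 ∧ v 4 < v β ∧ v β < 1 ∧ ¬ IsSquare (v β) ∧
      s ^ 2 * (1 + α) = s' ^ 2 * (1 + β)) := by
  have h4 := h.four
  induction n with
  | zero =>
    intro s α hs h1 hα hα4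
    simp only [Nat.cast_zero, WithZero.exp_zero, mul_one] at hα4
    have hd : v (α / 4) ≤ 1 := by
      rw [map_div₀]; exact div_le_one_of_le₀ hα4 zero_le
    by_cases hu : Unr v (α / 4)
    · right; left
      exact ⟨s, α / 4, hs, hu, by rw [mul_div_cancel₀ _ h4]⟩
    · left
      simp only [Unr, hd, true_and, not_forall] at hu
      obtain ⟨t, ht, hne⟩ := hu
      have hlt : v (t ^ 2 + t - α / 4) < 1 := by
        refine lt_of_le_of_ne (v.map_sub_le (v.map_add_le ?_ ht) hd) hne
        rw [map_pow]; exact pow_le_one₀ zero_le ht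
      have hlt4 : v ((1 + α) - (1 + 2 * t) ^ 2) < v 4 := by
        have : (1 + α) - (1 + 2 * t) ^ 2 = 4 * (- (t ^ 2 + t - α / 4)) := by field_simp; ring
        rw [this, map_mul, Valuation.map_neg]
        have h40 : 0 < v 4 := zero_lt_iff.2 h.v4
        calc _ < v 4 * 1 := mul_lt_mul_of_pos_left hlt h40
          _ = _ := mul_one _
      have hsq : v ((1 + 2 * t) ^ 2) = 1 := by
        have e : (1 + 2 * t) ^ 2 = (1 + α) - ((1 + α) - (1 + 2 * t) ^ 2) := by ring
        rw [e, v.map_sub_eq_of_lt_left, h1]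
        rw [h1]; exact hlt4.trans_le (v_four_le v)
      have h0 : 1 + 2 * t ≠ 0 := by
        intro h0; rw [h0] at hsq; simp at hsq
      refine ⟨s * (1 + 2 * t), (1 + α) / (1 + 2 * t) ^ 2, mul_ne_zero hs h0, ?_, by field_simp⟩
      have : (1 + α) / (1 + 2 * t) ^ 2 - 1 = ((1 + α) - (1 + 2 * t) ^ 2) / (1 + 2 * t) ^ 2 := by
        field_simp
      rw [this, map_div₀, hsq, div_one]; exact hlt4
  | succ n ih =>
    intro s α hs h1 hα hα4
    by_cases hle : v α ≤ v 4 * WithZero.exp (n : ℤ)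
    · exact ih s α hs h1 hα hle
    have hlt : v 4 < v α := by
      refine lt_of_le_of_lt ?_ (not_le.1 hle)
      nth_rw 1 [← mul_one (v 4)]
      gcongr
      rw [← WithZero.exp_zero, WithZero.exp_le_exp]; positivity
    by_cases hsq : IsSquare (v α)
    · obtain ⟨g, hg⟩ := hsq
      obtain ⟨p, rfl⟩ := h.surj g
      have hp2 : v (p ^ 2) = v α := by rw [hg, map_pow, sq]
      have hα0 : v α ≠ 0 := (zero_le.trans_lt hlt).ne'
      have hp0 : p ≠ 0 := by rintro rfl; simp at hp2; exact hα0 (by rw [← hp2])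
      have hvp0 : 0 < v p := zero_lt_iff.2 ((Valuation.ne_zero_iff v).2 hp0)
      have h2p : v 2 < v p := by
        have : v 2 ^ 2 < v p ^ 2 := by rw [← v_four, ← map_pow, hp2]; exact hlt
        exact lt_of_pow_lt_pow_left₀ 2 zero_le this
      have hp1 : v p ≤ 1 := by
        have : v p ^ 2 ≤ 1 := by rw [← map_pow, hp2]; exact hα
        exact (pow_le_one_iff_of_nonneg zero_le two_ne_zero).1 this
      obtain ⟨w, hw1, hw⟩ := h.sqrt_res (h2p.trans_le hp1) (α / p ^ 2)
        (by rw [map_div₀, hp2, div_self hα0])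
      have hlt' : v ((1 + α) - (1 + p * w) ^ 2) < v α := by
        have : (1 + α) - (1 + p * w) ^ 2 = p ^ 2 * (α / p ^ 2 - w ^ 2) - 2 * p * w := by
          field_simp; ring
        rw [this]
        refine v.map_sub_lt ?_ ?_
        · rw [map_mul, hp2]
          calc _ < v α * 1 := mul_lt_mul_of_pos_left hw (zero_lt_iff.2 hα0)
            _ = _ := mul_one _
        · rw [map_mul, map_mul]
          calc v 2 * v p * v w ≤ v 2 * v p * 1 := by gcongr
            _ = v 2 * v p := mul_one _
            _ < v p * v p := mul_lt_mul_of_pos_right h2p hvp0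
            _ = _ := hg.symm
      have hsq : v ((1 + p * w) ^ 2) = 1 := by
        have e : (1 + p * w) ^ 2 = (1 + α) - ((1 + α) - (1 + p * w) ^ 2) := by ring
        rw [e, v.map_sub_eq_of_lt_left, h1]
        rw [h1]; exact hlt'.trans_le hα
      have h0 : 1 + p * w ≠ 0 := by
        intro h0; rw [h0] at hsq; simp at hsq
      set α' := (1 + α) / (1 + p * w) ^ 2 - 1 with hα'
      have hvα' : v α' = v ((1 + α) - (1 + p * w) ^ 2) := by
        have : α' = ((1 + α) - (1 + p * w) ^ 2) / (1 + p * w) ^ 2 := by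
          rw [hα']; field_simp
        rw [this, map_div₀, hsq, div_one]
      have e1 : s ^ 2 * (1 + α) = (s * (1 + p * w)) ^ 2 * (1 + α') := by
        rw [hα']; field_simp; ring
      rw [e1]
      refine ih _ α' (mul_ne_zero hs h0) ?_ ?_ ?_
      · rw [hα', add_sub_cancel, map_div₀, hsq, h1, div_one]
      · rw [hvα']; exact hlt'.le.trans hα
      · rw [hvα', ← WithZero.lt_mul_exp_iff_le (mul_ne_zero h.v4 (by simp))]
        refine hlt'.trans_le (hα4.trans_eq ?_)
        rw [mul_assoc, ← WithZero.exp_add]; push_cast; rfl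
    · right; right
      refine ⟨s, α, hs, hlt, lt_of_le_of_ne hα ?_, hsq, rfl⟩
      intro h1; exact hsq (by rw [h1]; exact ⟨1, by simp⟩)

lemma exists_exp_ge (h : Good v) : ∃ n : ℕ, 1 ≤ v 4 * WithZero.exp (n : ℤ) := by
  refine ⟨(- WithZero.log (v 4)).toNat, ?_⟩
  have : v 4 = WithZero.exp (WithZero.log (v 4)) := (WithZero.exp_log h.v4).symm
  nth_rw 1 [this]
  rw [← WithZero.exp_add, ← WithZero.exp_zero, WithZero.exp_le_exp]
  have := Int.self_le_toNat (- WithZero.log (v 4))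
  omega

lemma normal_form (h : Good v) (a : k) (ha : a ≠ 0) (hsq : IsSquare (v a)) :
    (∃ s' u : k, s' ≠ 0 ∧ v (u - 1) < v 4 ∧ a = s' ^ 2 * u) ∨
    (∃ s' δ : k, s' ≠ 0 ∧ Unr v δ ∧ a = s' ^ 2 * (1 + 4 * δ)) ∨
    (∃ s' β : k, s' ≠ 0 ∧ v 4 < v β ∧ v β < 1 ∧ ¬ IsSquare (v β) ∧
      a = s' ^ 2 * (1 + β)) := by
  obtain ⟨g, hg⟩ := hsq
  obtain ⟨s, rfl⟩ := h.surj g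
  have hva : v a ≠ 0 := (Valuation.ne_zero_iff v).2 ha
  have hs : s ≠ 0 := by rintro rfl; simp at hg; exact ha hg
  have e : a = s ^ 2 * (1 + (a / s ^ 2 - 1)) := by field_simp; ring
  have h1 : v (a / s ^ 2) = 1 := by
    rw [map_div₀, map_pow, hg, sq, div_self (by rwa [← hg])]
  have h2 : v (a / s ^ 2 - 1) ≤ 1 := v.map_sub_le h1.le (by simp)
  obtain ⟨n, hn⟩ := exists_exp_ge h
  have := normal_form_aux h n s (a / s ^ 2 - 1) hs (by simpa using h1) h2 (h2.trans hn)
  rwa [← e] at this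

lemma not_isSquare_exp : ¬ IsSquare (WithZero.exp (-1 : ℤ)) := by
  rintro ⟨r, hr⟩
  have h0 : r ≠ 0 := by rintro rfl; simp at hr
  have := congrArg WithZero.log hr
  rw [WithZero.log_mul h0 h0] at this
  simp at this
  omega

/-- Local norm groups are proper. -/
theorem L1a (h : Good v) (a : kˣ) (ha : a ∉ Sq v) : ∃ b : kˣ, b ∉ Nm (a : k) ⊔ Sq v := by
  obtain ⟨δ, hδ⟩ := h.exists_unr
  have hε : (1 + 4 * δ) ≠ 0 := by
    have := (hδ.norm_even h.two 0 1 (by simp)).1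
    intro h0; apply this; rw [h0]; simp
  have hclose : ∀ u ∈ U4 v, ∃ δ', Unr v δ' ∧ (1 + 4 * δ) * (u : kˣ) = 1 + 4 * δ' := by
    intro u hu
    have hu' := U4_val h.v4 hu
    have h4 := h.four
    refine ⟨δ + ((u : k) - 1) / 4 * (1 + 4 * δ), hδ.congr ?_, by field_simp; ring⟩
    rw [add_sub_cancel_left, map_mul, map_div₀]
    have h1 : v (1 + 4 * δ) ≤ 1 := by
      refine v.map_add_le (by simp) ?_
      rw [map_mul]; exact mul_le_one' (v_four_le v) hδ.1
    calc _ ≤ v ((u : k) - 1) / v 4 * 1 := by gcongr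
      _ < 1 := by rw [mul_one]; exact (div_lt_one₀ (zero_lt_iff.2 h.v4)).2 hu'
  by_cases hsq : IsSquare (v (a : k))
  · rcases normal_form h a a.ne_zero hsq with ⟨s, u, hs, hu, e⟩ | ⟨s, δ, hs, hδ, e⟩ |
      ⟨s, α, hs, h4α, hα1, hαsq, e⟩
    · exfalso
      have hu1 : v u = 1 := by
        simpa using v_one_add v (hu.trans_le (v_four_le v))
      have hu0 : u ≠ 0 := by rintro rfl; simp at hu1
      exact ha ((mem_Sq v).2 ⟨Units.mk0 s hs, Units.mk0 u hu0, mem_U4 v hu,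
        by ext; simpa using e.symm⟩)
    · obtain ⟨π, hπ⟩ := h.surj (WithZero.exp (-1))
      have hπ0 : π ≠ 0 := by rintro rfl; rw [map_zero] at hπ; exact WithZero.exp_ne_zero hπ.symm
      refine ⟨Units.mk0 π hπ0, ?_⟩
      rw [e, Nm_sq_mul _ hs, mem_LNm]
      rintro ⟨u, hu, x, y, hxy⟩
      have hne : ¬ (x = 0 ∧ y = 0) := by
        rintro ⟨rfl, rfl⟩
        simp [hπ0] at hxy
      have := (hδ.norm_even h.two x y hne).2
      rw [← hxy, map_mul, U4_val_one hu, mul_one, Units.val_mk0, hπ] at this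
      exact not_isSquare_exp this
    · have hα0 : α ≠ 0 := by rintro rfl; simp at h4α
      set β := - 4 * δ / α with hβ
      have hβ1 : v β < 1 := by
        rw [hβ, map_div₀, map_mul, Valuation.map_neg, div_lt_one₀ (zero_le.trans_lt h4α)]
        exact lt_of_le_of_lt (mul_le_of_le_one_right zero_le hδ.1) h4α
      have hb1 := v_one_add v hβ1
      have hb0 : 1 + β ≠ 0 := by intro h0; rw [h0] at hb1; simp at hb1
      refine ⟨Units.mk0 (1 + β) hb0, ?_⟩
      rw [e, Nm_sq_mul _ hs, mem_LNm]
      rintro ⟨u, hu, X0, Y0, hxy⟩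
      rw [Units.val_mk0] at hxy
      set A := 1 + α with hA
      set C := -α * ((1 + β) * (u : kˣ)) with hC
      set X := X0 + A * Y0 with hX
      set Y := X0 + Y0 with hY
      have hCn : C = X ^ 2 - A * Y ^ 2 := by
        rw [hC, hxy, hX, hY, hA]; ring
      have h4 := h.four
      have hA1 : v A = 1 := v_one_add v hα1
      have hvC : v C = v α := by
        rw [hC, map_mul, map_mul, Valuation.map_neg, hb1, U4_val_one hu]; simp
      obtain ⟨δ', hδ', hAC⟩ : ∃ δ', Unr v δ' ∧ A + C = 1 + 4 * δ' := by
        refine ⟨(A + C - 1) / 4, hδ.congr ?_, by field_simp; ring⟩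
        have e2 : (A + C - 1) / 4 - δ = - (α * (1 + β) * (((u : k) - 1) / 4)) := by
          rw [hC, hA, hβ]; field_simp; ring
        rw [e2, Valuation.map_neg, map_mul, map_mul, hb1, mul_one, map_div₀]
        have := U4_val h.v4 hu
        calc _ ≤ 1 * (v ((u : k) - 1) / v 4) := by gcongr
          _ < 1 := by rw [one_mul]; exact (div_lt_one₀ (zero_lt_iff.2 h.v4)).2 this
      have key : (A * Y + C) ^ 2 - (1 + 4 * δ') * X ^ 2 = - (A * C * (Y - 1) ^ 2) := by
        rw [← hAC]
        have : X ^ 2 = C + A * Y ^ 2 := by rw [hCn]; ring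
        rw [this]; ring
      have hA0 : A ≠ 0 := by intro h0; rw [h0] at hA1; simp at hA1
      have hC0 : C ≠ 0 := by
        intro h0; rw [h0] at hvC; rw [map_zero] at hvC; exact hα0 ((Valuation.zero_iff v).1 hvC.symm)
      by_cases hY1 : Y = 1
      · by_cases hz : A * Y + C = 0 ∧ X = 0
        · have : A = - C := by rw [hY1] at hz; linear_combination hz.1
          rw [this, Valuation.map_neg, hvC] at hA1
          exact hα1.ne hA1
        · apply (hδ'.norm_even h.two _ _ hz).1
          rw [key, hY1]; simp
      · have hz : ¬ (A * Y + C = 0 ∧ X = 0) := by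
          rintro ⟨h1, h2⟩
          rw [h1, h2] at key
          have : A * C * (Y - 1) ^ 2 = 0 := by linear_combination key
          have h3 : Y - 1 ≠ 0 := sub_ne_zero.2 hY1
          exact (mul_ne_zero (mul_ne_zero hA0 hC0) (pow_ne_zero 2 h3)) this
        have := (hδ'.norm_even h.two _ _ hz).2
        rw [key, Valuation.map_neg, map_mul, map_mul, hA1, one_mul, hvC, map_pow,
          isSq_mul_sq ((Valuation.ne_zero_iff v).2 (sub_ne_zero.2 hY1))] at this
        exact hαsq this
  · refine ⟨Units.mk0 _ hε, ?_⟩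
    rw [mem_LNm]
    rintro ⟨u, hu, x, y, hxy⟩
    obtain ⟨δ', hδ', e⟩ := hclose u hu
    rw [Units.val_mk0, e] at hxy
    have e2 : (a : k) * y ^ 2 = x ^ 2 - (1 + 4 * δ') * 1 ^ 2 := by linear_combination hxy
    obtain ⟨h1, h2⟩ := hδ'.norm_even h.two x 1 (by simp)
    rw [← e2] at h1 h2
    have hy : y ≠ 0 := by rintro rfl; simp at h1
    rw [map_mul, map_pow, isSq_mul_sq ((Valuation.ne_zero_iff v).2 hy)] at h2
    exact hsq h2

end Local
end HM

end

section
open scoped TensorProduct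
open IsDedekindDomain
open scoped WithZero

namespace HM

/-- For a finite commutative group, `[G:G²] = |G[2]|`. -/
lemma index_range_pow (G : Type) [CommGroup G] [Finite G] :
    (powMonoidHom 2 : G →* G).range.index = Nat.card (powMonoidHom 2 : G →* G).ker := by
  have h1 := (powMonoidHom 2 : G →* G).range.card_mul_index
  have h2 := (powMonoidHom 2 : G →* G).ker.card_mul_index
  rw [Subgroup.index_ker] at h2
  have h3 : Nat.card (powMonoidHom 2 : G →* G).range ≠ 0 := Nat.card_pos.ne'
  apply Nat.eq_of_mul_eq_mul_left (Nat.pos_of_ne_zero h3)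
  rw [h1, ← h2, mul_comm]

section Local
variable {k : Type} [Field k] {v : Valuation k ℤᵐ⁰}

variable (v) in
/-- valuation units -/
def Uv : Subgroup kˣ where
  carrier := {c | v (c : k) = 1}
  one_mem' := by simp
  mul_mem' := by
    intro a b ha hb
    simp only [Set.mem_ofPred_eq] at *
    push_cast; rw [map_mul, ha, hb, one_mul]
  inv_mem' := by
    intro a ha
    simp only [Set.mem_ofPred_eq] at *
    rw [Units.val_inv_eq_inv_val, map_inv₀, ha, inv_one]

lemma mem_Uv {c : kˣ} : c ∈ Uv v ↔ v (c : k) = 1 := Iff.rfl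

lemma Good.res_pow (h : Good v) (n : ℕ) :
    ∃ X : Finset k, ∀ x, v x ≤ 1 → ∃ y ∈ X, v (x - y) ≤ WithZero.exp (-(n : ℤ)) := by
  classical
  obtain ⟨π, hπ⟩ := h.surj (WithZero.exp (-1))
  have hπ0 : π ≠ 0 := by rintro rfl; rw [map_zero] at hπ; exact WithZero.exp_ne_zero hπ.symm
  obtain ⟨X0, hX0⟩ := h.res
  induction n with
  | zero => exact ⟨{0}, fun x hx => ⟨0, by simp, by simpa using hx⟩⟩
  | succ n ih =>
    obtain ⟨X, hX⟩ := ih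
    refine ⟨(X0 ×ˢ X).image (fun p => p.1 + π * p.2), fun x hx => ?_⟩
    obtain ⟨y, hy, -, hxy⟩ := hX0 x hx
    have h1 : v ((x - y) / π) ≤ 1 := by
      rw [map_div₀, hπ, ← WithZero.lt_mul_exp_iff_le one_ne_zero, one_mul, div_eq_mul_inv,
        ← WithZero.exp_neg, neg_neg]
      calc _ < 1 * WithZero.exp 1 := mul_lt_mul_of_pos_right hxy (by simp)
        _ = _ := one_mul _
    obtain ⟨z, hz, hxz⟩ := hX _ h1
    refine ⟨y + π * z, Finset.mem_image.2 ⟨(y, z), by simp [hy, hz], rfl⟩, ?_⟩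
    have : x - (y + π * z) = π * ((x - y) / π - z) := by field_simp; ring
    rw [this, map_mul, hπ]
    calc _ ≤ WithZero.exp (-1) * WithZero.exp (-(n : ℤ)) := by gcongr
      _ = _ := by rw [← WithZero.exp_add]; congr 1; push_cast; ring

lemma finite_U_quot (h : Good v) : Finite (Uv v ⧸ (U4 v).subgroupOf (Uv v)) := by
  classical
  obtain ⟨n, hn⟩ := exists_exp_ge h
  obtain ⟨X, hX⟩ := h.res_pow (n + 1)
  let f : Uv v → X := fun c => ⟨(hX (c : kˣ) (le_of_eq c.2)).choose,
    (hX (c : kˣ) (le_of_eq c.2)).choose_spec.1⟩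
  have hf : ∀ c : Uv v, v (((c : kˣ) : k) - (f c : k)) ≤ WithZero.exp (-((n + 1 : ℕ) : ℤ)) :=
    fun c => (hX (c : kˣ) (le_of_eq c.2)).choose_spec.2
  have hn' : WithZero.exp (-((n + 1 : ℕ) : ℤ)) < v 4 := by
    have : WithZero.exp (-(n : ℤ)) ≤ v 4 := by
      calc _ = 1 * WithZero.exp (-(n : ℤ)) := (one_mul _).symm
        _ ≤ v 4 * WithZero.exp (n : ℤ) * WithZero.exp (-(n : ℤ)) := by gcongr
        _ = v 4 := by rw [mul_assoc, ← WithZero.exp_add]; simp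
    refine lt_of_lt_of_le ?_ this
    rw [WithZero.exp_lt_exp]; push_cast; omega
  have key : ∀ c d : Uv v, f c = f d → (QuotientGroup.mk c : Uv v ⧸ (U4 v).subgroupOf (Uv v)) = QuotientGroup.mk d := by
    intro c d hcd
    rw [QuotientGroup.eq, Subgroup.mem_subgroupOf]
    apply mem_U4
    have h1 := hf c
    have h2 := hf d
    rw [hcd] at h1
    have h3 : v (((d : kˣ) : k) - ((c : kˣ) : k)) < v 4 := by
      have e : ((d : kˣ) : k) - ((c : kˣ) : k) = (((d : kˣ) : k) - (f d : k)) - (((c : kˣ) : k) - (f d : k)) := by ring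
      rw [e]
      exact (v.map_sub_le h2 h1).trans_lt hn'
    have hc := c.2
    rw [mem_Uv] at hc
    have e : (((c⁻¹ * d : Uv v) : kˣ) : k) - 1 = (((d : kˣ) : k) - ((c : kˣ) : k)) / ((c : kˣ) : k) := by
      push_cast
      have := (c : kˣ).ne_zero
      field_simp
    rw [e, map_div₀, hc, div_one]; exact h3
  refine Finite.of_injective (fun q : Uv v ⧸ (U4 v).subgroupOf (Uv v) => f q.out) ?_
  intro p q hpq
  have := key _ _ hpq
  simpa using this

/-- bound on unit square classes -/
lemma Sq_relIndex_Uv (h : Good v) (X : Finset k) (hX : ∀ x, v x ≤ 1 → ∃ y ∈ X, v (x - y) ≤ v 2) :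
    (Sq v).relIndex (Uv v) ≠ 0 ∧ (Sq v).relIndex (Uv v) ≤ 2 * X.card := by
  classical
  have hfin := finite_U_quot h
  set N := (U4 v).subgroupOf (Uv v)
  let G := Uv v ⧸ N
  let _ : CommGroup G := QuotientGroup.Quotient.commGroup N
  obtain ⟨π, hπ⟩ := h.surj (WithZero.exp (-1))
  have hπ0 : π ≠ 0 := by rintro rfl; rw [map_zero] at hπ; exact WithZero.exp_ne_zero hπ.symm
  have hπ1 : v π < 1 := by rw [hπ, ← WithZero.exp_zero, WithZero.exp_lt_exp]; omega
  have h2 := h.two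
  -- the 2-torsion
  have tors : ∀ c : (powMonoidHom 2 : G →* G).ker, ∃ p : Bool × X,
      v (((((c : G).out : Uv v) : kˣ) : k) - ((if p.1 then 1 else -1) + 2 * π * p.2)) ≤ v (4 * π) := by
    rintro ⟨c, hc⟩
    obtain ⟨x, rfl⟩ : ∃ x : Uv v, QuotientGroup.mk x = c := ⟨c.out, by simp⟩
    have hx2 : ((QuotientGroup.mk x : G).out)^2 ∈ N := by
      have : (QuotientGroup.mk (((QuotientGroup.mk x : G).out)^2) : G) = 1 := by
        rw [QuotientGroup.mk_pow]; simpa using hc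
      rwa [QuotientGroup.eq_one_iff] at this
    simp only
    set z := (QuotientGroup.mk x : G).out
    rw [Subgroup.mem_subgroupOf] at hx2
    have hz := U4_val h.v4 hx2
    push_cast at hz
    set y := (((z : kˣ) : k) - 1) / 2 with hy
    have ez : ((z : kˣ) : k) = 1 + 2 * y := by rw [hy]; field_simp; ring
    rw [ez] at hz ⊢
    have hz' : v (y * (y + 1)) < 1 := by
      have e : (1 + 2 * y) ^ 2 - 1 = 4 * (y * (y + 1)) := by ring
      rw [e, map_mul] at hz
      by_contra hcon
      push Not at hcon
      have : v 4 * 1 ≤ v 4 * v (y * (y + 1)) := by gcongr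
      rw [mul_one] at this
      exact absurd hz (not_lt.2 this)
    have hdiv : ∀ w, v w < 1 → ∃ r ∈ X, v (2 * w - 2 * π * r) ≤ v (4 * π) := by
      intro w hw
      have h1 : v (w / π) ≤ 1 := by
        rw [map_div₀, hπ, ← WithZero.lt_mul_exp_iff_le one_ne_zero, one_mul, div_eq_mul_inv,
          ← WithZero.exp_neg, neg_neg]
        calc _ < 1 * WithZero.exp 1 := mul_lt_mul_of_pos_right hw (by simp)
          _ = _ := one_mul _
      obtain ⟨r, hr, hle⟩ := hX _ h1
      refine ⟨r, hr, ?_⟩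
      have e : 2 * w - 2 * π * r = 2 * π * (w / π - r) := by field_simp
      have e4 : (4 * π) = 2 * π * 2 := by ring
      rw [e, e4, map_mul, map_mul _ _ (2 : k)]
      gcongr
    by_cases hy1 : v y < 1
    · obtain ⟨r, hr, hle⟩ := hdiv y hy1
      refine ⟨(true, ⟨r, hr⟩), ?_⟩
      have e : 1 + 2 * y - ((if true = true then (1 : k) else -1) + 2 * π * r) = 2 * y - 2 * π * r := by
        simp
      change v (1 + 2 * y - ((if _ = true then (1 : k) else -1) + 2 * π * r)) ≤ _
      rw [e]; exact hle
    · have hy2 : v (y + 1) < 1 := by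
        push Not at hy1
        by_contra hcon
        push Not at hcon
        rw [map_mul] at hz'
        exact absurd hz' (not_lt.2 (one_le_mul hy1 hcon))
      obtain ⟨r, hr, hle⟩ := hdiv _ hy2
      refine ⟨(false, ⟨r, hr⟩), ?_⟩
      have e : 1 + 2 * y - ((if false = true then (1 : k) else -1) + 2 * π * r) = 2 * (y + 1) - 2 * π * r := by
        simp; ring
      change v (1 + 2 * y - ((if _ = true then (1 : k) else -1) + 2 * π * r)) ≤ _
      rw [e]; exact hle
  choose f hf using tors
  have hfinj : Function.Injective f := by
    intro c d hcd
    have h1 := hf c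
    have h2 := hf d
    rw [hcd] at h1
    set A := ((if (f d).1 = true then (1 : k) else -1) + 2 * π * (f d).2)
    set c' := (c : G).out with hc'
    set d' := (d : G).out with hd'
    have h3 : v (((d' : kˣ) : k) - ((c' : kˣ) : k)) < v 4 := by
      have e : ((d' : kˣ) : k) - ((c' : kˣ) : k) = (((d' : kˣ) : k) - A) - (((c' : kˣ) : k) - A) := by ring
      rw [e]
      refine (v.map_sub_le h2 h1).trans_lt ?_
      rw [map_mul]
      calc _ < v 4 * 1 := mul_lt_mul_of_pos_left hπ1 (zero_lt_iff.2 h.v4)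
        _ = _ := mul_one _
    have : (QuotientGroup.mk c' : G) = QuotientGroup.mk d' := by
      rw [QuotientGroup.eq, Subgroup.mem_subgroupOf]
      apply mem_U4
      have hc := c'.2
      rw [mem_Uv] at hc
      have e : (((c'⁻¹ * d' : Uv v) : kˣ) : k) - 1 = (((d' : kˣ) : k) - ((c' : kˣ) : k)) / ((c' : kˣ) : k) := by
        push_cast
        have := (c' : kˣ).ne_zero
        field_simp
      rw [e, map_div₀, hc, div_one]; exact h3
    apply Subtype.ext
    simpa [hc', hd'] using this
  have hcard : Nat.card (powMonoidHom 2 : G →* G).ker ≤ 2 * X.card := by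
    have := Nat.card_le_card_of_injective f hfinj
    simpa [Nat.card_prod] using this
  rw [← index_range_pow] at hcard
  have hind : ((powMonoidHom 2 : G →* G).range.comap (QuotientGroup.mk' N)).index =
      (powMonoidHom 2 : G →* G).range.index :=
    Subgroup.index_comap_of_surjective _ (QuotientGroup.mk'_surjective N)
  have hle : (powMonoidHom 2 : G →* G).range.comap (QuotientGroup.mk' N) ≤ (Sq v).subgroupOf (Uv v) := by
    rintro x ⟨y, hy⟩
    obtain ⟨y, rfl⟩ := QuotientGroup.mk'_surjective N y
    rw [powMonoidHom_apply, ← map_pow] at hy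
    have : (y ^ 2)⁻¹ * x ∈ N := by
      rw [← QuotientGroup.eq]; exact hy
    rw [Subgroup.mem_subgroupOf] at this ⊢
    have h3 := mul_mem (sq_mem_Sq v (y : kˣ)) (U4_le_Sq v this)
    simpa using h3
  have hne : ((powMonoidHom 2 : G →* G).range.comap (QuotientGroup.mk' N)).index ≠ 0 := by
    rw [hind]; exact Subgroup.FiniteIndex.index_ne_zero
  have hdvd := Subgroup.index_dvd_of_le hle
  rw [Subgroup.relIndex]
  refine ⟨fun h0 => hne (by rw [h0] at hdvd; exact Nat.eq_zero_of_zero_dvd hdvd), ?_⟩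
  refine (Nat.le_of_dvd (Nat.pos_of_ne_zero hne) hdvd).trans ?_
  rw [hind]; exact hcard

variable (v) in
/-- parity of the valuation -/
def parity : kˣ →* Multiplicative (ZMod 2) where
  toFun c := Multiplicative.ofAdd ((WithZero.log (v (c : k)) : ℤ) : ZMod 2)
  map_one' := by simp
  map_mul' a b := by
    have ha : v (a : k) ≠ 0 := (Valuation.ne_zero_iff v).2 a.ne_zero
    have hb : v (b : k) ≠ 0 := (Valuation.ne_zero_iff v).2 b.ne_zero
    push_cast
    rw [map_mul, WithZero.log_mul ha hb]; push_cast; rfl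

lemma parity_ker_le (h : Good v) : (parity v).ker ≤ Sq v ⊔ Uv v := by
  intro c hc
  have hc' : ((WithZero.log (v (c : k)) : ℤ) : ZMod 2) = 0 := hc
  rw [ZMod.intCast_zmod_eq_zero_iff_dvd] at hc'
  obtain ⟨m, hm⟩ := hc'
  obtain ⟨s, hs⟩ := h.surj (WithZero.exp m)
  have hs0 : s ≠ 0 := by rintro rfl; rw [map_zero] at hs; exact WithZero.exp_ne_zero hs.symm
  have hvc : v (c : k) ≠ 0 := (Valuation.ne_zero_iff v).2 c.ne_zero
  have : c = (Units.mk0 s hs0) ^ 2 * ((Units.mk0 s hs0) ^ 2)⁻¹ * c := by simp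
  rw [this, mul_assoc]
  refine Subgroup.mul_mem_sup (sq_mem_Sq v _) ?_
  rw [mem_Uv]
  push_cast
  rw [map_mul, map_inv₀, map_pow, Units.val_mk0, hs]
  rw [← WithZero.exp_log hvc, hm]
  simp only [← WithZero.exp_nsmul, ← WithZero.exp_neg, ← WithZero.exp_add]
  rw [← WithZero.exp_zero]; congr 1; push_cast; simp

theorem L2 (h : Good v) (X : Finset k) (hX : ∀ x, v x ≤ 1 → ∃ y ∈ X, v (x - y) ≤ v 2) :
    (Sq v).index ≠ 0 ∧ (Sq v).index ≤ 4 * X.card := by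
  obtain ⟨h1, h2⟩ := Sq_relIndex_Uv h X hX
  have e1 : (Sq v).relIndex (Sq v ⊔ Uv v) * (Sq v ⊔ Uv v).index = (Sq v).index :=
    Subgroup.relIndex_mul_index le_sup_left
  have e2 : (Sq v).relIndex (Sq v ⊔ Uv v) = (Sq v).relIndex (Uv v) := by
    rw [sup_comm]; exact Subgroup.relIndex_sup_right _ _
  have e3 : (parity v).ker.index ≤ 2 := by
    rw [Subgroup.index_ker]
    refine (Nat.card_le_card_of_injective _ (Subtype.val_injective)).trans ?_
    simp
  have e4 : (parity v).ker.index ≠ 0 := by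
    rw [Subgroup.index_ker]; exact Nat.card_pos.ne'
  have e5 := Subgroup.index_dvd_of_le (parity_ker_le h)
  have e6 : (Sq v ⊔ Uv v).index ≤ 2 := (Nat.le_of_dvd (Nat.pos_of_ne_zero e4) e5).trans e3
  have e7 : (Sq v ⊔ Uv v).index ≠ 0 := fun h0 => e4 (by
    rw [h0] at e5; exact Nat.eq_zero_of_zero_dvd e5)
  rw [← e1, e2]
  refine ⟨mul_ne_zero h1 e7, ?_⟩
  calc _ ≤ (2 * X.card) * 2 := Nat.mul_le_mul h2 e6
    _ = _ := by ring

end Local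
end HM

end

section
open scoped TensorProduct
open IsDedekindDomain
open scoped WithZero

namespace HM

/-- finite places -/
abbrev Pl (k : Type) [Field k] [NumberField k] := HeightOneSpectrum (NumberField.RingOfIntegers k)
/-- the valuation -/
abbrev vl {k : Type} [Field k] [NumberField k] (v : Pl k) : Valuation k ℤᵐ⁰ := v.valuation k

section NF
variable {k : Type} [Field k] [NumberField k]
local notation "𝓞k" => NumberField.RingOfIntegers k

lemma vl_int (v : Pl k) (a : 𝓞k) : vl v (algebraMap 𝓞k k a) ≤ 1 := v.valuation_le_one a

lemma vl_int_pow (v : Pl k) (a : 𝓞k) (n : ℕ) :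
    vl v (algebraMap 𝓞k k a) ≤ WithZero.exp (-(n : ℤ)) ↔ a ∈ v.asIdeal ^ n := by
  rw [← v.intValuation_le_pow_iff_mem, ← v.valuation_of_algebraMap (K := k)]

lemma approx_int (v : Pl k) {x : k} (hx : vl v x ≤ 1) (n : ℕ) :
    ∃ a : 𝓞k, vl v (x - algebraMap 𝓞k k a) ≤ WithZero.exp (-(n : ℤ)) := by
  obtain ⟨a, ha⟩ := v.exists_valuation_sub_lt_of_integer hx (Units.mk0 (WithZero.exp (-(n : ℤ))) (by simp))
  refine ⟨a, ?_⟩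
  rw [Valuation.map_sub_swap]
  exact ha.le

lemma pow_ne_bot (v : Pl k) (n : ℕ) : v.asIdeal ^ n ≠ ⊥ := by
  rw [← Ideal.zero_eq_bot]
  exact pow_ne_zero _ (by rw [Ideal.zero_eq_bot]; exact v.ne_bot)

lemma finite_quot_pow (v : Pl k) (n : ℕ) : Finite (𝓞k ⧸ v.asIdeal ^ n) :=
  Ideal.finiteQuotientOfFreeOfNeBot _ (pow_ne_bot v n)

lemma exists_reps (v : Pl k) (n : ℕ) : ∃ X : Finset k, X.card ≤ Ideal.absNorm (v.asIdeal ^ n) ∧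
    ∀ x, vl v x ≤ 1 → ∃ y ∈ X, vl v y ≤ 1 ∧ vl v (x - y) ≤ WithZero.exp (-(n : ℤ)) := by
  classical
  have := finite_quot_pow v n
  have := Fintype.ofFinite (𝓞k ⧸ v.asIdeal ^ n)
  refine ⟨(Finset.univ : Finset (𝓞k ⧸ v.asIdeal ^ n)).image (fun q => algebraMap 𝓞k k q.out), ?_, ?_⟩
  · refine Finset.card_image_le.trans ?_
    rw [Finset.card_univ, Ideal.absNorm_apply, Submodule.cardQuot_apply, Nat.card_eq_fintype_card]
  · intro x hx
    obtain ⟨a, ha⟩ := approx_int v hx n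
    refine ⟨_, Finset.mem_image.2 ⟨Ideal.Quotient.mk _ a, Finset.mem_univ _, rfl⟩, v.valuation_le_one _, ?_⟩
    set b := (Ideal.Quotient.mk (v.asIdeal ^ n) a).out with hb
    have hab : a - b ∈ v.asIdeal ^ n := by
      rw [← Ideal.Quotient.eq, hb]; exact (Quotient.out_eq' _).symm
    have h2 : vl v (algebraMap 𝓞k k (a - b)) ≤ WithZero.exp (-(n : ℤ)) := by
      rw [vl_int_pow]; exact hab
    have e : x - algebraMap 𝓞k k b = (x - algebraMap 𝓞k k a) + algebraMap 𝓞k k (a - b) := by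
      rw [map_sub]; ring
    rw [e]
    exact (vl v).map_add_le ha h2

lemma good_vl (v : Pl k) : Good (vl v) where
  two := two_ne_zero
  surj := v.valuation_surjective k
  res := by
    obtain ⟨X, -, hX⟩ := exists_reps v 1
    refine ⟨X, fun x hx => ?_⟩
    obtain ⟨y, hy, h1, h2⟩ := hX x hx
    refine ⟨y, hy, h1, h2.trans_lt ?_⟩
    rw [← WithZero.exp_zero, WithZero.exp_lt_exp]; simp

lemma exists_X2 : ∃ X : Pl k → Finset k, (∀ v x, vl v x ≤ 1 → ∃ y ∈ X v, vl v (x - y) ≤ vl v 2) ∧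
    ∀ S : Finset (Pl k), ∏ v ∈ S, (X v).card ≤ 2 ^ (Module.finrank ℚ k) := by
  classical
  have key : ∀ v : Pl k, ∃ e : ℕ, vl v 2 = WithZero.exp (-(e : ℤ)) := by
    intro v
    have h1 := v_two_le (vl v)
    have h0 := (good_vl v).v2
    refine ⟨(- WithZero.log (vl v 2)).toNat, ?_⟩
    have : WithZero.log (vl v 2) ≤ 0 := by
      rw [WithZero.log_le_iff_le_exp h0]; simpa using h1
    rw [Int.toNat_of_nonneg (by omega), neg_neg, WithZero.exp_log h0]
  choose e he using key
  choose X hX1 hX2 using fun v => exists_reps v (e v)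
  refine ⟨X, fun v x hx => ?_, fun S => ?_⟩
  · obtain ⟨y, hy, -, h⟩ := hX2 v x hx
    exact ⟨y, hy, by rw [he]; exact h⟩
  · have h1 : (∏ v ∈ S, v.asIdeal ^ e v) ∣ Ideal.span {(2 : 𝓞k)} := by
      apply Finset.prod_dvd_of_coprime
      · intro v _ w _ hvw
        simp only [Function.onFun]
        apply IsCoprime.pow
        rw [Ideal.isCoprime_iff_sup_eq]
        exact (v.isMaximal).coprime_of_ne w.isMaximal (fun h => hvw (HeightOneSpectrum.ext h))
      · intro v _
        rw [Ideal.dvd_span_singleton, ← vl_int_pow]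
        have := he v
        rw [map_ofNat]; exact this.le
    have h2 : (∏ v ∈ S, Ideal.absNorm (v.asIdeal ^ e v)) ∣ Ideal.absNorm (Ideal.span {(2 : 𝓞k)}) := by
      rw [← map_prod]
      exact Ideal.absNorm_dvd_absNorm_of_le (Ideal.dvd_iff_le.1 h1)
    have h3 : Ideal.absNorm (Ideal.span {(2 : 𝓞k)}) = 2 ^ (Module.finrank ℚ k) := by
      rw [Ideal.absNorm_span_singleton]
      have : (2 : 𝓞k) = algebraMap ℤ 𝓞k 2 := by simp
      rw [this, Algebra.norm_algebraMap, NumberField.RingOfIntegers.rank]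
      simp [Int.natAbs_pow]
    rw [h3] at h2
    refine le_trans (Finset.prod_le_prod' fun v _ => hX1 v) (Nat.le_of_dvd (by positivity) h2)

/-- a natural number highly divisible at given finite places -/
lemma exists_nat_small (S : Finset (Pl k)) (N : ℕ) :
    ∃ M : ℕ, 0 < M ∧ ∀ v ∈ S, vl v (M : k) ≤ WithZero.exp (-(N : ℤ)) := by
  refine ⟨∏ v ∈ S, Ideal.absNorm (v.asIdeal ^ N), ?_, fun v hv => ?_⟩
  · refine Finset.prod_pos fun v _ => Nat.pos_of_ne_zero ?_
    rw [Ideal.absNorm_ne_zero_iff]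
    exact finite_quot_pow v N
  · have h1 : ((∏ v ∈ S, Ideal.absNorm (v.asIdeal ^ N) : ℕ) : 𝓞k) ∈ v.asIdeal ^ N := by
      refine Ideal.mem_of_dvd _ ?_ (Ideal.absNorm_mem (v.asIdeal ^ N))
      apply Nat.cast_dvd_cast
      exact (Finset.dvd_prod_of_mem (fun w : Pl k => Ideal.absNorm (w.asIdeal ^ N)) hv)
    rw [← vl_int_pow] at h1
    rw [map_natCast] at h1
    exact h1

lemma exists_exp_lt (γ : ℤᵐ⁰) (h : γ ≠ 0) : ∃ n : ℕ, ∀ m : ℕ, n ≤ m → WithZero.exp (-(m : ℤ)) < γ := by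
  refine ⟨(- WithZero.log γ).toNat + 1, fun m hm => ?_⟩
  rw [← WithZero.exp_log h, WithZero.exp_lt_exp]
  have := Int.self_le_toNat (- WithZero.log γ)
  push_cast at *
  omega

lemma exists_unif_exp_lt {ι : Type} (S : Finset ι) (γ : ι → ℤᵐ⁰) (h : ∀ v, γ v ≠ 0) :
    ∃ n : ℕ, ∀ v ∈ S, WithZero.exp (-(n : ℤ)) < γ v := by
  classical
  choose n hn using fun v => exists_exp_lt (γ v) (h v)
  exact ⟨S.sup n, fun v hv => hn v _ (Finset.le_sup hv)⟩

theorem weak_approx (S : Finset (Pl k)) (x : Pl k → k) (γ : Pl k → ℤᵐ⁰) (hγ : ∀ v, γ v ≠ 0) :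
    ∃ y : k, ∀ v ∈ S, vl v (y - x v) < γ v := by
  classical
  obtain ⟨⟨D, hD⟩, hD'⟩ := IsLocalization.exist_integer_multiples_of_finset (nonZeroDivisors 𝓞k) (S.image x)
  have hD0 : (algebraMap 𝓞k k D) ≠ 0 := by
    simpa using nonZeroDivisors.ne_zero hD
  choose z hz using fun v : S => hD' (x v) (Finset.mem_image_of_mem x v.2)
  simp only [Algebra.smul_def] at hz
  obtain ⟨N, hN⟩ := exists_unif_exp_lt S (fun v => γ v * vl v (algebraMap 𝓞k k D)) (fun v =>
    mul_ne_zero (hγ v) ((Valuation.ne_zero_iff _).2 hD0))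
  obtain ⟨y, hy⟩ := IsDedekindDomain.exists_forall_sub_mem_ideal (s := S) (fun v : Pl k => v.asIdeal) (fun _ => N)
    (fun v _ => v.prime) (fun v _ w _ hvw h => hvw (HeightOneSpectrum.ext h)) z
  refine ⟨algebraMap 𝓞k k y / algebraMap 𝓞k k D, fun v hv => ?_⟩
  have h1 := hy v hv
  rw [← vl_int_pow, map_sub, hz] at h1
  have e : algebraMap 𝓞k k y / algebraMap 𝓞k k D - x v =
    (algebraMap 𝓞k k y - algebraMap 𝓞k k D * x v) / algebraMap 𝓞k k D := by field_simp
  rw [e, map_div₀, div_lt_iff₀ (zero_lt_iff.2 ((Valuation.ne_zero_iff _).2 hD0))]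
  exact h1.trans_lt (hN v hv)

lemma finite_real : Finite (k →+* ℝ) := by
  refine Finite.of_injective (fun φ : k →+* ℝ => (Complex.ofRealHom.comp φ : k →+* ℂ)) ?_
  intro φ ψ h
  ext x
  have := congrArg (fun f : k →+* ℂ => f x) h
  simpa using this

theorem weak_approx_small (S : Finset (Pl k)) (x : Pl k → k) (γ : Pl k → ℤᵐ⁰) (hγ : ∀ v, γ v ≠ 0)
    (ε : ℝ) (hε : 0 < ε) :
    ∃ y : k, (∀ v ∈ S, vl v (y - x v) < γ v) ∧ ∀ φ : k →+* ℝ, |φ y| < ε := by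
  classical
  obtain ⟨y, hy⟩ := weak_approx S x γ hγ
  have hfin : Finite (k →+* ℝ) := finite_real
  by_cases hy0 : y = 0
  · exact ⟨y, hy, fun φ => by simpa [hy0] using hε⟩
  have hvy : ∀ v : Pl k, vl v y ≠ 0 := fun v => (Valuation.ne_zero_iff _).2 hy0
  obtain ⟨N, hN⟩ := exists_unif_exp_lt S (fun v => min 1 (γ v * (vl v y)⁻¹)) (fun v => by
    have : 0 < min 1 (γ v * (vl v y)⁻¹) := lt_min zero_lt_one
      (zero_lt_iff.2 (mul_ne_zero (hγ v) (inv_ne_zero (hvy v))))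
    exact this.ne')
  obtain ⟨M, hM0, hM⟩ := exists_nat_small S N
  obtain ⟨B, hB⟩ : ∃ B : ℝ, ∀ φ : k →+* ℝ, |φ y| ≤ B := by
    obtain ⟨B, hB⟩ := (Set.finite_range (fun φ : k →+* ℝ => |φ y|)).bddAbove
    exact ⟨B, fun φ => hB ⟨φ, rfl⟩⟩
  obtain ⟨j, hj⟩ := exists_nat_gt (B / ε)
  have hpos : (0 : ℝ) < 1 + M * j := by positivity
  have h0 : (1 + M * j : k) ≠ 0 := by
    have : ((1 + M * j : ℕ) : k) ≠ 0 := Nat.cast_ne_zero.2 (by omega)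
    exact_mod_cast this
  refine ⟨y / (1 + M * j), fun v hv => ?_, fun φ => ?_⟩
  · have hMj : vl v (M * j : k) ≤ WithZero.exp (-(N : ℤ)) := by
      rw [map_mul]
      have : vl v (j : k) ≤ 1 := by
        have := vl_int v (j : 𝓞k)
        rwa [map_natCast] at this
      calc _ ≤ vl v (M : k) * 1 := by gcongr
        _ ≤ _ := by rw [mul_one]; exact hM v hv
    have hlt := hMj.trans_lt (hN v hv)
    have h1 := v_one_add (vl v) (hlt.trans_le (min_le_left _ _))
    have e : y / (1 + M * j) - x v = (y - x v) - y * (M * j) / (1 + M * j) := by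
      field_simp; ring
    rw [e]
    refine (vl v).map_sub_lt (hy v hv) ?_
    rw [map_div₀, h1, div_one, map_mul, mul_comm]
    have := hlt.trans_le (min_le_right _ _)
    rwa [← div_eq_mul_inv, lt_div_iff₀ (zero_lt_iff.2 (hvy v))] at this
  · rw [map_div₀, map_add, map_one, map_mul, map_natCast, map_natCast, abs_div, abs_of_pos hpos,
      div_lt_iff₀ hpos]
    refine (hB φ).trans_lt ?_
    rw [div_lt_iff₀ hε] at hj
    have : (j : ℝ) ≤ 1 + M * j := by
      have : (1 : ℝ) ≤ M := by exact_mod_cast hM0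
      nlinarith [(Nat.cast_nonneg j : (0 : ℝ) ≤ j)]
    nlinarith

end NF
end HM

end

section
open scoped TensorProduct
open IsDedekindDomain
open scoped WithZero

namespace HM

section NF
variable {k : Type} [Field k] [NumberField k]
local notation "𝓞k" => NumberField.RingOfIntegers k

lemma vl_ne_zero (v : Pl k) (u : kˣ) : vl v (u : k) ≠ 0 := (Valuation.ne_zero_iff _).2 u.ne_zero

/-- `S`-units -/
def US (S : Finset (Pl k)) : Subgroup kˣ where
  carrier := {u | ∀ v : Pl k, v ∉ S → vl v (u : k) = 1}
  one_mem' := by intro v _; simp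
  mul_mem' := by
    intro a b ha hb v hv
    push_cast; rw [map_mul, ha v hv, hb v hv, one_mul]
  inv_mem' := by
    intro a ha v hv
    rw [Units.val_inv_eq_inv_val, map_inv₀, ha v hv, inv_one]

lemma mem_US {S : Finset (Pl k)} {u : kˣ} : u ∈ US S ↔ ∀ v : Pl k, v ∉ S → vl v (u : k) = 1 := Iff.rfl

lemma US_mono {S T : Finset (Pl k)} (h : S ⊆ T) : US S ≤ US T :=
  fun _ hu v hv => hu v (fun hS => hv (h hS))

lemma vl_int_eq_one (v : Pl k) (a : 𝓞k) : vl v (algebraMap 𝓞k k a) = 1 ↔ a ∉ v.asIdeal := by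
  have h1 := vl_int v a
  have h2 := vl_int_pow v a 1
  rw [pow_one] at h2
  rw [← h2]
  constructor
  · intro h; rw [h]
    rw [not_le, ← WithZero.exp_zero, WithZero.exp_lt_exp]; simp
  · intro h
    refine le_antisymm h1 (not_lt.1 fun hlt => h ?_)
    rw [← WithZero.lt_mul_exp_iff_le (by simp), ← WithZero.exp_add]
    simpa using hlt

lemma finite_ne_one (x : kˣ) : {v : Pl k | vl v (x : k) ≠ 1}.Finite := by
  refine ((HeightOneSpectrum.Support.finite (𝓞k) (x : k)).union
    (HeightOneSpectrum.Support.finite (𝓞k) ((x⁻¹ : kˣ) : k))).subset ?_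
  intro v hv
  rcases lt_or_gt_of_ne hv with h | h
  · right
    show 1 < vl v _
    rw [Units.val_inv_eq_inv_val, map_inv₀]
    exact (one_lt_inv₀ (zero_lt_iff.2 (vl_ne_zero v x))).2 h
  · left; exact h

/-- every element is an `S`-unit for large `S` -/
lemma exists_S_unit (x : kˣ) : ∃ S : Finset (Pl k), x ∈ US S := by
  refine ⟨(finite_ne_one x).toFinset, fun v hv => ?_⟩
  simpa using hv

open Classical in
/-- valuation of a generator of `v^h * J` -/
lemma vl_of_span {v : Pl k} {n : ℕ} {J : Ideal 𝓞k} {y : 𝓞k} (h : Ideal.span {y} = v.asIdeal ^ n * J)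
    (hy : y ≠ 0) (w : Pl k) (hJ : ¬ J ≤ w.asIdeal) :
    vl w (algebraMap 𝓞k k y) = if w = v then WithZero.exp (-(n : ℤ)) else 1 := by
  split_ifs with hw
  · subst hw
    apply le_antisymm
    · rw [vl_int_pow, ← Ideal.span_singleton_le_iff_mem, h]; exact Ideal.mul_le_left (I := w.asIdeal ^ n) (J := J)
    · by_contra hlt
      rw [not_le] at hlt
      have : vl w (algebraMap 𝓞k k y) ≤ WithZero.exp (-((n + 1 : ℕ) : ℤ)) := by
        rw [← WithZero.lt_mul_exp_iff_le (by simp), ← WithZero.exp_add]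
        convert hlt using 2; push_cast; ring
      rw [vl_int_pow, ← Ideal.span_singleton_le_iff_mem, h, ← Ideal.dvd_iff_le, pow_succ] at this
      have h0 : w.asIdeal ^ n ≠ 0 := pow_ne_bot w n
      have := (mul_dvd_mul_iff_left h0).1 this
      exact hJ (Ideal.dvd_iff_le.1 this)
  · rw [vl_int_eq_one]
    intro hmem
    rw [← Ideal.span_singleton_le_iff_mem, h] at hmem
    rcases (Ideal.IsPrime.mul_le w.isPrime).1 hmem with h1 | h1
    · have h2 := Ideal.IsPrime.le_of_pow_le (hP := w.isPrime) h1
      apply hw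
      exact HeightOneSpectrum.ext (v.isMaximal.eq_of_le w.isPrime.ne_top h2).symm
    · exact hJ h1

open Classical in
lemma exists_gen (v : Pl k) : ∃ a : kˣ, ∀ w, vl w (a : k) =
    if w = v then WithZero.exp (-(NumberField.classNumber k : ℤ)) else 1 := by
  have h1 : (ClassGroup.mk0 ⟨v.asIdeal, mem_nonZeroDivisors_of_ne_zero v.ne_bot⟩) ^ NumberField.classNumber k = 1 := by
    rw [NumberField.classNumber, pow_card_eq_one]
  rw [← map_pow, ClassGroup.mk0_eq_one_iff] at h1
  obtain ⟨y, hy⟩ := h1.principal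
  simp only [SubmonoidClass.mk_pow] at hy
  have hy0 : y ≠ 0 := by
    rintro rfl
    exact pow_ne_bot v _ (by rw [hy]; simp)
  have hy1 : algebraMap 𝓞k k y ≠ 0 := by simpa using hy0
  refine ⟨Units.mk0 _ hy1, fun w => ?_⟩
  refine vl_of_span (J := ⊤) ?_ hy0 w ?_
  · rw [Ideal.mul_top, hy]
  · rw [top_le_iff]; exact w.isPrime.ne_top

/-- "good" finite sets of places: containing the dyadic ones, and trivial `S`-class group -/
def GoodS (S : Finset (Pl k)) : Prop :=
  ∀ v : Pl k, v ∉ S → vl v 2 = 1 ∧ ∃ y : kˣ, vl v (y : k) = WithZero.exp (-1) ∧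
    ∀ w : Pl k, w ∉ S → w ≠ v → vl w (y : k) = 1

lemma exists_goodS : ∃ S0 : Finset (Pl k), ∀ S, S0 ⊆ S → GoodS S := by
  classical
  have hne : ∀ c : ClassGroup 𝓞k, ∃ J : nonZeroDivisors (Ideal 𝓞k), ClassGroup.mk0 J = c :=
    ClassGroup.mk0_surjective
  choose J hJ using hne
  have : Fintype (ClassGroup 𝓞k) := inferInstance
  have hfin : ∀ c, {v : Pl k | v.asIdeal ∣ (J c : Ideal 𝓞k)}.Finite := fun c =>
    Ideal.finite_factors (nonZeroDivisors.ne_zero (J c).2)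
  let two : kˣ := Units.mk0 2 two_ne_zero
  refine ⟨(finite_ne_one two).toFinset ∪ Finset.univ.biUnion (fun c => (hfin c).toFinset), fun S hS v hv => ⟨?_, ?_⟩⟩
  · by_contra hcon
    exact hv (hS (Finset.mem_union_left _ (by simpa [two] using hcon)))
  · have hS' : ∀ w, w ∉ S → ∀ c, ¬ ((J c : Ideal 𝓞k) ≤ w.asIdeal) := by
      intro w hw c hle
      exact hw (hS (Finset.mem_union_right _ (Finset.mem_biUnion.2 ⟨c, Finset.mem_univ _, by
        simpa [Ideal.dvd_iff_le] using hle⟩)))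
    let V : nonZeroDivisors (Ideal 𝓞k) := ⟨v.asIdeal, mem_nonZeroDivisors_of_ne_zero v.ne_bot⟩
    let c := (ClassGroup.mk0 V)⁻¹
    have h1 : ClassGroup.mk0 (V * J c) = 1 := by
      rw [map_mul, hJ]; simp [c]
    rw [ClassGroup.mk0_eq_one_iff] at h1
    obtain ⟨y, hy⟩ := h1.principal
    have hy0 : y ≠ 0 := by
      rintro rfl
      have := nonZeroDivisors.ne_zero (V * J c).2
      apply this
      rw [Ideal.zero_eq_bot, hy]; simp
    have hy1 : algebraMap 𝓞k k y ≠ 0 := by simpa using hy0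
    have key : ∀ w, w ∉ S → vl w (algebraMap 𝓞k k y) = if w = v then WithZero.exp (-((1 : ℕ) : ℤ)) else 1 := by
      intro w hw
      refine vl_of_span (J := J c) ?_ hy0 w (hS' w hw c)
      rw [pow_one]
      exact hy.symm
    refine ⟨Units.mk0 _ hy1, by simpa using key v hv, fun w hw hwv => by simpa [hwv] using key w hw⟩

/-- Integral units as `S`-units. -/
def unitsToUS (S : Finset (Pl k)) : Additive (𝓞k)ˣ →ₗ[ℤ] Additive (US S) :=
  (MonoidHom.toAdditive ((Units.map (algebraMap 𝓞k k : 𝓞k →* k)).codRestrict (US S) (by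
    intro u v _
    rw [Units.coe_map]
    refine le_antisymm (vl_int v _) ?_
    have h := vl_int v ((u⁻¹ : (𝓞k)ˣ) : 𝓞k)
    have h2 : vl v (algebraMap 𝓞k k u) * vl v (algebraMap 𝓞k k ((u⁻¹ : (𝓞k)ˣ) : 𝓞k)) = 1 := by
      rw [← map_mul, ← map_mul]; simp
    calc (1 : ℤᵐ⁰) = _ := h2.symm
      _ ≤ vl v (algebraMap 𝓞k k u) * 1 := by gcongr
      _ = _ := mul_one _))).toIntLinearMap

lemma unitsToUS_inj (S : Finset (Pl k)) : Function.Injective (unitsToUS S) := by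
  intro a b h
  have h1 : (Units.map (algebraMap 𝓞k k : 𝓞k →* k)) a.toMul = (Units.map (algebraMap 𝓞k k : 𝓞k →* k)) b.toMul :=
    congrArg (fun x : Additive (US S) => ((x.toMul : US S) : kˣ)) h
  have h2 : Function.Injective (Units.map (algebraMap 𝓞k k : 𝓞k →* k)) :=
    Units.map_injective NumberField.RingOfIntegers.coe_injective
  exact Additive.toMul.injective (h2 h1)

/-- valuations of `S`-units -/
def valUS (S : Finset (Pl k)) : Additive (US S) →ₗ[ℤ] (S → ℤ) :=
  ({ toFun := fun u v => WithZero.log (vl (v : Pl k) ((u.toMul : US S) : kˣ))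
     map_zero' := by ext v; simp
     map_add' := by
      intro a b; ext v
      simp only [toMul_add, Subgroup.coe_mul, Units.val_mul, map_mul, Pi.add_apply]
      rw [WithZero.log_mul (vl_ne_zero _ _) (vl_ne_zero _ _)] } : Additive (US S) →+ (S → ℤ)).toIntLinearMap

lemma valUS_apply (S : Finset (Pl k)) (u : Additive (US S)) (v : S) :
    valUS S u v = WithZero.log (vl (v : Pl k) ((u.toMul : US S) : kˣ)) := rfl

lemma log_eq_zero_iff' {x : ℤᵐ⁰} (hx : x ≠ 0) : WithZero.log x = 0 ↔ x = 1 := by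
  constructor
  · intro h; rw [← WithZero.exp_log hx, h, WithZero.exp_zero]
  · rintro rfl; simp

lemma range_unitsToUS (S : Finset (Pl k)) : LinearMap.range (unitsToUS S) = LinearMap.ker (valUS S) := by
  apply le_antisymm
  · rintro _ ⟨u, rfl⟩
    rw [LinearMap.mem_ker]
    ext v
    rw [valUS_apply, Pi.zero_apply, log_eq_zero_iff' (vl_ne_zero _ _)]
    have h1 := ((unitsToUS (∅ : Finset (Pl k)) u).toMul : US (∅ : Finset (Pl k))).2 (v : Pl k) (by simp)
    exact h1
  · intro u hu
    have h1 : ∀ v : Pl k, vl v ((u.toMul : US S) : kˣ) = 1 := by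
      intro v
      by_cases hv : v ∈ S
      · have := congrFun hu ⟨v, hv⟩
        rwa [valUS_apply, Pi.zero_apply, log_eq_zero_iff' (vl_ne_zero _ _)] at this
      · exact (u.toMul : US S).2 v hv
    obtain ⟨a, ha⟩ := HeightOneSpectrum.mem_integers_of_valuation_le_one (R := 𝓞k) k _ (fun v => (h1 v).le)
    obtain ⟨b, hb⟩ := HeightOneSpectrum.mem_integers_of_valuation_le_one (R := 𝓞k) k
      ((((u.toMul : US S) : kˣ)⁻¹ : kˣ) : k) (fun v => by
        rw [Units.val_inv_eq_inv_val, map_inv₀]; exact (by rw [h1 v, inv_one]))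
    have hab : a * b = 1 := by
      apply NumberField.RingOfIntegers.coe_injective
      rw [map_mul, ha, hb]; simp
    refine ⟨Additive.ofMul (Units.mk a b hab (by rw [mul_comm]; exact hab)), ?_⟩
    apply Additive.toMul.injective
    apply Subtype.ext
    apply Units.ext
    exact ha

instance US_finite (S : Finset (Pl k)) : Module.Finite ℤ (Additive (US S)) := by
  have h1 : Module.Finite ℤ (LinearMap.ker (valUS S)) := by
    rw [← range_unitsToUS]; infer_instance
  have h2 : Module.Finite ℤ (LinearMap.range (valUS S)) := inferInstance
  have h3 : Module.Finite ℤ (Additive (US S) ⧸ LinearMap.ker (valUS S)) :=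
    Module.Finite.equiv (valUS S).quotKerEquivRange.symm
  exact Module.Finite.of_submodule_quotient (LinearMap.ker (valUS S))

lemma US_finrank (S : Finset (Pl k)) :
    Module.finrank ℤ (Additive (US S)) = NumberField.Units.rank k + S.card := by
  classical
  rw [← Submodule.finrank_quotient_add_finrank (LinearMap.ker (valUS S)),
    (valUS S).quotKerEquivRange.finrank_eq, ← range_unitsToUS,
    ← (LinearEquiv.ofInjective _ (unitsToUS_inj S)).finrank_eq, NumberField.Units.finrank_eq, add_comm]
  congr 1
  apply le_antisymm
  · refine (Submodule.finrank_le _).trans ?_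
    simp
  · -- multiples of the class number are in the range
    set h := NumberField.classNumber k
    have hh : (h : ℤ) ≠ 0 := by
      have : 0 < h := Fintype.card_pos
      exact_mod_cast this.ne'
    have hle : ∀ x : S → ℤ, (h : ℤ) • x ∈ LinearMap.range (valUS S) := by
      intro x
      have : (h : ℤ) • x = ∑ v : S, x v • ((h : ℤ) • (Pi.single v 1 : S → ℤ)) := by
        ext w
        simp [Finset.sum_apply, Pi.single_apply, mul_comm]
      rw [this]
      refine Submodule.sum_mem _ fun v _ => Submodule.smul_mem _ _ ?_
      obtain ⟨a, ha⟩ := exists_gen (v : Pl k)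
      have haS : a⁻¹ ∈ US S := inv_mem (fun w hw => by
        rw [ha, if_neg]; rintro rfl; exact hw v.2)
      refine ⟨Additive.ofMul ⟨a⁻¹, haS⟩, ?_⟩
      ext w
      rw [valUS_apply]
      simp only [toMul_ofMul, Units.val_inv_eq_inv_val, map_inv₀, ha, WithZero.log_inv]
      by_cases hwv : w = v
      · subst hwv; simp [h]
      · have : (w : Pl k) ≠ v := fun e => hwv (Subtype.ext e)
        simp [this, hwv]
    let g : (S → ℤ) →ₗ[ℤ] LinearMap.range (valUS S) :=
      ((h : ℤ) • LinearMap.id).codRestrict _ hle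
    have hg : Function.Injective g := by
      intro x y hxy
      have : (h : ℤ) • x = (h : ℤ) • y := congrArg Subtype.val hxy
      exact smul_right_injective _ hh this
    have := LinearMap.finrank_le_finrank_of_injective hg
    simpa using this

end NF
end HM

end

section
open scoped TensorProduct
open IsDedekindDomain
open scoped WithZero

namespace HM

lemma index_two_free (M : Type) [AddCommGroup M] [Module.Free ℤ M] [Module.Finite ℤ M] :
    (nsmulAddMonoidHom 2 : M →+ M).range.index = 2 ^ Module.finrank ℤ M := by
  have h := ModN.natCard_eq (G := M) (n := 2)
  rw [← h]
  show Nat.card _ = _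
  have : (nsmulAddMonoidHom 2 : M →+ M).range = (LinearMap.range (LinearMap.lsmul ℤ M 2)).toAddSubgroup := by
    ext x
    simp [AddMonoidHom.mem_range, LinearMap.mem_range]
    simp [two_smul]
  rw [this]
  rfl

lemma index_two_prod (A B M : Type) [AddCommGroup A] [AddCommGroup B] [AddCommGroup M]
    (e : M ≃+ A × B) :
    (nsmulAddMonoidHom 2 : M →+ M).range.index =
      (nsmulAddMonoidHom 2 : A →+ A).range.index * (nsmulAddMonoidHom 2 : B →+ B).range.index := by
  rw [← AddSubgroup.index_prod, ← AddSubgroup.index_comap_of_surjective (f := e.toAddMonoidHom) _ e.surjective]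
  congr 1
  ext x
  simp only [AddMonoidHom.mem_range, AddSubgroup.mem_comap, AddSubgroup.mem_prod, nsmulAddMonoidHom_apply]
  constructor
  · rintro ⟨y, rfl⟩
    exact ⟨⟨(e y).1, by simp⟩, ⟨(e y).2, by simp⟩⟩
  · rintro ⟨⟨a, ha⟩, ⟨b, hb⟩⟩
    refine ⟨e.symm (a, b), ?_⟩
    apply e.injective
    rw [map_nsmul, e.apply_symm_apply]
    exact Prod.ext ha hb

lemma index_two_finite (B : Type) [AddCommGroup B] [Finite B] :
    (nsmulAddMonoidHom 2 : B →+ B).range.index = Nat.card (nsmulAddMonoidHom 2 : B →+ B).ker := by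
  have h1 := (nsmulAddMonoidHom 2 : B →+ B).range.card_mul_index
  have h2 := (nsmulAddMonoidHom 2 : B →+ B).ker.card_mul_index
  rw [AddSubgroup.index_ker] at h2
  have h3 : Nat.card (nsmulAddMonoidHom 2 : B →+ B).range ≠ 0 := Nat.card_pos.ne'
  apply Nat.eq_of_mul_eq_mul_left (Nat.pos_of_ne_zero h3)
  rw [h1, ← h2, mul_comm]

lemma index_two_fg (M : Type) [AddCommGroup M] [Module.Finite ℤ M] :
    (nsmulAddMonoidHom 2 : M →+ M).range.index =
      2 ^ Module.finrank ℤ M * Nat.card (nsmulAddMonoidHom 2 : M →+ M).ker := by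
  have hfg : AddGroup.FG M := Module.Finite.iff_addGroup_fg.1 inferInstance
  obtain ⟨n, ι, _, p, hp, e, ⟨f⟩⟩ := AddCommGroup.equiv_free_prod_directSum_zmod M
  have : ∀ i, NeZero (p i ^ e i) := fun i => ⟨pow_ne_zero _ (hp i).ne_zero⟩
  classical
  set B := DirectSum ι (fun i => ZMod (p i ^ e i))
  have hB : Finite B := Finite.of_injective (fun (x : B) i => x i) DFunLike.coe_injective
  rw [index_two_prod _ _ _ f, index_two_free, index_two_finite]
  congr 1
  · congr 1
    rw [f.toIntLinearEquiv.finrank_eq, Module.finrank_finsupp_self]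
    have h1 : Module.finrank ℤ ((Fin n →₀ ℤ) × B) = Module.finrank ℤ (Fin n →₀ ℤ) := by
      rw [← Submodule.finrank_quotient_add_finrank (LinearMap.ker (LinearMap.fst ℤ (Fin n →₀ ℤ) B)),
        ((LinearMap.fst ℤ (Fin n →₀ ℤ) B).quotKerEquivOfSurjective LinearMap.fst_surjective).finrank_eq]
      have : Module.finrank ℤ (LinearMap.ker (LinearMap.fst ℤ (Fin n →₀ ℤ) B)) = 0 := by
        have : Module.Finite ℤ B := Module.Finite.of_finite
        refine (Module.finrank_eq_zero_iff (R := ℤ) (M := LinearMap.ker (LinearMap.fst ℤ (Fin n →₀ ℤ) B))).2 ?_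
        rintro ⟨⟨a, b⟩, hx⟩
        refine ⟨Nat.card B, by exact_mod_cast Nat.card_pos.ne', ?_⟩
        have ha : a = 0 := hx
        subst ha
        apply Subtype.ext
        refine Prod.ext ?_ ?_
        · simp
        · show (Nat.card B : ℤ) • b = 0
          rw [natCast_zsmul, card_nsmul_eq_zero']
      rw [this, add_zero]
    rw [h1, Module.finrank_finsupp_self]
  · refine Nat.card_congr ⟨fun b => ⟨f.symm (0, b.1), ?_⟩, fun x => ⟨(f x.1).2, ?_⟩, ?_, ?_⟩
    · have hb : 2 • b.1 = 0 := b.2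
      show 2 • _ = (0 : M)
      rw [← map_nsmul, Prod.smul_mk, hb]; simp
    · have hx : 2 • x.1 = 0 := x.2
      show 2 • _ = (0 : B)
      have := congrArg (fun y => (f y).2) hx
      simpa using this
    · intro b; simp
    · intro x
      apply Subtype.ext
      have hx : 2 • x.1 = 0 := x.2
      apply f.injective
      simp only [AddEquiv.apply_symm_apply]
      refine Prod.ext ?_ rfl
      have := congrArg (fun y => (f y).1) hx
      simp only [map_nsmul, Prod.smul_fst, map_zero, Prod.fst_zero] at this
      exact ((smul_eq_zero.1 this).resolve_left two_ne_zero).symm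

/-- squares in a f.g. subgroup of `kˣ` -/
lemma sq_relIndex {k : Type} [Field k] [CharZero k] (A : Subgroup kˣ) (hA : -1 ∈ A)
    [Module.Finite ℤ (Additive A)] :
    (A.map (powMonoidHom 2)).relIndex A = 2 ^ (Module.finrank ℤ (Additive A) + 1) := by
  have h := index_two_fg (Additive A)
  have h1 : (A.map (powMonoidHom 2)).relIndex A = (nsmulAddMonoidHom 2 : Additive A →+ Additive A).range.index := by
    have : (A.map (powMonoidHom 2)).subgroupOf A = (powMonoidHom 2 : A →* A).range := by
      ext x
      simp only [Subgroup.mem_subgroupOf, Subgroup.mem_map, MonoidHom.mem_range, powMonoidHom_apply]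
      constructor
      · rintro ⟨y, hy, hyx⟩; exact ⟨⟨y, hy⟩, Subtype.ext hyx⟩
      · rintro ⟨y, rfl⟩; exact ⟨y, y.2, rfl⟩
    rw [Subgroup.relIndex, this]
    rfl
  rw [h1, h, pow_succ]
  congr 1
  have hne : (-1 : kˣ) ≠ 1 := by
    intro h; have := congrArg (Units.val) h
    norm_num at this
  have : Nat.card (nsmulAddMonoidHom 2 : Additive A →+ Additive A).ker = Nat.card ({1, -1} : Set kˣ) := by
    refine Nat.card_congr ⟨fun x => ⟨(x.1.toMul : A), ?_⟩, fun y => ⟨Additive.ofMul ⟨y.1, ?_⟩, ?_⟩, ?_, ?_⟩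
    · have hx : (x.1.toMul) ^ 2 = (1 : A) := x.2
      have hx2 : (((x.1.toMul : A) : kˣ) : k) ^ 2 = 1 := by
        have := congrArg (fun z : A => ((z : kˣ) : k)) hx
        simpa using this
      rcases sq_eq_one_iff.1 hx2 with h | h
      · left; exact Units.ext h
      · right; exact Units.ext (by simpa using h)
    · rcases y.2 with h | h
      · rw [h]; exact one_mem _
      · rw [h]; exact hA
    · show (⟨y.1, _⟩ : A) ^ 2 = 1
      apply Subtype.ext
      rcases y.2 with h | h
      · simp [h]
      · simp [show y.1 = -1 from h]
    · intro x; rfl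
    · intro y; rfl
  rw [this]
  simp [Set.ncard_pair hne.symm]

section NF
variable {k : Type} [Field k] [NumberField k]

/-- the number `s` -/
def sN (k : Type) [Field k] [NumberField k] (S : Finset (Pl k)) : ℕ := Fintype.card (NumberField.InfinitePlace k) + S.card

lemma neg_one_mem_US (S : Finset (Pl k)) : (-1 : kˣ) ∈ US S := by
  intro v _; simp

lemma US_finrank' (S : Finset (Pl k)) : Module.finrank ℤ (Additive (US S)) + 1 = sN k S := by
  rw [US_finrank, sN, NumberField.Units.rank]
  have : 0 < Fintype.card (NumberField.InfinitePlace k) := Fintype.card_pos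
  omega

lemma US_sq_relIndex (S : Finset (Pl k)) :
    ((US S).map (powMonoidHom 2)).relIndex (US S) = 2 ^ sN k S := by
  rw [sq_relIndex _ (neg_one_mem_US S), US_finrank']

end NF
end HM

end

section
open scoped TensorProduct
open IsDedekindDomain
open scoped WithZero

namespace HM

section Ext
variable (k : Type) {K : Type} [Field k] [NumberField k] [Field K] [NumberField K] [Algebra k K]

/-- the place of `k` below `W` -/
def und (W : Pl K) : Pl k := W.under (NumberField.RingOfIntegers k)

lemma vl_und_pow (W : Pl K) : ∃ e : ℕ, e ≠ 0 ∧ ∀ x : k, vl (und k W) x ^ e = vl W (algebraMap k K x) := by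
  have : W.asIdeal.LiesOver (und k W).asIdeal := ⟨rfl⟩
  exact ⟨_, Ideal.IsDedekindDomain.ramificationIdx'_ne_zero_of_liesOver W.asIdeal (und k W).ne_bot,
    fun x => HeightOneSpectrum.valuation_liesOver K (und k W) W x⟩

lemma und_le_one (W : Pl K) (x : k) : vl W (algebraMap k K x) ≤ 1 ↔ vl (und k W) x ≤ 1 := by
  obtain ⟨e, he, h⟩ := vl_und_pow k W
  rw [← h, pow_le_one_iff he]

lemma und_lt_one (W : Pl K) (x : k) : vl W (algebraMap k K x) < 1 ↔ vl (und k W) x < 1 := by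
  obtain ⟨e, he, h⟩ := vl_und_pow k W
  rw [← h, pow_lt_one_iff he]

lemma und_eq_one (W : Pl K) (x : k) : vl W (algebraMap k K x) = 1 ↔ vl (und k W) x = 1 := by
  rw [eq_iff_le_not_lt, eq_iff_le_not_lt, und_le_one, und_lt_one]

lemma und_lt (W : Pl K) (x y : k) : vl W (algebraMap k K x) < vl W (algebraMap k K y) ↔
    vl (und k W) x < vl (und k W) y := by
  obtain ⟨e, he, h⟩ := vl_und_pow k W
  rw [← h, ← h, pow_lt_pow_iff_left₀ (zero_le) (zero_le) he]

lemma exists_over (v : Pl k) : ∃ W : Pl K, und k W = v := by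
  obtain ⟨P, hP, h2⟩ := v.asIdeal.exists_ideal_over_prime_of_isIntegral_of_isDomain
    (S := NumberField.RingOfIntegers K) (by simp)
  refine ⟨⟨P, hP, ?_⟩, HeightOneSpectrum.ext h2⟩
  rintro rfl
  apply v.ne_bot
  rw [← h2]
  exact (RingHom.injective_iff_ker_eq_bot _).1 (FaithfulSMul.algebraMap_injective _ _)

lemma finite_over (v : Pl k) : {W : Pl K | und k W = v}.Finite := by
  have := IsDedekindDomain.primesOver_finite v.asIdeal (NumberField.RingOfIntegers K)
  refine Set.Finite.of_finite_image (f := fun W : Pl K => W.asIdeal) (this.subset ?_) ?_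
  · rintro _ ⟨W, hW, rfl⟩
    refine ⟨W.isPrime, ⟨?_⟩⟩
    rw [← (show und k W = v from hW)]; rfl
  · intro a _ b _ h; exact HeightOneSpectrum.ext h

lemma finite_SK (S : Finset (Pl k)) : {W : Pl K | und k W ∈ S}.Finite := by
  have : {W : Pl K | und k W ∈ S} = ⋃ v ∈ S, {W : Pl K | und k W = v} := by
    ext W; simp
  rw [this]
  exact S.finite_toSet.biUnion fun v _ => finite_over k v

/-- places above `S` -/
def SK (K : Type) [Field K] [NumberField K] [Algebra k K] (S : Finset (Pl k)) : Finset (Pl K) := (finite_SK k S).toFinset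

lemma mem_SK (S : Finset (Pl k)) (W : Pl K) : W ∈ SK k K S ↔ und k W ∈ S := by simp [SK]

variable {k}

lemma eq_of_le_exp {x y : ℤᵐ⁰} (hx : x ≤ 1) (hy : y ≤ 1) (hx0 : x ≠ 0) (hy0 : y ≠ 0)
    (h : ∀ n : ℕ, x ≤ WithZero.exp (-(n : ℤ)) ↔ y ≤ WithZero.exp (-(n : ℤ))) : x = y := by
  have key : ∀ {x y : ℤᵐ⁰}, x ≤ 1 → x ≠ 0 →
      (∀ n : ℕ, x ≤ WithZero.exp (-(n : ℤ)) → y ≤ WithZero.exp (-(n : ℤ))) → y ≤ x := by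
    intro x y hx hx0 h
    obtain ⟨n, hn⟩ : ∃ n : ℕ, x = WithZero.exp (-(n : ℤ)) := by
      have hl : WithZero.log x ≤ 0 := by
        rw [← WithZero.exp_log hx0, ← WithZero.exp_zero, WithZero.exp_le_exp] at hx; exact hx
      refine ⟨(-WithZero.log x).toNat, ?_⟩
      rw [Int.toNat_of_nonneg (by omega), neg_neg, WithZero.exp_log hx0]
    rw [hn]; exact h n hn.le
  exact le_antisymm (key hy hy0 fun n => (h n).2) (key hx hx0 fun n => (h n).1)

/-- conjugate place -/
lemma exists_conj (σ : K ≃ₐ[k] K) (W : Pl K) : ∃ W' : Pl K, und k W' = und k W ∧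
    ∀ z : K, vl W' z = vl W (σ z) := by
  let e : NumberField.RingOfIntegers K ≃+* NumberField.RingOfIntegers K :=
    NumberField.RingOfIntegers.mapRingEquiv σ
  have he : ∀ a, algebraMap (NumberField.RingOfIntegers K) K (e a) = σ (algebraMap (NumberField.RingOfIntegers K) K a) := fun a => rfl
  let W' : Pl K := ⟨W.asIdeal.comap e, Ideal.comap_isPrime _ _, by
    intro h
    apply W.ne_bot
    rw [eq_bot_iff]
    intro x hx
    have : e.symm x ∈ W.asIdeal.comap e := by
      rw [Ideal.mem_comap, e.apply_symm_apply]; exact hx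
    rw [h] at this
    simpa using this⟩
  have hintgr : ∀ a : NumberField.RingOfIntegers K, a ≠ 0 → vl W' (algebraMap _ K a) = vl W (σ (algebraMap _ K a)) := by
    intro a ha
    have ha1 : algebraMap (NumberField.RingOfIntegers K) K a ≠ 0 := by simpa using ha
    apply eq_of_le_exp (vl_int _ _) (by rw [← he]; exact vl_int _ _)
    · exact (Valuation.ne_zero_iff _).2 ha1
    · exact (Valuation.ne_zero_iff _).2 (by simpa using ha1)
    · intro n
      rw [← he, vl_int_pow, vl_int_pow]
      have : W'.asIdeal ^ n = (W.asIdeal ^ n).comap e := by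
        show (W.asIdeal.comap e) ^ n = (W.asIdeal ^ n).comap e
        rw [← Ideal.map_symm, ← Ideal.map_symm, Ideal.map_pow]
      rw [this, Ideal.mem_comap]
  refine ⟨W', ?_, ?_⟩
  · apply HeightOneSpectrum.ext
    ext a
    show e (algebraMap _ _ a) ∈ W.asIdeal ↔ algebraMap _ _ a ∈ W.asIdeal
    have : e (algebraMap (NumberField.RingOfIntegers k) _ a) = algebraMap (NumberField.RingOfIntegers k) (NumberField.RingOfIntegers K) a := by
      apply NumberField.RingOfIntegers.coe_injective
      exact σ.commutes (algebraMap _ k a)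
    rw [this]
  · intro z
    rcases eq_or_ne z 0 with rfl | hz
    · simp
    obtain ⟨a, b, hb, rfl⟩ := IsFractionRing.div_surjective (A := NumberField.RingOfIntegers K) z
    have hb0 : b ≠ 0 := nonZeroDivisors.ne_zero hb
    have ha0 : a ≠ 0 := by rintro rfl; simp at hz
    rw [map_div₀, map_div₀, map_div₀, hintgr a ha0, hintgr b hb0]

end Ext

/-- A quadratic extension `K = k(√c)`. -/
structure QE (k K : Type) [Field k] [Field K] [Algebra k K] (c : k) where
  θ : K
  sq : θ ^ 2 = algebraMap k K c
  rep : ∀ z : K, ∃ x y : k, z = algebraMap k K x + algebraMap k K y * θ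
  σ : K ≃ₐ[k] K
  hσ : σ θ = -θ
  rank : Module.finrank k K = 2
  lift : ∀ (φ : k →+* ℝ) (r : ℝ), r ^ 2 = φ c → ∃ ψ : K →+* ℝ, (∀ x, ψ (algebraMap k K x) = φ x) ∧ ψ θ = r

/-- conjugation -/
def qaConj {k : Type} [Field k] (c : k) : QuadraticAlgebra k c 0 ≃ₐ[k] QuadraticAlgebra k c 0 where
  toFun z := ⟨z.re, -z.im⟩
  invFun z := ⟨z.re, -z.im⟩
  left_inv z := by ext <;> simp
  right_inv z := by ext <;> simp
  map_mul' x y := by ext <;> simp <;> ring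
  map_add' x y := by ext <;> simp <;> ring
  commutes' x := by ext <;> simp

lemma exists_QE (k : Type) [Field k] [NumberField k] (c : k) (hc : ¬ IsSquare c) :
    ∃ (K : Type) (_ : Field K) (_ : NumberField K) (_ : Algebra k K), Nonempty (QE k K c) := by
  have hf : Fact (∀ r : k, r ^ 2 ≠ c + 0 * r) := ⟨fun r h => hc ⟨r, by rw [← sq, h]; ring⟩⟩
  have hfin : Module.Finite k (QuadraticAlgebra k c 0) := inferInstance
  have hcz : CharZero (QuadraticAlgebra k c 0) := charZero_of_injective_algebraMap (algebraMap k (QuadraticAlgebra k c 0)).injective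
  have hQ : FiniteDimensional ℚ (QuadraticAlgebra k c 0) := FiniteDimensional.trans ℚ k (QuadraticAlgebra k c 0)
  have hN : NumberField (QuadraticAlgebra k c 0) := { to_charZero := hcz, to_finiteDimensional := hQ }
  refine ⟨QuadraticAlgebra k c 0, inferInstance, hN, inferInstance, ⟨{
    θ := ⟨0, 1⟩
    sq := by rw [sq]; ext <;> simp
    rep := fun z => ⟨z.re, z.im, by ext <;> simp⟩
    σ := qaConj c
    hσ := by ext <;> simp [qaConj]
    rank := ?_
    lift := ?_ }⟩⟩
  · exact QuadraticAlgebra.finrank_eq_two _ _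
  · intro φ r hr
    let _ : Algebra k ℝ := φ.toAlgebra
    refine ⟨(QuadraticAlgebra.lift (R := k) (A := ℝ) (a := c) (b := 0) ⟨r, ?_⟩ : QuadraticAlgebra k c 0 →ₐ[k] ℝ).toRingHom, ?_, ?_⟩
    · rw [← sq, hr, Algebra.smul_def, zero_smul, add_zero, mul_one]; rfl
    · intro x
      exact AlgHom.commutes _ x
    · simp

end HM

end

section
open scoped TensorProduct
open IsDedekindDomain
open scoped WithZero

namespace HM

section
variable {k : Type} [Field k]

/-- positive elements at a real embedding -/
def Pos (φ : k →+* ℝ) : Subgroup kˣ where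
  carrier := {u | 0 < φ u}
  one_mem' := by simp
  mul_mem' := by
    intro a b ha hb
    simp only [Set.mem_ofPred_eq] at *
    push_cast; rw [map_mul]; positivity
  inv_mem' := by
    intro a ha
    simp only [Set.mem_ofPred_eq] at *
    rw [Units.val_inv_eq_inv_val, map_inv₀]; positivity

lemma mem_Pos {φ : k →+* ℝ} {u : kˣ} : u ∈ Pos φ ↔ 0 < φ u := Iff.rfl
end

section NF
variable {k : Type} [Field k] [NumberField k]

instance : Finite (k →+* ℝ) := finite_real
instance : Fintype (k →+* ℝ) := Fintype.ofFinite _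

/-- local squares at a place -/
def LS : Pl k ⊕ (k →+* ℝ) → Subgroup kˣ
  | Sum.inl v => Sq (vl v)
  | Sum.inr φ => Pos φ

/-- the places in `S` and the real ones -/
def Om (S : Finset (Pl k)) : Finset (Pl k ⊕ (k →+* ℝ)) := S.disjSum Finset.univ

lemma inl_mem_Om {S : Finset (Pl k)} {v : Pl k} : Sum.inl v ∈ Om S ↔ v ∈ S := by simp [Om]
lemma inr_mem_Om {S : Finset (Pl k)} {φ : k →+* ℝ} : Sum.inr φ ∈ Om S := by simp [Om]

lemma card_real : Fintype.card (k →+* ℝ) = NumberField.InfinitePlace.nrRealPlaces k := by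
  classical
  rw [← NumberField.InfinitePlace.card_real_embeddings]
  refine Fintype.card_congr ⟨fun φ => ⟨(Complex.ofRealHom).comp φ, ?_⟩, fun φ => NumberField.ComplexEmbedding.IsReal.embedding φ.2, ?_, ?_⟩
  · ext x; simp
  · intro φ; ext x; simp [NumberField.ComplexEmbedding.IsReal.embedding]
  · intro φ
    apply Subtype.ext; ext x
    simp

lemma card_inf : 2 * Fintype.card (NumberField.InfinitePlace k) = Module.finrank ℚ k + Fintype.card (k →+* ℝ) := by
  classical
  have h1 := NumberField.InfinitePlace.card_add_two_mul_card_eq_rank k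
  have h2 := NumberField.InfinitePlace.card_eq_nrRealPlaces_add_nrComplexPlaces k
  rw [card_real]; omega

variable {K : Type} [Field K] [NumberField K] [Algebra k K] {c : kˣ}

lemma QE.split (q : QE k K c) {v : Pl k} (hv : c ∈ Sq (vl v)) : ∃ W1 W2 : Pl K, und k W1 = v ∧ und k W2 = v ∧ W1 ≠ W2 := by
  obtain ⟨W, hW⟩ := exists_over (K := K) k v
  obtain ⟨W', hW', hval⟩ := exists_conj q.σ W
  refine ⟨W, W', hW, hW'.trans hW, ?_⟩
  rintro rfl
  obtain ⟨s, u, hu, hsu⟩ := (mem_Sq _).1 hv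
  replace hu := U4_val (v := vl v) ((Valuation.ne_zero_iff _).2 (by norm_num)) hu
  set A := algebraMap k K
  set t : K := (q.θ / A s - 1) / 2 with ht
  set μ : k := ((u : k) - 1) / 4 with hμ
  have hs : A s ≠ 0 := by simp [A]
  have hθ : q.θ ^ 2 = A s ^ 2 * A u := by
    rw [q.sq, ← hsu]; push_cast; simp [A]
  have h1 : t * (t + 1) = A μ := by
    have : A μ = (A u - 1) / 4 := by
      rw [hμ, map_div₀, map_sub, map_one, map_ofNat]
    rw [this, ht]
    field_simp
    linear_combination 4 * hθ
  have h2 : q.σ t = -(t + 1) := by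
    rw [ht, map_div₀, map_sub, map_div₀, q.hσ, AlgEquiv.commutes, map_one]
    have : q.σ 2 = 2 := map_ofNat q.σ 2
    rw [this]
    field_simp; ring
  have h3 : vl W t = vl W (t + 1) := by rw [hval t, h2, Valuation.map_neg]
  have h4 : vl W (A μ) < 1 := by
    rw [und_lt_one, hW, hμ, map_div₀, div_lt_one₀ (by simp [zero_lt_iff])]
    exact hu
  rw [← h1, map_mul, ← h3] at h4
  have h5 : vl W t < 1 := by
    by_contra h; rw [not_lt] at h
    exact absurd h4 (not_lt.2 (one_le_mul h h))
  have h6 : vl W (t + 1 - t) < 1 := (Valuation.map_sub _ _ _).trans_lt (max_lt (h3 ▸ h5) h5)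
  simp at h6

open Classical in
lemma QE.card_SK (q : QE k K c) (S : Finset (Pl k)) :
    S.card + (S.filter (fun v => c ∈ Sq (vl v))).card ≤ (SK k K S).card := by
  rw [Finset.card_eq_sum_card_fiberwise (f := und k) (s := SK k K S) (t := S)
    (fun W hW => (mem_SK k S W).1 hW), Finset.card_filter, Finset.card_eq_sum_ones, ← Finset.sum_add_distrib]
  refine Finset.sum_le_sum fun v hv => ?_
  split_ifs with h
  · obtain ⟨W1, W2, h1, h2, h3⟩ := q.split h
    have : ({W1, W2} : Finset (Pl K)) ⊆ (SK k K S).filter (fun W => und k W = v) := by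
      intro W hW
      rw [Finset.mem_insert, Finset.mem_singleton] at hW
      rcases hW with rfl | rfl <;> simp [mem_SK, *]
    have := Finset.card_le_card this
    rwa [Finset.card_pair h3] at this
  · obtain ⟨W, hW⟩ := exists_over (K := K) k v
    exact Finset.card_pos.2 ⟨W, by simp [mem_SK, hW, hv]⟩

open Classical in
lemma QE.card_inf (q : QE k K c) :
    2 * Fintype.card (NumberField.InfinitePlace k) ≤ Fintype.card (NumberField.InfinitePlace K) +
      (Finset.univ.filter (fun φ : k →+* ℝ => c ∉ Pos φ)).card := by
  have h1 := HM.card_inf (k := k)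
  have h2 := HM.card_inf (k := K)
  have h3 : Module.finrank ℚ K = 2 * Module.finrank ℚ k := by
    rw [← Module.finrank_mul_finrank ℚ k K, q.rank, mul_comm]
  have h4 : (Finset.univ.filter (fun φ : k →+* ℝ => c ∈ Pos φ)).card + (Finset.univ.filter (fun φ : k →+* ℝ => c ∉ Pos φ)).card = Fintype.card (k →+* ℝ) := by
    rw [Finset.card_filter_add_card_filter_not, Finset.card_univ]
  have h5 : 2 * (Finset.univ.filter (fun φ : k →+* ℝ => c ∈ Pos φ)).card ≤ Fintype.card (K →+* ℝ) := by
    have hl : ∀ x : {φ : k →+* ℝ // c ∈ Pos φ} × Bool, ∃ ψ : K →+* ℝ, (∀ y, ψ (algebraMap k K y) = x.1.1 y) ∧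
        ψ q.θ = (if x.2 then 1 else -1) * √(x.1.1 c) := by
      intro x
      apply q.lift
      rw [mul_pow, Real.sq_sqrt (le_of_lt x.1.2)]
      split_ifs <;> simp
    choose Ψ hΨ using hl
    have hinj : Function.Injective Ψ := by
      rintro ⟨φ, b⟩ ⟨φ', b'⟩ h
      have e1 : φ = φ' := by
        apply Subtype.ext; ext y
        rw [← (hΨ (φ, b)).1 y, h, (hΨ (φ', b')).1 y]
      subst e1
      have e2 := (hΨ (φ, b)).2
      rw [h, (hΨ (φ, b')).2] at e2
      have hp : 0 < √(φ.1 c) := Real.sqrt_pos.2 φ.2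
      have e3 := mul_right_cancel₀ hp.ne' e2
      cases b <;> cases b' <;> simp at e3 ⊢ <;> norm_num at e3
    have := Fintype.card_le_of_injective Ψ hinj
    rw [Fintype.card_prod, Fintype.card_bool, Fintype.card_subtype] at this
    omega
  omega

open Classical in
/-- number of places at which `c` is not a local square -/
def rN (S : Finset (Pl k)) (c : kˣ) : ℕ := ((Om S).filter (fun i => c ∉ LS i)).card

lemma QE.sN_ge (q : QE k K c) (S : Finset (Pl k)) :
    2 * sN k S ≤ sN K (SK k K S) + rN S c := by
  classical
  have h1 := q.card_SK S
  have h2 := q.card_inf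
  have h3 : rN S c = (S.filter (fun v => c ∉ Sq (vl v))).card + (Finset.univ.filter (fun φ : k →+* ℝ => c ∉ Pos φ)).card := by
    rw [rN, ← Finset.card_disjSum]
    congr 1
    ext i
    rcases i with v | φ
    · rw [Finset.mem_filter, inl_mem_Om, Finset.inl_mem_disjSum, Finset.mem_filter]; rfl
    · rw [Finset.mem_filter, Finset.inr_mem_disjSum, Finset.mem_filter]
      simp only [inr_mem_Om, Finset.mem_univ]; rfl
  have h4 : (S.filter (fun v => c ∈ Sq (vl v))).card + (S.filter (fun v => c ∉ Sq (vl v))).card = S.card := by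
    rw [Finset.card_filter_add_card_filter_not]
  unfold sN
  convert_to _ ≤ _ + ((S.filter (fun v => c ∉ Sq (vl v))).card + (Finset.univ.filter (fun φ : k →+* ℝ => c ∉ Pos φ)).card)
  · rw [← h3]
  · omega

end NF
end HM

end

section
open scoped TensorProduct
open IsDedekindDomain
open scoped WithZero

namespace HM

section rk
variable {G H : Type} [CommGroup G] [CommGroup H]

/-- f.g. abelian group -/
abbrev FGg (A : Subgroup G) : Prop := Module.Finite ℤ (Additive A)
/-- rank -/
def rk (A : Subgroup G) : ℕ := Module.finrank ℤ (Additive A)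

/-- inclusion as linear map -/
def inclL {A B : Subgroup G} (h : A ≤ B) : Additive A →ₗ[ℤ] Additive B :=
  (MonoidHom.toAdditive (Subgroup.inclusion h)).toIntLinearMap

lemma inclL_inj {A B : Subgroup G} (h : A ≤ B) : Function.Injective (inclL h) :=
  fun _ _ e => Additive.toMul.injective (Subgroup.inclusion_injective h e)

lemma FGg.mono {A B : Subgroup G} (h : A ≤ B) (hB : FGg B) : FGg A :=
  Module.Finite.of_injective (inclL h) (inclL_inj h)

lemma rk_mono {A B : Subgroup G} (h : A ≤ B) (hB : FGg B) : rk A ≤ rk B :=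
  LinearMap.finrank_le_finrank_of_injective (inclL_inj h)

/-- restriction of a hom as a linear map -/
def mapL (f : G →* H) (A : Subgroup G) : Additive A →ₗ[ℤ] Additive (A.map f) :=
  (MonoidHom.toAdditive (f.subgroupMap A)).toIntLinearMap

lemma mapL_surj (f : G →* H) (A : Subgroup G) : Function.Surjective (mapL f A) :=
  fun y => (f.subgroupMap_surjective A) y

lemma FGg.map (f : G →* H) {A : Subgroup G} (hA : FGg A) : FGg (A.map f) :=
  Module.Finite.of_surjective (mapL f A) (mapL_surj f A)

lemma rk_map (f : G →* H) {A : Subgroup G} (_hA : FGg A) :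
    rk A = rk (A.map f) + rk (A ⊓ f.ker) := by
  have h1 := Submodule.finrank_quotient_add_finrank (LinearMap.ker (mapL f A))
  rw [((mapL f A).quotKerEquivOfSurjective (mapL_surj f A)).finrank_eq] at h1
  rw [rk, ← h1]
  congr 1
  have hr : LinearMap.ker (mapL f A) = LinearMap.range (inclL (inf_le_left : A ⊓ f.ker ≤ A)) := by
    ext x
    rw [LinearMap.mem_ker, LinearMap.mem_range]
    constructor
    · intro hx
      have hx' : f (x.toMul : A) = 1 := congrArg (fun y : Additive (A.map f) => ((y.toMul : A.map f) : H)) hx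
      exact ⟨Additive.ofMul ⟨(x.toMul : A), (x.toMul : A).2, hx'⟩, rfl⟩
    · rintro ⟨y, rfl⟩
      apply Additive.toMul.injective
      apply Subtype.ext
      exact (y.toMul : (A ⊓ f.ker : Subgroup G)).2.2
  rw [hr, rk]
  exact (LinearEquiv.ofInjective _ (inclL_inj _)).finrank_eq.symm

lemma rk_tors {A : Subgroup G} (hA : FGg A) (h : ∀ x ∈ A, x ^ 2 = 1) : rk A = 0 := by
  refine (Module.finrank_eq_zero_iff (R := ℤ) (M := Additive A)).2 fun x => ⟨2, two_ne_zero, ?_⟩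
  apply Additive.toMul.injective
  apply Subtype.ext
  have := h _ (x.toMul : A).2
  rw [two_smul, toMul_add, Subgroup.coe_mul, ← sq, this]
  rfl

end rk

section NF
variable {k : Type} [Field k] [NumberField k]

/-- realising prescribed valuations -/
lemma GoodS.exists_val {S : Finset (Pl k)} (hS : GoodS S) (T : Finset (Pl k)) (hT : ∀ v ∈ T, v ∉ S) (n : Pl k → ℤ) :
    ∃ g : kˣ, (∀ v ∈ T, vl v (g : k) = WithZero.exp (n v)) ∧ ∀ v, v ∉ S → v ∉ T → vl v (g : k) = 1 := by
  classical
  induction T using Finset.induction_on with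
  | empty => exact ⟨1, by simp, by simp⟩
  | insert v T hv ih =>
    obtain ⟨g, h1, h2⟩ := ih (fun w hw => hT w (Finset.mem_insert_of_mem hw))
    have hvS := hT v (Finset.mem_insert_self _ _)
    obtain ⟨_, y, h3, h4⟩ := hS v hvS
    refine ⟨g * y ^ (-(n v)), ?_, ?_⟩
    · intro w hw
      push_cast
      rw [map_mul, map_zpow₀]
      rcases Finset.mem_insert.1 hw with rfl | hw'
      · rw [h2 w hvS hv, h3, one_mul, ← WithZero.exp_zsmul]; simp
      · rw [h1 w hw', h4 w (hT w hw) (by rintro rfl; exact hv hw'), one_zpow, mul_one]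
    · intro w hw hwT
      rw [Finset.mem_insert, not_or] at hwT
      push_cast
      rw [map_mul, map_zpow₀, h2 w hw hwT.2, h4 w hw hwT.1, one_zpow, mul_one]

variable {K : Type} [Field K] [NumberField K] [Algebra k K] {c : kˣ}

namespace QE
variable (q : QE k K c)

lemma θ_ne : q.θ ≠ 0 := by
  intro h
  have := q.sq
  rw [h, zero_pow two_ne_zero] at this
  exact (map_ne_zero (algebraMap k K)).2 c.ne_zero this.symm

lemma σ_rep (x y : k) : q.σ (algebraMap k K x + algebraMap k K y * q.θ) = algebraMap k K x - algebraMap k K y * q.θ := by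
  rw [map_add, map_mul, AlgEquiv.commutes, AlgEquiv.commutes, q.hσ]; ring

lemma σσ (z : K) : q.σ (q.σ z) = z := by
  obtain ⟨x, y, rfl⟩ := q.rep z
  rw [q.σ_rep, map_sub, map_mul, AlgEquiv.commutes, AlgEquiv.commutes, q.hσ]; ring

lemma fixed {z : K} (h : q.σ z = z) : ∃ x : k, algebraMap k K x = z := by
  obtain ⟨x, y, rfl⟩ := q.rep z
  rw [q.σ_rep] at h
  have h2 : (2 : K) * (algebraMap k K y * q.θ) = 0 := by linear_combination -h
  have h3 : algebraMap k K y = 0 := by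
    rcases mul_eq_zero.1 h2 with h2 | h2
    · exact absurd h2 two_ne_zero
    · exact (mul_eq_zero.1 h2).resolve_right q.θ_ne
  exact ⟨x, by rw [h3]; ring⟩

lemma norm_rep (x y : k) : (algebraMap k K x + algebraMap k K y * q.θ) * q.σ (algebraMap k K x + algebraMap k K y * q.θ) =
    algebraMap k K (x ^ 2 - c * y ^ 2) := by
  rw [q.σ_rep, map_sub, map_mul, map_pow, map_pow, ← q.sq]; ring

lemma US_σ {S : Finset (Pl k)} {z : Kˣ} (hz : z ∈ US (SK k K S)) :
    Units.map (q.σ : K →* K) z ∈ US (SK k K S) := by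
  intro W hW
  obtain ⟨W', h1, h2⟩ := exists_conj q.σ W
  rw [mem_SK] at hW
  rw [Units.coe_map]
  have := hz W' (by rw [mem_SK, h1]; exact hW)
  rw [h2] at this
  exact this

/-- Hilbert 90 with `S`-units -/
lemma h90 {S : Finset (Pl k)} (hS : GoodS S) (hc : c ∈ US S) {d : Kˣ} (hd : d ∈ US (SK k K S))
    (hN : (d : K) * q.σ d = 1) : ∃ z : Kˣ, z ∈ US (SK k K S) ∧ (d : K) * q.σ z = z := by
  classical
  obtain ⟨z, hz0, hz⟩ : ∃ z : K, z ≠ 0 ∧ (d : K) * q.σ z = z := by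
    by_cases h : (1 : K) + d = 0
    · refine ⟨q.θ, q.θ_ne, ?_⟩
      have : (d : K) = -1 := by linear_combination h
      rw [this, q.hσ]; ring
    · refine ⟨1 + d, h, ?_⟩
      rw [map_add, map_one]
      linear_combination hN
  obtain ⟨x, y, hxy⟩ := q.rep z
  have key : ∀ v : Pl k, v ∉ S → ∃ m : kˣ, ∀ W : Pl K, und k W = v → vl W z = vl W (algebraMap k K m) := by
    intro v hv
    have h2 := (hS v hv).1
    obtain ⟨m, hx1, hy1, hm1⟩ : ∃ m : kˣ, vl v x ≤ vl v m ∧ vl v y ≤ vl v m ∧ (m.1 = x ∨ m.1 = y) := by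
      by_cases hx0 : x = 0
      · have hy0 : y ≠ 0 := by rintro rfl; rw [hx0] at hxy; simp at hxy; exact hz0 hxy
        exact ⟨Units.mk0 y hy0, by simp [hx0], by simp, Or.inr rfl⟩
      by_cases hy0 : y = 0
      · exact ⟨Units.mk0 x hx0, by simp, by simp [hy0], Or.inl rfl⟩
      rcases le_total (vl v x) (vl v y) with h | h
      · exact ⟨Units.mk0 y hy0, h, le_rfl, Or.inr rfl⟩
      · exact ⟨Units.mk0 x hx0, le_rfl, h, Or.inl rfl⟩
    refine ⟨m, ?_⟩
    rintro W rfl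
    have hvS : W ∉ SK k K S := by rw [mem_SK]; exact hv
    have hθ : vl W q.θ = 1 := by
      have : vl W q.θ ^ 2 = 1 := by
        rw [← map_pow, q.sq, und_eq_one]; exact hc _ hv
      by_contra hne
      rcases lt_or_gt_of_ne hne with h | h
      · exact absurd this (pow_lt_one₀ (zero_le) h two_ne_zero).ne
      · exact absurd this (one_lt_pow₀ h two_ne_zero).ne'
    set A := algebraMap k K
    have hle : ∀ a b : k, vl (und k W) a ≤ vl (und k W) b → vl W (A a) ≤ vl W (A b) := by
      intro a b hab
      rw [← not_lt, und_lt, not_lt]; exact hab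
    have hX := hle _ _ hx1
    have hY := hle _ _ hy1
    have h2W : vl W (2 : K) = 1 := by
      have := (und_eq_one k W 2).2 h2
      rwa [map_ofNat] at this
    have hσz : vl W (q.σ z) = vl W z := by
      conv_rhs => rw [← hz, map_mul, hd W hvS, one_mul]
    apply le_antisymm
    · rw [hxy]
      refine (Valuation.map_add _ _ _).trans (max_le hX ?_)
      rw [map_mul, hθ, mul_one]; exact hY
    · have hs : ∀ t, 2 * t = z + q.σ z ∨ 2 * t = z - q.σ z → vl W t ≤ vl W z := by
        intro t ht
        have : vl W t = vl W (2 * t) := by rw [map_mul, h2W, one_mul]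
        rw [this]
        rcases ht with ht | ht
        · rw [ht]; exact (Valuation.map_add _ _ _).trans (max_le le_rfl hσz.le)
        · rw [ht]; exact (Valuation.map_sub _ _ _).trans (max_le le_rfl hσz.le)
      have hσ := q.σ_rep x y
      rw [← hxy] at hσ
      have e1 : vl W (A x) ≤ vl W z := hs _ (Or.inl (by rw [hσ]; conv_rhs => { rw [hxy] }; ring))
      have e2 : vl W (A y) ≤ vl W z := by
        have := hs (A y * q.θ) (Or.inr (by rw [hσ]; conv_rhs => { rw [hxy] }; ring))
        rwa [map_mul, hθ, mul_one] at this
      rcases hm1 with h | h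
      · rw [h]; exact e1
      · rw [h]; exact e2
  choose! m hm using key
  -- finite support
  have hfin : {v : Pl k | v ∉ S ∧ vl v (m v : k) ≠ 1}.Finite := by
    refine ((finite_ne_one (Units.mk0 z hz0)).image (und k)).subset ?_
    rintro v ⟨hv, hne⟩
    obtain ⟨W, hW⟩ := exists_over (K := K) k v
    refine ⟨W, ?_, hW⟩
    show vl W z ≠ 1
    rw [hm v hv W hW, Ne, und_eq_one, hW]
    exact hne
  obtain ⟨g, hg1, hg2⟩ := hS.exists_val hfin.toFinset (fun v hv => by simpa using ((Set.Finite.mem_toFinset _).1 hv).1)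
    (fun v => WithZero.log (vl v (m v : k)))
  have hg : ∀ v, v ∉ S → vl v (g : k) = vl v (m v : k) := by
    intro v hv
    by_cases h : vl v (m v : k) = 1
    · rw [h]; exact hg2 v hv (fun hmem => ((Set.Finite.mem_toFinset _).1 hmem).2 h)
    · rw [hg1 v ((Set.Finite.mem_toFinset _).2 ⟨hv, h⟩), WithZero.exp_log (vl_ne_zero _ _)]
  have hgK : algebraMap k K g ≠ 0 := by simp
  refine ⟨Units.mk0 (z / algebraMap k K g) (div_ne_zero hz0 hgK), ?_, ?_⟩
  · intro W hW
    rw [mem_SK] at hW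
    rw [Units.val_mk0, map_div₀, hm _ hW W rfl]
    obtain ⟨e, he, h⟩ := vl_und_pow k W
    rw [← h, ← h, hg _ hW]
    exact div_self (pow_ne_zero _ (vl_ne_zero _ _))
  · rw [Units.val_mk0, map_div₀, AlgEquiv.commutes, ← mul_div_assoc, hz]

end QE
end NF
end HM

end

section
open scoped TensorProduct
open IsDedekindDomain
open scoped WithZero

namespace HM
section NF
variable {k : Type} [Field k] [NumberField k]
variable {K : Type} [Field K] [NumberField K] [Algebra k K] {c : kˣ}

set_option linter.unusedSectionVars false

/-- if every square of an element of `A` lies in `B ≤ A`, same rank -/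
lemma rk_sq {G : Type} [CommGroup G] {A B : Subgroup G} (hA : FGg A) (h1 : A.map (powMonoidHom 2) ≤ B) (h2 : B ≤ A) :
    rk B = rk A := by
  apply le_antisymm (rk_mono h2 hA)
  have := rk_map (powMonoidHom 2) hA
  rw [rk_tors (A := A ⊓ (powMonoidHom 2 : G →* G).ker) (hA.mono inf_le_left)
    (fun x hx => (Subgroup.mem_inf.1 hx).2), add_zero] at this
  rw [this]
  exact rk_mono h1 (hA.mono h2)

lemma FI_aux (q : QE k K c) {S : Finset (Pl k)} (hS : GoodS S) (hc : c ∈ US S) :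
    (Nm (c : k)).relIndex (US S) ≠ 0 ∧ 2 * (Nm (c : k)).relIndex (US S) ≤ 2 ^ rN S c := by
  classical
  set j : kˣ →* Kˣ := Units.map (algebraMap k K : k →* K) with hj
  have jinj : Function.Injective j := Units.map_injective (algebraMap k K).injective
  set s : Kˣ →* Kˣ := Units.map (q.σ : K →* K) with hs
  set UK : Subgroup Kˣ := US (SK k K S) with hUK
  set A' : Subgroup Kˣ := (US S).map j with hA'
  set N : Kˣ →* Kˣ := MonoidHom.id Kˣ * s with hN
  set Θ : Kˣ →* Kˣ := MonoidHom.id Kˣ / s with hΘ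
  have Napp : ∀ z, N z = z * s z := fun z => rfl
  have Θapp : ∀ z, Θ z = z / s z := fun z => rfl
  have sval : ∀ z : Kˣ, ((s z : Kˣ) : K) = q.σ z := fun z => rfl
  have jval : ∀ z : kˣ, ((j z : Kˣ) : K) = algebraMap k K z := fun z => rfl
  have sj : ∀ a, s (j a) = j a := fun a => Units.ext (by rw [sval, jval, AlgEquiv.commutes])
  have ss : ∀ a, s (s a) = a := fun a => Units.ext (by rw [sval, sval, q.σσ])
  have sUK : ∀ z ∈ UK, s z ∈ UK := fun z hz => q.US_σ hz
  have jUK : ∀ a : kˣ, j a ∈ UK ↔ a ∈ US S := by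
    intro a
    constructor
    · intro h v hv
      obtain ⟨W, rfl⟩ := exists_over (K := K) k v
      have := h W (by rw [mem_SK]; exact hv)
      rwa [jval, und_eq_one] at this
    · intro h W hW
      rw [mem_SK] at hW
      rw [jval, und_eq_one]; exact h _ hW
  have sfix : ∀ z : Kˣ, s z = z → ∃ a : kˣ, j a = z := by
    intro z hz
    obtain ⟨x, hx⟩ := q.fixed (z := z) (congrArg Units.val hz)
    have hx0 : x ≠ 0 := by rintro rfl; rw [map_zero] at hx; exact z.ne_zero hx.symm
    exact ⟨Units.mk0 x hx0, Units.ext hx⟩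
  have A'UK : A' ≤ UK := by rintro _ ⟨a, ha, rfl⟩; exact (jUK a).2 ha
  have fixA' : ∀ z ∈ UK, s z = z → z ∈ A' := by
    intro z hz h
    obtain ⟨a, rfl⟩ := sfix z h
    exact ⟨a, (jUK a).1 hz, rfl⟩
  have A'fix : ∀ z ∈ A', s z = z := by rintro _ ⟨a, ha, rfl⟩; exact sj a
  set NU := UK.map N with hNU
  set A2 := A'.map (powMonoidHom 2) with hA2
  set D := UK ⊓ N.ker with hD
  have hUKfg : FGg UK := inferInstanceAs (Module.Finite ℤ (Additive (US (SK k K S))))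
  have hUSfg : FGg (US S) := inferInstanceAs (Module.Finite ℤ (Additive (US S)))
  have hA'fg : FGg A' := hUSfg.map j
  have hDfg : FGg D := hUKfg.mono inf_le_left
  have A2NU : A2 ≤ NU := by
    rintro _ ⟨a, ha, rfl⟩
    refine ⟨a, A'UK ha, ?_⟩
    rw [Napp, A'fix a ha]; exact (sq a).symm
  have NUA' : NU ≤ A' := by
    rintro _ ⟨z, hz, rfl⟩
    apply fixA' _ (mul_mem hz (sUK z hz))
    rw [map_mul, ss, mul_comm]
  have NUNm : NU ≤ ((Nm (c : k))).map j := by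
    rintro _ ⟨z, hz, rfl⟩
    obtain ⟨a, ha, ha2⟩ := NUA' ⟨z, hz, rfl⟩
    refine ⟨a, ?_, ha2⟩
    obtain ⟨x, y, hxy⟩ := q.rep (z : K)
    refine ⟨x, y, (algebraMap k K).injective ?_⟩
    rw [← q.norm_rep, ← hxy]
    exact congrArg Units.val ha2
  -- index computations
  have i1 : A2.relIndex NU * NU.relIndex A' = A2.relIndex A' := Subgroup.relIndex_mul_relIndex _ _ _ A2NU NUA'
  have hm1 : (-1 : Kˣ) ∈ A' := ⟨-1, neg_one_mem_US S, by ext; simp [jval]⟩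
  have rkA' : rk A' = rk (US S) := by
    have := rk_map j hUSfg
    rw [rk_tors (A := US S ⊓ j.ker) (hUSfg.mono inf_le_left), add_zero] at this
    · exact this.symm
    · rintro x ⟨_, hx⟩
      have : x = 1 := jinj (by rw [map_one]; exact hx)
      rw [this, one_pow]
  have rkUS : rk (US S) + 1 = sN k S := US_finrank' S
  have rkUK : rk UK + 1 = sN K (SK k K S) := US_finrank' _
  have i2 : A2.relIndex A' = 2 ^ (sN k S) := by
    rw [← rkUS, ← rkA']; exact sq_relIndex A' hm1
  have hmD : (-1 : Kˣ) ∈ D := by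
    refine Subgroup.mem_inf.2 ⟨neg_one_mem_US _, ?_⟩
    rw [MonoidHom.mem_ker, Napp]
    have : s (-1) = -1 := by ext; simp [sval]
    rw [this]; simp
  set D2 := D.map (powMonoidHom 2) with hD2
  have i3 : D2.relIndex D = 2 ^ (rk D + 1) := sq_relIndex D hmD
  have ΘD : UK.map Θ = D := by
    apply le_antisymm
    · rintro _ ⟨z, hz, rfl⟩
      refine Subgroup.mem_inf.2 ⟨div_mem hz (sUK z hz), ?_⟩
      rw [MonoidHom.mem_ker, Napp, Θapp, map_div, ss]
      simp
    · rintro d ⟨hd, hd2⟩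
      obtain ⟨z, hz, hz2⟩ := q.h90 hS hc hd (congrArg Units.val hd2)
      refine ⟨z, hz, ?_⟩
      rw [Θapp, div_eq_iff_eq_mul]
      exact Units.ext hz2.symm
  have i4 : A2.relIndex NU = D2.relIndex D := by
    rw [← ΘD, hNU, ← Subgroup.relIndex_comap, ← Subgroup.relIndex_comap, ← Subgroup.inf_relIndex_right, ← Subgroup.inf_relIndex_right (D2.comap Θ)]
    congr 1
    ext z
    constructor
    · rintro ⟨⟨a, ha, haz⟩, hz⟩
      refine Subgroup.mem_inf.2 ⟨⟨z / a, Subgroup.mem_inf.2 ⟨div_mem hz (A'UK ha), ?_⟩, ?_⟩, hz⟩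
      · rw [MonoidHom.mem_ker, map_div, ← haz, Napp a, A'fix a ha]
        show a ^ 2 / (a * a) = 1
        rw [sq]; exact div_self' _
      · have haz' : a ^ 2 = z * s z := haz
        show (z / a) ^ 2 = z / s z
        rw [div_pow, haz', sq, mul_div_mul_left_eq_div]
    · rintro ⟨⟨d, ⟨hd, hd1⟩, hdz⟩, hz⟩
      have hd1' : d * s d = 1 := hd1
      have hdz' : d ^ 2 = z / s z := hdz
      have e2 : s d = d⁻¹ := eq_inv_of_mul_eq_one_right hd1'
      have e1 : s z = z / d ^ 2 := by rw [hdz']; simp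
      refine Subgroup.mem_inf.2 ⟨⟨z / d, fixA' _ (div_mem hz hd) ?_, ?_⟩, hz⟩
      · rw [map_div, e1, e2, sq]; simp [div_eq_mul_inv, mul_assoc]
      · show (z / d) ^ 2 = z * s z
        rw [e1, div_pow, sq, mul_div_assoc]
  have rkNU : rk NU = rk A' := rk_sq hA'fg A2NU NUA'
  have rkN : rk UK = rk NU + rk D := rk_map N hUKfg
  have hge := q.sN_ge S
  have main : NU.relIndex A' ≠ 0 ∧ 2 * NU.relIndex A' ≤ 2 ^ rN S c := by
    rw [i4, i3, i2] at i1
    constructor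
    · intro h; rw [h, mul_zero] at i1; exact absurd i1.symm (pow_ne_zero _ two_ne_zero)
    · have hp : 0 < 2 ^ (rk D + 1) := by positivity
      refine Nat.le_of_mul_le_mul_left ?_ hp
      calc 2 ^ (rk D + 1) * (2 * NU.relIndex A') = 2 * (2 ^ (rk D + 1) * NU.relIndex A') := by ring
        _ = 2 ^ (sN k S + 1) := by rw [i1]; ring
        _ ≤ 2 ^ (rk D + 1 + rN S c) := Nat.pow_le_pow_right (by norm_num) (by omega)
        _ = _ := by rw [pow_add]
  have hdvd : (Nm (c : k)).relIndex (US S) ∣ NU.relIndex A' := by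
    have := Subgroup.relIndex_dvd_of_le_left A' NUNm
    rwa [hA', Subgroup.relIndex_map_map_of_injective _ _ jinj] at this
  refine ⟨fun h => main.1 ?_, ?_⟩
  · rw [h] at hdvd; exact Nat.eq_zero_of_zero_dvd hdvd
  · have := Nat.le_of_dvd (Nat.pos_of_ne_zero main.1) hdvd
    omega

theorem FI {S : Finset (Pl k)} (hS : GoodS S) (hc : c ∈ US S) (hsq : ¬ IsSquare (c : k)) :
    (Nm (c : k)).relIndex (US S) ≠ 0 ∧ 2 * (Nm (c : k)).relIndex (US S) ≤ 2 ^ rN S c := by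
  obtain ⟨K, i1, i2, i3, ⟨q⟩⟩ := exists_QE k (c : k) hsq
  exact FI_aux q hS hc

end NF
end HM

end

section
open scoped TensorProduct
open IsDedekindDomain
open scoped WithZero

namespace HM

lemma card_le_relIndex {G ι : Type} [CommGroup G] [Finite ι] {H U : Subgroup G} (h0 : H.relIndex U ≠ 0) (f : ι → G)
    (hf : ∀ i, f i ∈ U) (hinj : ∀ i j, f i / f j ∈ H → i = j) : Nat.card ι ≤ H.relIndex U := by
  have : Finite (U ⧸ H.subgroupOf U) := Nat.finite_of_card_ne_zero h0
  have : Function.Injective (fun i => (QuotientGroup.mk (⟨f i, hf i⟩ : U) : U ⧸ H.subgroupOf U)) := by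
    intro i j hij
    rw [QuotientGroup.eq] at hij
    apply hinj i j
    rw [Subgroup.mem_subgroupOf] at hij
    have := inv_mem hij
    simpa [div_eq_mul_inv, mul_comm] using this
  exact Nat.card_le_card_of_injective _ this

section NF
variable {k : Type} [Field k] [NumberField k]

lemma approx_units (S : Finset (Pl k)) (b : Pl k → kˣ) : ∃ x : kˣ, ∀ v ∈ S, x / b v ∈ U4 (vl v) := by
  rcases S.eq_empty_or_nonempty with rfl | ⟨v0, hv0⟩
  · exact ⟨1, by simp⟩
  obtain ⟨y, hy⟩ := weak_approx S (fun v => (b v : k)) (fun v => vl v 4 * vl v (b v : k))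
    (fun v => mul_ne_zero (good_vl v).v4 (vl_ne_zero v _))
  have hy0 : y ≠ 0 := by
    rintro rfl
    have := hy v0 hv0
    rw [zero_sub, Valuation.map_neg] at this
    refine absurd this (not_lt.2 ?_)
    calc _ ≤ 1 * vl v0 (b v0 : k) := by gcongr; exact v_four_le _
      _ = _ := one_mul _
  refine ⟨Units.mk0 y hy0, fun v hv => mem_U4 _ ?_⟩
  have hb := (b v).ne_zero
  have : (((Units.mk0 y hy0 / b v : kˣ) : k) - 1) = (y - b v) / (b v : k) := by
    rw [Units.val_div_eq_div_val, Units.val_mk0]; field_simp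
  rw [this, map_div₀, div_lt_iff₀ (zero_lt_iff.2 (vl_ne_zero v _))]
  exact hy v hv

lemma exists_big (S0 : Finset (Pl k)) (X : Finset kˣ) : ∃ S, S0 ⊆ S ∧ GoodS S ∧ ∀ x ∈ X, x ∈ US S := by
  classical
  obtain ⟨S1, h1⟩ := exists_goodS (k := k)
  choose T hT using fun x : kˣ => exists_S_unit x
  refine ⟨S0 ∪ S1 ∪ X.biUnion T, ?_, ?_, ?_⟩
  · exact Finset.subset_union_left.trans Finset.subset_union_left
  · exact h1 _ (Finset.subset_union_right.trans Finset.subset_union_left)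
  · intro x hx
    exact US_mono ((Finset.subset_biUnion_of_mem T hx).trans Finset.subset_union_right) (hT x)

theorem SqThm (c : kˣ) (h : ∀ i, c ∈ LS i) : IsSquare (c : k) := by
  classical
  by_contra hsq
  obtain ⟨S, -, hS, hc⟩ := exists_big (k := k) ∅ {c}
  obtain ⟨h1, h2⟩ := FI hS (hc c (by simp)) hsq
  have : rN S c = 0 := by
    rw [rN, Finset.card_eq_zero, Finset.filter_eq_empty_iff]
    intro i _; simpa using h i
  rw [this] at h2
  omega

theorem AESq [IsEmpty (k →+* ℝ)] (c : kˣ) (R : Finset (Pl k)) (hR : ∀ v, v ∉ R → c ∈ Sq (vl v)) : IsSquare (c : k) := by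
  classical
  by_contra hsq
  wlog hR' : ∀ v ∈ R, c ∉ Sq (vl v) generalizing R
  · refine this (R.filter (fun v => c ∉ Sq (vl v))) ?_ ?_
    · intro v hv
      by_contra hc
      exact hv (Finset.mem_filter.2 ⟨by_contra fun h => hc (hR v h), hc⟩)
    · intro v hv; exact (Finset.mem_filter.1 hv).2
  have : ∀ v : Pl k, ∃ b : kˣ, v ∈ R → b ∉ Nm (c : k) ⊔ Sq (vl v) := by
    intro v
    by_cases hv : v ∈ R
    · obtain ⟨b, hb⟩ := L1a (good_vl v) c (hR' v hv)
      exact ⟨b, fun _ => hb⟩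
    · exact ⟨1, fun h => absurd h hv⟩
  choose b hb using this
  choose x hx using fun T : Set R => approx_units R (fun v => if ∃ h : v ∈ R, (⟨v, h⟩ : R) ∈ T then b v else 1)
  obtain ⟨S, hRS, hS, hX⟩ := exists_big R (insert c (Finset.univ.image x))
  have hc := hX c (Finset.mem_insert_self _ _)
  obtain ⟨h1, h2⟩ := FI hS hc hsq
  have hr : rN S c = R.card := by
    rw [rN, ← Finset.card_map (Function.Embedding.inl : Pl k ↪ Pl k ⊕ (k →+* ℝ))]
    congr 1
    ext i
    rcases i with v | φ
    · rw [Finset.mem_filter, inl_mem_Om, Finset.mem_map]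
      simp only [Function.Embedding.inl_apply, Sum.inl.injEq, exists_eq_right, LS]
      constructor
      · rintro ⟨_, h⟩; by_contra h'; exact h (hR v h')
      · intro h; exact ⟨hRS h, hR' v h⟩
    · exact (IsEmpty.false φ).elim
  have h3 := card_le_relIndex h1 x (fun T => hX _ (Finset.mem_insert_of_mem (Finset.mem_image_of_mem _ (Finset.mem_univ _)))) (by
    have key : ∀ T T' : Set R, x T / x T' ∈ Nm (c : k) → ∀ v, v ∈ T → v ∈ T' := by
      intro T T' h v hv
      by_contra hv'
      have e1 := hx T v v.2
      have e2 := hx T' v v.2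
      rw [if_pos ⟨v.2, hv⟩] at e1
      rw [if_neg (by rintro ⟨_, h⟩; exact hv' h), div_one] at e2
      apply hb v v.2
      have : b v = (x T / x T') * (x T' / (x T / b v)) := by
        rw [div_mul_div_cancel, div_div_cancel]
      rw [this]
      exact Subgroup.mul_mem_sup h (U4_le_Sq _ (div_mem e2 e1))
    intro T T' h
    apply Set.Subset.antisymm
    · exact fun v hv => key T T' h v hv
    · refine fun v hv => key T' T ?_ v hv
      have := inv_mem h
      rwa [inv_div] at this)
  rw [Nat.card_eq_fintype_card, Fintype.card_set, Fintype.card_coe, ← hr] at h3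
  have : 0 < 2 ^ rN S c := by positivity
  omega
end NF
end HM

end

section
open scoped TensorProduct
open IsDedekindDomain
open scoped WithZero

namespace HM

lemma relIndex_le_two {G : Type} [CommGroup G] {H M : Subgroup G} (a : G) (h : ∀ x ∈ M, x ∈ H ∨ x / a ∈ H) :
    H.relIndex M ≤ 2 := by
  classical
  have : Function.Injective (fun q : M ⧸ H.subgroupOf M => decide ((q.out : G) ∈ H)) := by
    intro p q hpq
    simp only [decide_eq_decide] at hpq
    rw [← Quotient.out_eq' p, ← Quotient.out_eq' q]
    refine QuotientGroup.eq.2 ?_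
    rw [Subgroup.mem_subgroupOf]
    push_cast
    by_cases hp : (p.out : G) ∈ H
    · exact mul_mem (inv_mem hp) (hpq.1 hp)
    · have h1 := (h _ p.out.2).resolve_left hp
      have h2 := (h _ q.out.2).resolve_left (fun h => hp (hpq.2 h))
      have := div_mem h2 h1
      rw [div_div_div_cancel_right] at this
      rwa [mul_comm, ← div_eq_mul_inv]
  have := Nat.card_le_card_of_injective _ this
  rwa [Nat.card_eq_fintype_card (α := Bool), Fintype.card_bool] at this

section NF
variable {k : Type} [Field k] [NumberField k]

/-- units at odd places -/
lemma Sq_relIndex_odd {w : Pl k} (h2 : vl w 2 = 1) : (Sq (vl w)).relIndex (Uv (vl w)) ≠ 0 ∧ (Sq (vl w)).relIndex (Uv (vl w)) ≤ 2 := by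
  have := Sq_relIndex_Uv (good_vl w) {0} (fun x hx => ⟨0, by simp, by rw [sub_zero, h2]; exact hx⟩)
  simpa using this

lemma Sq_mul_odd {w : Pl k} (h2 : vl w 2 = 1) {a b : kˣ} (ha : vl w (a : k) = 1) (hb : vl w (b : k) = 1)
    (ha' : a ∉ Sq (vl w)) (hb' : b ∉ Sq (vl w)) : a * b ∈ Sq (vl w) := by
  obtain ⟨h0, h1⟩ := Sq_relIndex_odd h2
  set H := (Sq (vl w)).subgroupOf (Uv (vl w)) with hH
  have h3 : H.index = 2 := by
    have h5 : H.index ≠ 1 := by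
      intro h
      rw [Subgroup.index_eq_one] at h
      exact ha' (Subgroup.mem_subgroupOf.1 (h ▸ Subgroup.mem_top (⟨a, ha⟩ : Uv (vl w))))
    have h6 : H.index ≠ 0 := h0
    have h7 : H.index ≤ 2 := h1
    omega
  have := (Subgroup.mul_mem_iff_of_index_two h3 (a := (⟨a, ha⟩ : Uv (vl w))) (b := ⟨b, hb⟩)).2
    (iff_of_false ha' hb')
  exact this

lemma Sq_up {K : Type} [Field K] [NumberField K] [Algebra k K] (W : Pl K) {c : kˣ} (hc : c ∈ Sq (vl (und k W))) :
    Units.map (algebraMap k K : k →* K) c ∈ Sq (vl W) := by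
  obtain ⟨s, u, hu, rfl⟩ := (mem_Sq _).1 hc
  rw [map_mul, map_pow]
  refine mul_mem (sq_mem_Sq _ _) (U4_le_Sq _ (mem_U4 _ ?_))
  have := U4_val (good_vl _).v4 hu
  rw [← und_lt, map_sub, map_one, map_ofNat] at this
  exact this

lemma isEmpty_of_neg {K : Type} [Field K] [Algebra k K] {a : k} (q : QE k K a) (ha : ∀ φ : k →+* ℝ, φ a < 0) :
    IsEmpty (K →+* ℝ) := by
  refine ⟨fun ψ => ?_⟩
  have h1 := ha (ψ.comp (algebraMap k K))
  rw [RingHom.comp_apply, ← q.sq, map_pow] at h1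
  exact absurd h1 (not_lt.2 (sq_nonneg _))

theorem Cheb (a c : kˣ) (ha : ¬ IsSquare (a : k)) (hneg : ∀ φ : k →+* ℝ, φ a < 0) (hc : ¬ IsSquare (c : k))
    (hac : ∀ y : k, (c : k) ≠ a * y ^ 2) (S1 : Finset (Pl k)) :
    ∃ w, w ∉ S1 ∧ a ∈ Sq (vl w) ∧ c ∉ Sq (vl w) := by
  classical
  by_contra hcon
  push Not at hcon
  obtain ⟨S, hS1, hS, hX⟩ := exists_big S1 {a, c}
  have haS := hX a (by simp)
  have hcS := hX c (by simp)
  obtain ⟨K, i1, i2, i3, ⟨q⟩⟩ := exists_QE k (a : k) ha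
  have := isEmpty_of_neg q hneg
  have hsq := AESq (Units.map (algebraMap k K : k →* K) c) (SK k K S) (by
    intro W hW
    rw [mem_SK] at hW
    by_cases h1 : a ∈ Sq (vl (und k W))
    · exact Sq_up W (hcon _ (fun h => hW (hS1 h)) h1)
    by_cases h2 : c ∈ Sq (vl (und k W))
    · exact Sq_up W h2
    have h3 := Sq_up W (Sq_mul_odd (hS _ hW).1 (haS _ hW) (hcS _ hW) h1 h2)
    rw [map_mul] at h3
    have h4 : Units.map (algebraMap k K : k →* K) a ∈ Sq (vl W) := by
      have : Units.map (algebraMap k K : k →* K) a = (Units.mk0 q.θ q.θ_ne) ^ 2 := by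
        ext; push_cast; exact q.sq.symm
      rw [this]; exact sq_mem_Sq _ _
    exact (Subgroup.mul_mem_cancel_left _ h4).1 h3)
  obtain ⟨z, hz⟩ := hsq
  obtain ⟨x, y, rfl⟩ := q.rep z
  have hz' : algebraMap k K c = algebraMap k K (x ^ 2 + a * y ^ 2) + algebraMap k K (2 * x * y) * q.θ := by
    have : algebraMap k K c = _ := hz
    rw [this, map_add, map_mul, map_mul, map_mul, map_pow, map_pow, ← q.sq, map_ofNat]; ring
  have h5 := congrArg q.σ hz'
  rw [q.σ_rep, AlgEquiv.commutes] at h5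
  have h6 : algebraMap k K (2 * x * y) = 0 := by
    have : (2 : K) * (algebraMap k K (2 * x * y) * q.θ) = 0 := by linear_combination h5 - hz'
    rcases mul_eq_zero.1 this with h | h
    · exact absurd h two_ne_zero
    · exact (mul_eq_zero.1 h).resolve_right q.θ_ne
  have h7 : (c : k) = x ^ 2 + a * y ^ 2 := (algebraMap k K).injective (by rw [hz', h6]; ring)
  rw [map_eq_zero] at h6
  rcases mul_eq_zero.1 h6 with h | h
  · have hx : x = 0 := (mul_eq_zero.1 h).resolve_left two_ne_zero
    rw [hx] at h7
    exact hac y (by rw [h7]; ring)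
  · rw [h] at h7
    exact hc ⟨x, by rw [h7]; ring⟩

/-- elements which are local squares on `T` -/
def HT (T : Finset (Pl k)) : Subgroup kˣ := T.inf (fun w => Sq (vl w))

lemma mem_HT {T : Finset (Pl k)} {x : kˣ} : x ∈ HT T ↔ ∀ w ∈ T, x ∈ Sq (vl w) := by
  rw [HT, ← Subgroup.zpowers_le, Finset.le_inf_iff]
  simp only [Subgroup.zpowers_le]

lemma HT_relIndex {S : Finset (Pl k)} (hS : GoodS S) (T : Finset (Pl k)) (hT : ∀ w ∈ T, w ∉ S) :
    (HT T).relIndex (US S) ≠ 0 ∧ (HT T).relIndex (US S) ≤ 2 ^ T.card := by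
  classical
  induction T using Finset.induction_on with
  | empty => simp [HT]
  | insert w T hw ih =>
    obtain ⟨h1, h2⟩ := ih (fun w hw => hT w (Finset.mem_insert_of_mem hw))
    have hwS := hT w (Finset.mem_insert_self _ _)
    obtain ⟨h3, h4⟩ := Sq_relIndex_odd (hS w hwS).1
    have hle : US S ≤ Uv (vl w) := fun x hx => hx w hwS
    have h5 : (Sq (vl w)).relIndex (US S) ≠ 0 := fun h => h3 (by
      have := Subgroup.relIndex_le_of_le_right hle h3
      exfalso
      exact (Subgroup.relIndex_ne_zero_trans h3 (Subgroup.relIndex_eq_one.2 hle ▸ one_ne_zero)) h)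
    have h6 := (Subgroup.relIndex_le_of_le_right hle h3).trans h4
    have e : HT (insert w T) = Sq (vl w) ⊓ HT T := by rw [HT, Finset.inf_insert]; rfl
    rw [e, Finset.card_insert_of_notMem hw]
    refine ⟨Subgroup.relIndex_inf_ne_zero h5 h1, (Subgroup.relIndex_inf_le).trans ?_⟩
    calc _ ≤ 2 * 2 ^ T.card := Nat.mul_le_mul h6 h2
      _ = _ := by ring

lemma US_sq_of_isSquare {S : Finset (Pl k)} {x : kˣ} (hx : x ∈ US S) (h : IsSquare (x : k)) :
    x ∈ (US S).map (powMonoidHom 2) := by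
  obtain ⟨r, hr⟩ := h
  have hr0 : r ≠ 0 := by rintro rfl; simp at hr
  have e : (Units.mk0 r hr0) ^ 2 = x := by ext; push_cast; rw [Units.val_mk0, hr, sq]
  refine ⟨Units.mk0 r hr0, ?_, e⟩
  intro v hv
  have := hx v hv
  rw [← e] at this
  push_cast at this
  rw [map_pow] at this
  exact (pow_eq_one_iff_of_nonneg (zero_le) two_ne_zero).1 this

lemma exists_T {S : Finset (Pl k)} (hS : GoodS S) (a : kˣ) (haS : a ∈ US S) (ha : ¬ IsSquare (a : k))
    (hneg : ∀ φ : k →+* ℝ, φ a < 0) (n : ℕ) (hn : n + 1 ≤ sN k S) :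
    ∃ T : Finset (Pl k), T.card = n ∧ (∀ w ∈ T, w ∉ S) ∧ (∀ w ∈ T, a ∈ Sq (vl w)) ∧
      ∀ P : Pl k → Prop, ∃ u ∈ US S, ∀ w ∈ T, u ∈ Sq (vl w) ↔ P w := by
  classical
  induction n with
  | zero => exact ⟨∅, by simp, by simp, by simp, fun P => ⟨1, one_mem _, by simp⟩⟩
  | succ n ih =>
    obtain ⟨T, h1, h2, h3, h4⟩ := ih (by omega)
    obtain ⟨i1, i2⟩ := HT_relIndex hS T h2
    obtain ⟨c, hcU, hcT, hc1, hc2⟩ : ∃ c ∈ US S, c ∈ HT T ∧ ¬ IsSquare (c : k) ∧ ∀ y : k, (c : k) ≠ a * y ^ 2 := by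
      by_contra hcon
      push Not at hcon
      have j1 : ((US S).map (powMonoidHom 2)).relIndex (HT T ⊓ US S) ≤ 2 := by
        apply relIndex_le_two a
        intro x hx
        obtain ⟨hx1, hx2⟩ := Subgroup.mem_inf.1 hx
        by_cases h : IsSquare (x : k)
        · exact Or.inl (US_sq_of_isSquare hx2 h)
        · obtain ⟨y, hy⟩ := hcon x hx2 hx1 h
          refine Or.inr (US_sq_of_isSquare (div_mem hx2 haS) ⟨y, ?_⟩)
          rw [Units.val_div_eq_div_val, hy]
          field_simp
      have j2 := Subgroup.relIndex_mul_relIndex ((US S).map (powMonoidHom 2)) (HT T ⊓ US S) (US S) (by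
        rintro _ ⟨x, hx, rfl⟩
        refine Subgroup.mem_inf.2 ⟨mem_HT.2 fun w _ => sq_mem_Sq _ x, pow_mem hx 2⟩) inf_le_right
      rw [US_sq_relIndex, Subgroup.inf_relIndex_right] at j2
      have j3 := Nat.mul_le_mul j1 i2
      rw [j2, h1] at j3
      have j4 : 2 ^ (n + 2) ≤ 2 ^ sN k S := Nat.pow_le_pow_right (by norm_num) (by omega)
      have j5 : 0 < 2 ^ n := by positivity
      have : 2 ^ (n + 2) = 2 * (2 * 2 ^ n) := by ring
      omega
    obtain ⟨w, hw, hwa, hwc⟩ := Cheb a c ha hneg hc1 hc2 (S ∪ T)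
    rw [Finset.mem_union, not_or] at hw
    refine ⟨insert w T, ?_, ?_, ?_, ?_⟩
    · rw [Finset.card_insert_of_notMem hw.2, h1]
    · intro x hx
      rcases Finset.mem_insert.1 hx with rfl | hx
      · exact hw.1
      · exact h2 x hx
    · intro x hx
      rcases Finset.mem_insert.1 hx with rfl | hx
      · exact hwa
      · exact h3 x hx
    · intro P
      obtain ⟨u, hu, hu2⟩ := h4 P
      by_cases hP : u ∈ Sq (vl w) ↔ P w
      · refine ⟨u, hu, fun x hx => ?_⟩
        rcases Finset.mem_insert.1 hx with rfl | hx
        · exact hP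
        · exact hu2 x hx
      · refine ⟨u * c, mul_mem hu hcU, fun x hx => ?_⟩
        rcases Finset.mem_insert.1 hx with rfl | hx
        · by_cases hux : u ∈ Sq (vl x)
          · have : ¬ P x := fun h => hP ⟨fun _ => h, fun _ => hux⟩
            refine iff_of_false (fun h => hwc ((Subgroup.mul_mem_cancel_left _ hux).1 h)) this
          · have : P x := by by_contra h; exact hP (iff_of_false hux h)
            exact iff_of_true (Sq_mul_odd (hS x hw.1).1 (hu x hw.1) (hcU x hw.1) hux hwc) this
        · rw [← hu2 x hx]
          exact Subgroup.mul_mem_cancel_right _ (mem_HT.1 hcT x hx)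
end NF
end HM

end

section
open scoped TensorProduct
open IsDedekindDomain
open scoped WithZero

namespace HM
section NF
variable {k : Type} [Field k] [NumberField k]

lemma count_lower (c : kˣ) (R : Finset (Pl k)) (U : Subgroup kˣ) (h0 : (Nm (c : k)).relIndex U ≠ 0)
    (hR : ∀ v ∈ R, c ∉ Sq (vl v)) (hs : ∀ β : Pl k → kˣ, ∃ y ∈ U, ∀ v ∈ R, y / β v ∈ Sq (vl v)) :
    2 ^ R.card ≤ (Nm (c : k)).relIndex U := by
  classical
  have : ∀ v : Pl k, ∃ b : kˣ, v ∈ R → b ∉ Nm (c : k) ⊔ Sq (vl v) := by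
    intro v
    by_cases hv : v ∈ R
    · obtain ⟨b, hb⟩ := L1a (good_vl v) c (hR v hv)
      exact ⟨b, fun _ => hb⟩
    · exact ⟨1, fun h => absurd h hv⟩
  choose b hb using this
  choose x hxU hx using fun T : Set R => hs (fun v => if ∃ h : v ∈ R, (⟨v, h⟩ : R) ∈ T then b v else 1)
  have h3 := card_le_relIndex h0 x hxU (by
    have key : ∀ T T' : Set R, x T / x T' ∈ Nm (c : k) → ∀ v, v ∈ T → v ∈ T' := by
      intro T T' h v hv
      by_contra hv'
      have e1 := hx T v v.2
      have e2 := hx T' v v.2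
      rw [if_pos ⟨v.2, hv⟩] at e1
      rw [if_neg (by rintro ⟨_, h⟩; exact hv' h), div_one] at e2
      apply hb v v.2
      have : b v = (x T / x T') * (x T' / (x T / b v)) := by
        rw [div_mul_div_cancel, div_div_cancel]
      rw [this]
      exact Subgroup.mul_mem_sup h (div_mem e2 e1)
    intro T T' h
    apply Set.Subset.antisymm
    · exact fun v hv => key T T' h v hv
    · refine fun v hv => key T' T ?_ v hv
      have := inv_mem h
      rwa [inv_div] at this)
  rwa [Nat.card_eq_fintype_card, Fintype.card_set, Fintype.card_coe] at h3

lemma GoodS.mono {S S' : Finset (Pl k)} (h : GoodS S) (hS : S ⊆ S') : GoodS S' := by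
  intro v hv
  obtain ⟨h1, y, h2, h3⟩ := h v (fun h => hv (hS h))
  exact ⟨h1, y, h2, fun w hw => h3 w (fun h => hw (hS h))⟩

open Classical in
lemma T_surj {S T : Finset (Pl k)} (hS : GoodS S) (hT : ∀ w ∈ T, w ∉ S)
    (h : ∀ P : Pl k → Prop, ∃ u ∈ US S, ∀ w ∈ T, u ∈ Sq (vl w) ↔ P w) (β : Pl k → kˣ) :
    ∃ y ∈ US (S ∪ T), ∀ w ∈ T, y / β w ∈ Sq (vl w) := by
  obtain ⟨g, hg1, hg2⟩ := hS.exists_val T hT (fun w => WithZero.log (vl w (β w : k)))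
  obtain ⟨u, hu, hu2⟩ := h (fun w => β w / g ∈ Sq (vl w))
  refine ⟨u * g, mul_mem (US_mono Finset.subset_union_left hu) ?_, ?_⟩
  · intro v hv
    rw [Finset.mem_union, not_or] at hv
    exact hg2 v hv.1 hv.2
  · intro w hw
    have e : u * g / β w = u * (β w / g)⁻¹ := by rw [inv_div, mul_div_assoc]
    have hval : vl w ((β w / g : kˣ) : k) = 1 := by
      rw [Units.val_div_eq_div_val, map_div₀, hg1 w hw, WithZero.exp_log (vl_ne_zero _ _)]
      exact div_self (vl_ne_zero _ _)
    rw [e]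
    by_cases hus : u ∈ Sq (vl w)
    · exact mul_mem hus (inv_mem ((hu2 w hw).1 hus))
    · have hb : β w / g ∉ Sq (vl w) := fun h => hus ((hu2 w hw).2 h)
      refine Sq_mul_odd (hS w (hT w hw)).1 (hu w (hT w hw)) ?_ hus (fun h => hb (by simpa using inv_mem h))
      rw [Units.val_inv_eq_inv_val, map_inv₀, hval, inv_one]

open Classical in
lemma T_square {S T : Finset (Pl k)} (hS : GoodS S) (hT : ∀ w ∈ T, w ∉ S)
    (h : ∀ P : Pl k → Prop, ∃ u ∈ US S, ∀ w ∈ T, u ∈ Sq (vl w) ↔ P w) {x : kˣ} (hx : x ∈ US (S ∪ T))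
    (hxS : ∀ i ∈ Om S, x ∈ LS i) : IsSquare (x : k) := by
  by_contra hsq
  obtain ⟨h1, h2⟩ := FI (hS.mono Finset.subset_union_left) hx hsq
  set R := T.filter (fun w => x ∉ Sq (vl w)) with hR
  have hr : rN (S ∪ T) x ≤ R.card := by
    rw [rN, ← Finset.card_map (Function.Embedding.inl : Pl k ↪ Pl k ⊕ (k →+* ℝ))]
    apply Finset.card_le_card
    intro i hi
    rw [Finset.mem_filter] at hi
    rcases i with v | φ
    · rw [inl_mem_Om, Finset.mem_union] at hi
      have hvT : v ∈ T := hi.1.resolve_left (fun hv => hi.2 (hxS _ (inl_mem_Om.2 hv)))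
      exact Finset.mem_map_of_mem _ (Finset.mem_filter.2 ⟨hvT, hi.2⟩)
    · exact absurd (hxS _ inr_mem_Om) hi.2
  have h3 := count_lower x R _ h1 (fun v hv => (Finset.mem_filter.1 hv).2) (fun β => by
    obtain ⟨y, hy, hy2⟩ := T_surj hS hT h β
    exact ⟨y, hy, fun v hv => hy2 v (Finset.mem_filter.1 hv).1⟩)
  have h4 : 2 ^ rN (S ∪ T) x ≤ 2 ^ R.card := Nat.pow_le_pow_right (by norm_num) hr
  have : 0 < 2 ^ R.card := by positivity
  omega

lemma Pos_index (φ : k →+* ℝ) : (Pos φ).index ≠ 0 ∧ (Pos φ).index ≤ 2 := by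
  have hle : (Pos φ).index ≤ 2 := by
    rw [← Subgroup.relIndex_top_right]
    refine relIndex_le_two (-1) (fun x _ => ?_)
    rw [mem_Pos, mem_Pos]
    have : φ (x : k) ≠ 0 := by simp
    rcases lt_or_gt_of_ne this with h | h
    · right; simpa [div_neg] using h
    · left; exact h
  refine ⟨fun h => ?_, hle⟩
  have hf : (Pos φ).FiniteIndex := by
    have : Function.Injective (fun q : kˣ ⧸ Pos φ => decide (0 < φ ((q.out : kˣ) : k))) := by
      intro p q hpq
      simp only [decide_eq_decide] at hpq
      rw [← Quotient.out_eq' p, ← Quotient.out_eq' q]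
      refine QuotientGroup.eq.2 ?_
      rw [mem_Pos]
      push_cast
      rw [map_mul, map_inv₀]
      have h1 : φ ((p.out : kˣ) : k) ≠ 0 := by simp
      have h2 : φ ((q.out : kˣ) : k) ≠ 0 := by simp
      rcases lt_or_gt_of_ne h1 with h | h
      · have h3 := lt_of_le_of_ne (not_lt.1 (fun h' => absurd (hpq.2 h') (not_lt.2 h.le))) h2
        exact mul_pos_of_neg_of_neg (inv_lt_zero.2 h) h3
      · exact mul_pos (inv_pos.2 h) (hpq.1 h)
    have : Finite (kˣ ⧸ Pos φ) := Finite.of_injective _ this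
    exact Subgroup.finiteIndex_of_finite_quotient
  exact hf.index_ne_zero h

lemma LS_index_ne (i : Pl k ⊕ (k →+* ℝ)) : (LS i).index ≠ 0 := by
  rcases i with v | φ
  · obtain ⟨X, hX, -⟩ := exists_X2 (k := k)
    exact (L2 (good_vl v) (X v) (hX v)).1
  · exact (Pos_index φ).1

lemma LS_prod (S : Finset (Pl k)) : ∏ i ∈ Om S, (LS i).index ≤ 2 ^ (2 * sN k S) := by
  obtain ⟨X, hX, hX2⟩ := exists_X2 (k := k)
  rw [Om, Finset.prod_disjSum]
  calc _ ≤ (∏ v ∈ S, 4 * (X v).card) * ∏ φ : (k →+* ℝ), 2 := by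
        gcongr with v hv φ hφ
        · exact (L2 (good_vl v) (X v) (hX v)).2
        · exact (Pos_index φ).2
    _ = 4 ^ S.card * (∏ v ∈ S, (X v).card) * 2 ^ (Fintype.card (k →+* ℝ)) := by
        rw [Finset.prod_mul_distrib, Finset.prod_const, Finset.prod_const, Finset.card_univ]
    _ ≤ 4 ^ S.card * 2 ^ (Module.finrank ℚ k) * 2 ^ (Fintype.card (k →+* ℝ)) := by
        gcongr; exact hX2 S
    _ = 2 ^ (2 * S.card + (Module.finrank ℚ k + Fintype.card (k →+* ℝ))) := by
        rw [pow_add, pow_add, pow_mul]; ring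
    _ = _ := by rw [← card_inf, sN]; congr 1; ring

lemma relIndex_inf_prod {G ι : Type} [CommGroup G] (I : Finset ι) (f : ι → Subgroup G) (B : Subgroup G) :
    (I.inf f).relIndex B ≤ ∏ i ∈ I, (f i).relIndex B := by
  classical
  induction I using Finset.induction_on with
  | empty => simp
  | insert i I hi ih =>
    rw [Finset.inf_insert, Finset.prod_insert hi]
    exact Subgroup.relIndex_inf_le.trans (Nat.mul_le_mul_left _ ih)

lemma mem_finset_inf {G ι : Type} [CommGroup G] {I : Finset ι} {f : ι → Subgroup G} {x : G} :
    x ∈ I.inf f ↔ ∀ i ∈ I, x ∈ f i := by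
  rw [← Subgroup.zpowers_le, Finset.le_inf_iff]
  simp only [Subgroup.zpowers_le]

lemma H_ne_top (a : kˣ) (hneg : ∀ φ : k →+* ℝ, φ a < 0) (i : Pl k ⊕ (k →+* ℝ)) (hi : a ∉ LS i) :
    Nm (a : k) ⊔ LS i ≠ ⊤ := by
  rcases i with v | φ
  · obtain ⟨b, hb⟩ := L1a (good_vl v) a hi
    intro h
    exact hb (by
      have : b ∈ Nm (a : k) ⊔ LS (Sum.inl v) := h ▸ Subgroup.mem_top b
      exact this)
  · have hle : Nm (a : k) ⊔ LS (Sum.inr φ) ≤ Pos φ := by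
      refine sup_le ?_ le_rfl
      rintro b ⟨x, y, hb⟩
      rw [mem_Pos]
      have hb0 : φ (b : k) ≠ 0 := by simp
      refine lt_of_le_of_ne ?_ hb0.symm
      rw [hb, map_sub, map_mul, map_pow, map_pow]
      have := hneg φ
      nlinarith [sq_nonneg (φ x), sq_nonneg (φ y)]
    intro h
    have h1 : (-1 : kˣ) ∈ Pos φ := hle (h ▸ Subgroup.mem_top _)
    rw [mem_Pos] at h1
    simp at h1
    linarith

theorem Tthm (a b : kˣ) (ha : ¬ IsSquare (a : k)) (hneg : ∀ φ : k →+* ℝ, φ a < 0)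
    (hb : ∀ i, b ∈ Nm (a : k) ⊔ LS i) : b ∈ Nm (a : k) := by
  classical
  obtain ⟨S, -, hS, hX⟩ := exists_big (k := k) ∅ {a, b}
  have haS := hX a (by simp)
  have hbS := hX b (by simp)
  have hs1 : 1 ≤ sN k S := by rw [← US_finrank' S]; omega
  obtain ⟨T, hT1, hT2, hT3, hT4⟩ := exists_T hS a haS ha hneg (sN k S - 1) (by omega)
  set U := US (S ∪ T) with hU
  have hsub : US S ≤ U := US_mono Finset.subset_union_left
  obtain ⟨f1, f2⟩ := FI (hS.mono Finset.subset_union_left) (hsub haS) ha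
  have hr : rN (S ∪ T) a = ((Om S).filter (fun i => a ∉ LS i)).card := by
    rw [rN]
    congr 1
    ext i
    rw [Finset.mem_filter, Finset.mem_filter]
    rcases i with v | φ
    · rw [inl_mem_Om, inl_mem_Om, Finset.mem_union]
      constructor
      · rintro ⟨h1 | h1, h2⟩
        · exact ⟨h1, h2⟩
        · exact absurd (hT3 v h1) h2
      · rintro ⟨h1, h2⟩; exact ⟨Or.inl h1, h2⟩
    · simp [inr_mem_Om]
  set M : Subgroup kˣ := (Om S).inf LS with hM
  set H : Subgroup kˣ := (Om S).inf (fun i => Nm (a : k) ⊔ LS i) with hH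
  set U2 := U.map (powMonoidHom 2) with hU2
  have hMU : M ⊓ U = U2 := by
    apply le_antisymm
    · intro x hx
      obtain ⟨h1, h2⟩ := Subgroup.mem_inf.1 hx
      exact US_sq_of_isSquare h2 (T_square hS hT2 hT4 h2 (mem_finset_inf.1 h1))
    · rintro _ ⟨x, hx, rfl⟩
      refine Subgroup.mem_inf.2 ⟨mem_finset_inf.2 fun i _ => ?_, pow_mem hx 2⟩
      rcases i with v | φ
      · exact sq_mem_Sq _ x
      · show _ ∈ Pos φ
        rw [mem_Pos]
        show 0 < φ ((x ^ 2 : kˣ) : k)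
        push_cast
        rw [map_pow]
        have : φ (x : k) ≠ 0 := by simp
        positivity
  have e1 : M.relIndex U = 2 ^ (2 * sN k S - 1) := by
    rw [← Subgroup.inf_relIndex_right, hMU, hU2, hU, US_sq_relIndex]
    congr 1
    have hd : Disjoint S T := by
      rw [Finset.disjoint_right]; exact hT2
    have hs' : sN k (S ∪ T) = sN k S + T.card := by
      rw [sN, sN, Finset.card_union_of_disjoint hd]; ring
    rw [hs', hT1]; omega
  have hMH : M ≤ H := Finset.inf_mono_fun fun i _ => le_sup_right
  set B := H ⊓ U with hB
  set A := Nm (a : k) ⊓ U with hA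
  have hAB : A ≤ B := by
    refine inf_le_inf_right _ ?_
    exact Finset.le_inf fun i _ => le_sup_left
  have e2 : (M ⊓ U).relIndex B * B.relIndex U = M.relIndex U := by
    rw [Subgroup.relIndex_mul_relIndex _ _ _ (inf_le_inf_right _ hMH) inf_le_right, Subgroup.inf_relIndex_right]
  have e3 : (M ⊓ U).relIndex B ≤ ∏ i ∈ Om S, (LS i).relIndex (Nm (a : k) ⊔ LS i) := by
    have : (M ⊓ U).relIndex B = M.relIndex B := by
      rw [← Subgroup.inf_relIndex_right, ← Subgroup.inf_relIndex_right M]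
      congr 1
      rw [inf_assoc, inf_eq_right.2 (inf_le_right : B ≤ U)]
    rw [this]
    refine (relIndex_inf_prod _ _ _).trans (Finset.prod_le_prod' fun i hi => ?_)
    have hle : B ≤ Nm (a : k) ⊔ LS i := inf_le_left.trans (Finset.inf_le hi)
    refine Subgroup.relIndex_le_of_le_right hle ?_
    intro h
    have := Subgroup.relIndex_mul_index (le_sup_right : LS i ≤ Nm (a : k) ⊔ LS i)
    rw [h, zero_mul] at this
    exact LS_index_ne i this.symm
  have e4 : 2 ^ ((Om S).filter (fun i => a ∉ LS i)).card ≤ ∏ i ∈ Om S, (Nm (a : k) ⊔ LS i).index := by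
    have hne : ∀ i, (Nm (a : k) ⊔ LS i).index ≠ 0 := fun i h => LS_index_ne i (by
      have := Subgroup.relIndex_mul_index (le_sup_right : LS i ≤ Nm (a : k) ⊔ LS i)
      rw [h, mul_zero] at this
      exact this.symm)
    rw [← Finset.prod_const, Finset.prod_filter]
    refine Finset.prod_le_prod' fun i _ => ?_
    by_cases h : a ∈ LS i
    · rw [if_neg (not_not.2 h)]; exact Nat.pos_of_ne_zero (hne i)
    · rw [if_pos h]
      have h1 := H_ne_top a hneg i h
      rw [Ne, ← Subgroup.index_eq_one] at h1
      have := hne i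
      omega
  have e5 : (∏ i ∈ Om S, (LS i).relIndex (Nm (a : k) ⊔ LS i)) * ∏ i ∈ Om S, (Nm (a : k) ⊔ LS i).index ≤ 2 ^ (2 * sN k S) := by
    rw [← Finset.prod_mul_distrib]
    refine le_trans (le_of_eq ?_) (LS_prod S)
    exact Finset.prod_congr rfl fun i _ => Subgroup.relIndex_mul_index le_sup_right
  have e6 : 2 ^ rN (S ∪ T) a ≤ 2 * B.relIndex U := by
    rw [hr]
    set r := ((Om S).filter (fun i => a ∉ LS i)).card
    have hp : 0 < 2 ^ (2 * sN k S - 1) := by positivity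
    have hpp : 2 ^ (2 * sN k S) = 2 ^ (2 * sN k S - 1) * 2 := by rw [← pow_succ]; congr 1; omega
    refine Nat.le_of_mul_le_mul_left ?_ hp
    calc 2 ^ (2 * sN k S - 1) * 2 ^ r = (M ⊓ U).relIndex B * B.relIndex U * 2 ^ r := by rw [e2, e1]
      _ ≤ (∏ i ∈ Om S, (LS i).relIndex (Nm (a : k) ⊔ LS i)) * B.relIndex U * ∏ i ∈ Om S, (Nm (a : k) ⊔ LS i).index := by
        gcongr
      _ = ((∏ i ∈ Om S, (LS i).relIndex (Nm (a : k) ⊔ LS i)) * ∏ i ∈ Om S, (Nm (a : k) ⊔ LS i).index) * B.relIndex U := by ring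
      _ ≤ 2 ^ (2 * sN k S) * B.relIndex U := by gcongr
      _ = _ := by rw [hpp]; ring
  have hAU : A.relIndex U = (Nm (a : k)).relIndex U := Subgroup.inf_relIndex_right _ _
  have e7 : A.relIndex B * B.relIndex U = A.relIndex U := Subgroup.relIndex_mul_relIndex _ _ _ hAB inf_le_right
  have e8 : A.relIndex B = 1 := by
    rw [hAU] at e7
    have h1 : A.relIndex B ≠ 0 := by intro h; rw [h, zero_mul] at e7; exact f1 e7.symm
    have h2 : B.relIndex U ≠ 0 := by intro h; rw [h, mul_zero] at e7; exact f1 e7.symm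
    by_contra h
    have h3 : 2 ≤ A.relIndex B := by omega
    have h4 := Nat.mul_le_mul_right (B.relIndex U) h3
    rw [e7] at h4
    have f2' : 2 * (Nm (a : k)).relIndex U ≤ 2 ^ rN (S ∪ T) a := f2
    omega
  rw [Subgroup.relIndex_eq_one] at e8
  have hbB : b ∈ B := Subgroup.mem_inf.2 ⟨mem_finset_inf.2 fun i _ => hb i, hsub hbS⟩
  exact (Subgroup.mem_inf.1 (e8 hbB)).1
end NF
end HM

end

section
open scoped TensorProduct
open IsDedekindDomain
open scoped WithZero

namespace HM

/-- diagonal quadratic form -/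
def Qd {k : Type} [Field k] {m : ℕ} (a x : Fin m → k) : k := ∑ i, a i * x i ^ 2

section Loc
variable {k : Type} [Field k] (v : Valuation k ℤᵐ⁰)

lemma lt_one_le_exp {x : ℤᵐ⁰} (h : x < 1) : x ≤ WithZero.exp (-1 : ℤ) := by
  by_cases h0 : x = 0
  · simp [h0]
  · rw [← WithZero.exp_log h0] at h ⊢
    rw [← WithZero.exp_zero, WithZero.exp_lt_exp] at h
    rw [WithZero.exp_le_exp]; omega

lemma newton_aux (h4 : v 4 ≠ 0) {c : k} (hc : v (c - 1) < v 4) (n : ℕ) :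
    ∃ t, v t = 1 ∧ v (c / t ^ 2 - 1) ≤ v 4 * WithZero.exp (-((n : ℤ) + 1)) := by
  have h40 : (4 : k) ≠ 0 := (Valuation.ne_zero_iff v).1 h4
  induction n with
  | zero =>
    refine ⟨1, by simp, ?_⟩
    have h1 : v ((c - 1) / 4) < 1 := by
      rw [map_div₀]; exact (div_lt_one₀ (zero_lt_iff.2 h4)).2 hc
    have h2 := lt_one_le_exp h1
    rw [map_div₀, div_le_iff₀ (zero_lt_iff.2 h4), mul_comm] at h2
    simpa using h2
  | succ n ih =>
    obtain ⟨t, ht, h⟩ := ih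
    have ht0 : t ≠ 0 := by rintro rfl; simp at ht
    set ε := (c / t ^ 2 - 1) / 4 with hε
    have h1 : v ε ≤ WithZero.exp (-((n : ℤ) + 1)) := by
      rw [hε, map_div₀, div_le_iff₀ (zero_lt_iff.2 h4), mul_comm]; exact h
    have h2 : v ε < 1 := by
      refine h1.trans_lt ?_
      rw [← WithZero.exp_zero, WithZero.exp_lt_exp]; omega
    have h3 : v (1 + 2 * ε) = 1 := by
      apply v_one_add
      rw [map_mul]
      calc v 2 * v ε ≤ 1 * v ε := by gcongr; exact v_two_le v
        _ < 1 := by simpa using h2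
    have h30 : 1 + 2 * ε ≠ 0 := by intro h; rw [h] at h3; simp at h3
    refine ⟨t * (1 + 2 * ε), by rw [map_mul, ht, h3, one_mul], ?_⟩
    have hc' : c = t ^ 2 * (1 + 4 * ε) := by rw [hε]; field_simp; ring
    clear_value ε
    have : c / (t * (1 + 2 * ε)) ^ 2 - 1 = - (4 * (ε ^ 2 / (1 + 2 * ε) ^ 2)) := by
      rw [hc', mul_pow, mul_div_mul_left _ _ (pow_ne_zero 2 ht0), div_sub_one (pow_ne_zero 2 h30), ← mul_div_assoc 4, ← neg_div]
      congr 1; ring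
    rw [this, Valuation.map_neg, map_mul, map_div₀, map_pow, map_pow, h3, one_pow, div_one]
    gcongr
    calc v ε ^ 2 ≤ (WithZero.exp (-((n : ℤ) + 1))) ^ 2 := by gcongr
      _ = WithZero.exp (2 • (-((n : ℤ) + 1))) := by rw [WithZero.exp_nsmul]
      _ ≤ _ := by rw [WithZero.exp_le_exp]; push_cast; simp only [nsmul_eq_mul]; push_cast; omega

lemma newton (h4 : v 4 ≠ 0) {c : k} (hc : v (c - 1) < v 4) {γ : ℤᵐ⁰} (hγ : γ ≠ 0) :
    ∃ t, v t = 1 ∧ v (c / t ^ 2 - 1) < γ := by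
  obtain ⟨n, hn⟩ := exists_exp_lt γ hγ
  obtain ⟨t, ht, h⟩ := newton_aux v h4 hc n
  refine ⟨t, ht, h.trans_lt (lt_of_le_of_lt ?_ (hn (n + 1) (by omega)))⟩
  calc _ ≤ 1 * WithZero.exp (-((n : ℤ) + 1)) := by gcongr; exact v_four_le v
    _ ≤ _ := by push_cast; simp

/-- `b` is in the closure of the values of the diagonal form `a` -/
def Rl {m : ℕ} (a : Fin m → k) (b : k) : Prop := ∀ γ : ℤᵐ⁰, γ ≠ 0 → ∃ x, v (Qd a x - b) < γ

lemma Qd_div {m : ℕ} (a x : Fin m → k) (t : k) : Qd a (fun i => x i / t) = Qd a x / t ^ 2 := by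
  simp only [Qd, Finset.sum_div, div_pow, mul_div_assoc]

lemma R1 (h4 : v 4 ≠ 0) {m : ℕ} {a x : Fin m → k} {b : k} (hb : b ≠ 0) (h : v (Qd a x - b) < v 4 * v b)
    {γ : ℤᵐ⁰} (hγ : γ ≠ 0) : ∃ t, v t = 1 ∧ v (Qd a (fun i => x i / t) - b) < γ := by
  have hvb : v b ≠ 0 := (Valuation.ne_zero_iff v).2 hb
  obtain ⟨t, ht, h'⟩ := newton v h4 (c := Qd a x / b) (by
    rw [div_sub_one hb, map_div₀]; exact (div_lt_iff₀ (zero_lt_iff.2 hvb)).2 h)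
    (γ := γ / v b) (div_ne_zero hγ hvb)
  refine ⟨t, ht, ?_⟩
  have ht0 : t ≠ 0 := by rintro rfl; simp at ht
  rw [Qd_div, show Qd a x / t ^ 2 - b = (Qd a x / b / t ^ 2 - 1) * b by field_simp, map_mul]
  exact (lt_div_iff₀ (zero_lt_iff.2 hvb)).1 h'

lemma R1' (h4 : v 4 ≠ 0) {m : ℕ} {a x : Fin m → k} {b : k} (hb : b ≠ 0) (h : v (Qd a x - b) < v 4 * v b) :
    Rl v a b := fun _ hγ => let ⟨_, _, h⟩ := R1 v h4 hb h hγ; ⟨_, h⟩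

lemma Qd_update {m : ℕ} (a x : Fin m → k) (j : Fin m) (hx : x j = 0) (τ : k) :
    Qd a (Function.update x j τ) = Qd a x + a j * τ ^ 2 := by
  classical
  unfold Qd
  rw [← Finset.add_sum_erase _ _ (Finset.mem_univ j), ← Finset.add_sum_erase _ _ (Finset.mem_univ j)]
  rw [Function.update_self, hx]
  have : ∀ i ∈ Finset.univ.erase j, a i * Function.update x j τ i ^ 2 = a i * x i ^ 2 := by
    intro i hi
    rw [Function.update_of_ne (Finset.ne_of_mem_erase hi)]
  rw [Finset.sum_congr rfl this]; ring

lemma Good.small (h : Good v) {γ : ℤᵐ⁰} (hγ : γ ≠ 0) : ∃ τ : k, τ ≠ 0 ∧ v τ < γ ∧ v τ ≤ 1 := by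
  obtain ⟨n, hn⟩ := exists_exp_lt γ hγ
  obtain ⟨τ, hτ⟩ := h.surj (WithZero.exp (-(n : ℤ)))
  refine ⟨τ, ?_, hτ ▸ hn n le_rfl, ?_⟩
  · rw [← Valuation.ne_zero_iff v, hτ]; simp
  · rw [hτ, ← WithZero.exp_zero, WithZero.exp_le_exp]; omega

lemma perturb (h : Good v) {m : ℕ} (a x : Fin m → k) (j : Fin m) (haj : a j ≠ 0) {γ : ℤᵐ⁰} (hγ : γ ≠ 0) :
    ∃ y : Fin m → k, y j ≠ 0 ∧ v (Qd a y - Qd a x) < γ := by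
  by_cases hx : x j = 0
  · have hva : v (a j) ≠ 0 := (Valuation.ne_zero_iff v).2 haj
    obtain ⟨τ, h0, h1, h2⟩ := h.small v (div_ne_zero hγ hva)
    refine ⟨Function.update x j τ, by simpa using h0, ?_⟩
    rw [Qd_update a x j hx, add_sub_cancel_left, map_mul, map_pow, mul_comm]
    rw [lt_div_iff₀ (zero_lt_iff.2 hva)] at h1
    refine lt_of_le_of_lt ?_ h1
    gcongr
    rw [sq]
    exact mul_le_of_le_one_left' h2
  · exact ⟨x, hx, by simpa using zero_lt_iff.2 hγ⟩

lemma Rl.loc (h : Good v) {m : ℕ} {a : Fin m → k} {b : k} (hb : b ≠ 0) (hR : Rl v a b) (j : Fin m) (haj : a j ≠ 0) :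
    ∃ x : Fin m → k, x j ≠ 0 ∧ ∀ γ : ℤᵐ⁰, γ ≠ 0 → ∃ t, v t = 1 ∧ v (Qd a (fun i => x i / t) - b) < γ := by
  have hvb : v b ≠ 0 := (Valuation.ne_zero_iff v).2 hb
  have h0 := mul_ne_zero h.v4 hvb
  obtain ⟨x, hx⟩ := hR _ h0
  obtain ⟨y, hy, hy'⟩ := perturb v h a x j haj h0
  refine ⟨y, hy, fun γ hγ => R1 v h.v4 hb ?_ hγ⟩
  rw [show Qd a y - b = (Qd a y - Qd a x) + (Qd a x - b) by ring]
  exact v.map_add_lt hy' hx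

end Loc
end HM

end

section
open scoped TensorProduct
open IsDedekindDomain
open scoped WithZero

namespace HM

lemma mem_sup_near {k : Type} [Field k] (v : Valuation k ℤᵐ⁰) {a : k} {b : kˣ} {X Y : k}
    (h : v (X ^ 2 - a * Y ^ 2 - b) < v 4 * v (b : k)) : b ∈ Nm a ⊔ Sq v := by
  have hb : v (b : k) ≠ 0 := (Valuation.ne_zero_iff v).2 b.ne_zero
  have h0 : X ^ 2 - a * Y ^ 2 ≠ 0 := by
    intro h0
    rw [h0, zero_sub, Valuation.map_neg] at h
    exact absurd h (not_lt.2 (mul_le_of_le_one_left' (v_four_le v)))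
  have h1 : Units.mk0 _ h0 ∈ Nm a := mem_Nm.2 ⟨X, Y, rfl⟩
  have h2 : Units.mk0 _ h0 / b ∈ Sq v := by
    refine U4_le_Sq v (mem_U4 v ?_)
    rw [Units.val_div_eq_div_val, Units.val_mk0, div_sub_one b.ne_zero, map_div₀]
    exact (div_lt_iff₀ (zero_lt_iff.2 hb)).2 h
  have := Subgroup.mul_mem_sup h1 (inv_mem h2)
  rwa [inv_div, mul_div_cancel] at this

lemma iso_id {K : Type} [Field K] {c0 c1 c2 B x0 x1 x2 θ P : K} (h0 : c0 ≠ 0) (h1 : c1 ≠ 0) (hP : P ≠ 0)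
    (e : P = c0 * x0 ^ 2 + c1 * x1 ^ 2) (e3 : θ ^ 2 = -(c0 * c1 * c2 * B)) :
    (c0 * (-θ * (c1 * x1) + c0 * c1 * c2 * x2 * x0) / -(c0 * c1 * P)) ^ 2
      - -(c0 * c1) * ((θ * (c0 * x0) + c0 * c1 * c2 * x2 * x1) / -(c0 * c1 * P)) ^ 2 - -(c0 * c2)
      = c0 * c2 * (P + c2 * x2 ^ 2 - B) / P := by
  have hZ : (-(c0 * c1 * P)) ≠ 0 := neg_ne_zero.2 (mul_ne_zero (mul_ne_zero h0 h1) hP)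
  have key : (c0 * (-θ * (c1 * x1) + c0 * c1 * c2 * x2 * x0)) ^ 2 + c0 * c1 * (θ * (c0 * x0) + c0 * c1 * c2 * x2 * x1) ^ 2
      = c0 ^ 3 * c1 ^ 2 * c2 * P * (c2 * x2 ^ 2 - B) := by
    rw [e]
    linear_combination (c0 ^ 2 * c1 ^ 2 * x1 ^ 2 + c0 ^ 3 * c1 * x0 ^ 2) * e3
  rw [div_pow, div_pow, sub_neg_eq_add, neg_mul (c0 * c1), sub_neg_eq_add, ← mul_div_assoc, ← add_div, key]
  field_simp
  ring

section NF
variable {k : Type} [Field k] [NumberField k]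

/-- totally positive -/
def TP (x : k) : Prop := ∀ φ : k →+* ℝ, 0 < φ x

lemma TP.ne [Nonempty (k →+* ℝ)] {x : k} (h : TP x) : x ≠ 0 := by
  rintro rfl
  have := h (Classical.arbitrary _)
  simp at this

lemma Qd_pos {m : ℕ} {a : Fin m → k} (ha : ∀ i, TP (a i)) (φ : k →+* ℝ) {x : Fin m → k} {j : Fin m} (hx : x j ≠ 0) :
    0 < φ (Qd a x) := by
  unfold Qd
  rw [map_sum]
  refine Finset.sum_pos' (fun i _ => ?_) ⟨j, Finset.mem_univ _, ?_⟩
  · rw [map_mul, map_pow]; exact mul_nonneg (ha i φ).le (sq_nonneg _)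
  · rw [map_mul, map_pow]
    have : φ (x j) ≠ 0 := by simpa using hx
    have := ha j φ
    positivity

lemma Qd_ne [Nonempty (k →+* ℝ)] {m : ℕ} {a : Fin m → k} (ha : ∀ i, TP (a i)) {x : Fin m → k} {j : Fin m} (hx : x j ≠ 0) :
    Qd a x ≠ 0 := by
  intro h
  have := Qd_pos ha (Classical.arbitrary _) hx
  simp [h] at this

variable [Nonempty (k →+* ℝ)]

lemma Rl.near {m : ℕ} {a : Fin m → k} {b : k} (hb : b ≠ 0) {v : Pl k} (h : Rl (vl v) a b) :
    ∃ x, vl v (Qd a x - b) < vl v 4 * vl v b :=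
  h _ (mul_ne_zero (good_vl v).v4 ((Valuation.ne_zero_iff _).2 hb))

lemma hasse1 {a : Fin 1 → k} {b : k} (ha : ∀ i, TP (a i)) (hb : TP b) (h : ∀ v : Pl k, Rl (vl v) a b) :
    ∃ x, Qd a x = b := by
  have ha0 := (ha 0).ne
  have hb0 := hb.ne
  have := SqThm (Units.mk0 (a 0) ha0 * Units.mk0 b hb0) (by
    rintro (v | φ)
    · show _ ∈ Sq (vl v)
      obtain ⟨x, hx⟩ := (h v).near hb0
      have := mem_sup_near (vl v) (a := 0) (b := Units.mk0 (a 0) ha0 * Units.mk0 b hb0) (X := a 0 * x 0) (Y := 0) (by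
        simp only [Units.val_mul, Units.val_mk0]
        rw [show (a 0 * x 0) ^ 2 - 0 * 0 ^ 2 - a 0 * b = a 0 * (Qd a x - b) by simp [Qd]; ring, map_mul, map_mul,
          mul_left_comm]
        exact mul_lt_mul_of_pos_left hx (zero_lt_iff.2 ((Valuation.ne_zero_iff _).2 ha0)))
      have h2 : Nm (0 : k) ≤ Sq (vl v) := by
        rintro c ⟨x, y, hc⟩
        have hx0 : x ≠ 0 := by rintro rfl; simp at hc
        have : c = Units.mk0 x hx0 ^ 2 := by ext; simp [hc]
        rw [this]; exact sq_mem_Sq _ _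
      rwa [sup_eq_right.2 h2] at this
    · show 0 < φ _
      simp only [Units.val_mul, Units.val_mk0, map_mul]
      exact mul_pos (ha 0 φ) (hb φ))
  obtain ⟨r, hr⟩ := this
  simp only [Units.val_mul, Units.val_mk0] at hr
  refine ⟨fun _ => r / a 0, ?_⟩
  simp only [Qd, Fin.sum_univ_one]
  rw [div_pow, sq r, ← hr]; field_simp

lemma not_sq_neg {a : k} (ha : ∀ φ : k →+* ℝ, φ a < 0) : ¬ IsSquare a := by
  rintro ⟨r, rfl⟩
  have := ha (Classical.arbitrary _)
  rw [map_mul] at this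
  nlinarith [sq_nonneg ((Classical.arbitrary (k →+* ℝ)) r)]

lemma hasse2 {a : Fin 2 → k} {b : k} (ha : ∀ i, TP (a i)) (hb : TP b) (h : ∀ v : Pl k, Rl (vl v) a b) :
    ∃ x, Qd a x = b := by
  have ha0 := (ha 0).ne
  have ha1 := (ha 1).ne
  have hb0 := hb.ne
  have hneg : ∀ φ : k →+* ℝ, φ (-(a 0 * a 1)) < 0 := by
    intro φ
    rw [map_neg, map_mul, neg_lt_zero]; exact mul_pos (ha 0 φ) (ha 1 φ)
  obtain ⟨X, Y, hXY⟩ := Tthm (Units.mk0 (-(a 0 * a 1)) (neg_ne_zero.2 (mul_ne_zero ha0 ha1))) (Units.mk0 (a 0) ha0 * Units.mk0 b hb0)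
    (not_sq_neg hneg) hneg (by
    rintro (v | φ)
    · show _ ∈ _ ⊔ Sq (vl v)
      obtain ⟨x, hx⟩ := (h v).near hb0
      refine mem_sup_near (vl v) (X := a 0 * x 0) (Y := x 1) ?_
      simp only [Units.val_mul, Units.val_mk0]
      rw [show (a 0 * x 0) ^ 2 - -(a 0 * a 1) * x 1 ^ 2 - a 0 * b = a 0 * (Qd a x - b) by simp [Qd]; ring, map_mul, map_mul,
          mul_left_comm]
      exact mul_lt_mul_of_pos_left hx (zero_lt_iff.2 ((Valuation.ne_zero_iff _).2 ha0))
    · refine Subgroup.mem_sup_right ?_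
      show 0 < φ _
      simp only [Units.val_mul, Units.val_mk0, map_mul]
      exact mul_pos (ha 0 φ) (hb φ))
  simp only [Units.val_mul, Units.val_mk0] at hXY
  refine ⟨![X / a 0, Y], ?_⟩
  simp only [Qd, Fin.sum_univ_two]
  apply mul_left_cancel₀ ha0
  rw [hXY]
  simp
  field_simp

lemma hasse3_iso {a : Fin 3 → k} {b : k} (ha : ∀ i, TP (a i)) (hb : TP b) (h : ∀ v : Pl k, Rl (vl v) a b)
    {K : Type} [Field K] [NumberField K] [Algebra k K] (q : QE k K (-(a 0 * a 1 * a 2 * b))) :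
    ∃ x y z : K, (x ≠ 0 ∨ y ≠ 0 ∨ z ≠ 0) ∧
      algebraMap k K (a 0) * x ^ 2 + algebraMap k K (a 1) * y ^ 2 + algebraMap k K (a 2) * z ^ 2 = 0 := by
  have hneg : ∀ φ : k →+* ℝ, φ (-(a 0 * a 1 * a 2 * b)) < 0 := by
    intro φ
    rw [map_neg, neg_lt_zero]; simp only [map_mul]
    have := ha 0 φ
    have := ha 1 φ
    have := ha 2 φ
    have := hb φ
    positivity
  have hE := isEmpty_of_neg q hneg
  have ha0 := (ha 0).ne
  have ha1 := (ha 1).ne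
  have ha2 := (ha 2).ne
  have hb0 := hb.ne
  set A := algebraMap k K with hA
  have hA0 : A (a 0) ≠ 0 := by simpa using ha0
  have hA1 : A (a 1) ≠ 0 := by simpa using ha1
  have hA2 : A (a 2) ≠ 0 := by simpa using ha2
  by_cases hsq : IsSquare (-(A (a 0) * A (a 1)))
  · obtain ⟨r, hr⟩ := hsq
    refine ⟨r / A (a 0), 1, 0, by simp, ?_⟩
    rw [div_pow, sq r, ← hr]; field_simp; ring
  obtain ⟨X, Y, hXY⟩ := Tthm (Units.mk0 (-(A (a 0) * A (a 1))) (neg_ne_zero.2 (mul_ne_zero hA0 hA1)))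
    (Units.mk0 (-(A (a 0) * A (a 2))) (neg_ne_zero.2 (mul_ne_zero hA0 hA2)))
    hsq (fun φ => (hE.false φ).elim) (by
    rintro (W | φ)
    · show _ ∈ _ ⊔ Sq (vl W)
      obtain ⟨x, hx0, hx⟩ := (h (und k W)).loc _ (good_vl _) hb0 0 ha0
      have hp : a 0 * x 0 ^ 2 + a 1 * x 1 ^ 2 ≠ 0 := by
        have := Qd_ne (a := ![a 0, a 1]) (x := ![x 0, x 1]) (j := 0) (by intro i; fin_cases i; exacts [ha 0, ha 1]) hx0
        simpa [Qd, Fin.sum_univ_two] using this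
      obtain ⟨t, ht, hxt⟩ := hx (vl (und k W) 4 * vl (und k W) (a 0 * x 0 ^ 2 + a 1 * x 1 ^ 2))
        (mul_ne_zero (good_vl _).v4 ((Valuation.ne_zero_iff _).2 hp))
      have ht0 : t ≠ 0 := by rintro rfl; simp at ht
      obtain ⟨y, hy⟩ : ∃ y : Fin 3 → k, y = fun i => x i / t := ⟨_, rfl⟩
      rw [← hy] at hxt
      obtain ⟨p, hpe⟩ : ∃ p, p = a 0 * y 0 ^ 2 + a 1 * y 1 ^ 2 := ⟨_, rfl⟩
      have hpp : p = (a 0 * x 0 ^ 2 + a 1 * x 1 ^ 2) / t ^ 2 := by rw [hpe, hy]; field_simp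
      have hp0 : p ≠ 0 := by rw [hpp]; exact div_ne_zero hp (pow_ne_zero _ ht0)
      have hAp : A p ≠ 0 := by simpa using hp0
      have hlt : vl (und k W) (Qd a y - b) < vl (und k W) (4 * p) := by
        rw [hpp, map_mul, map_div₀, map_pow, ht, one_pow, div_one]; exact hxt
      have hlt := (und_lt (K := K) k W _ _).2 hlt
      refine mem_sup_near (vl W)
        (X := A (a 0) * (-q.θ * A (a 1 * y 1) + A (a 0 * a 1 * a 2 * y 2 * y 0)) / A (-(a 0 * a 1 * p)))
        (Y := (q.θ * A (a 0 * y 0) + A (a 0 * a 1 * a 2 * y 2 * y 1)) / A (-(a 0 * a 1 * p))) ?_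
      simp only [Units.val_mk0]
      have key : (A (a 0) * (-q.θ * A (a 1 * y 1) + A (a 0 * a 1 * a 2 * y 2 * y 0)) / A (-(a 0 * a 1 * p))) ^ 2
          - -(A (a 0) * A (a 1)) * ((q.θ * A (a 0 * y 0) + A (a 0 * a 1 * a 2 * y 2 * y 1)) / A (-(a 0 * a 1 * p))) ^ 2
          - -(A (a 0) * A (a 2)) = A (a 0) * A (a 2) * A (Qd a y - b) / A p := by
        have e : A p = A (a 0) * A (y 0) ^ 2 + A (a 1) * A (y 1) ^ 2 := by rw [hpe]; simp
        have e2 : A (Qd a y - b) = A p + A (a 2) * A (y 2) ^ 2 - A b := by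
          rw [e]; simp [Qd, Fin.sum_univ_three]
        have e3 : q.θ ^ 2 = - (A (a 0) * A (a 1) * A (a 2) * A b) := by rw [q.sq]; simp [hA]
        rw [e2]
        simp only [map_neg, map_mul]
        generalize A p = P at *
        generalize A (a 0) = c0 at *
        generalize A (a 1) = c1 at *
        generalize A (a 2) = c2 at *
        generalize A b = B at *
        generalize A (y 0) = x0 at *
        generalize A (y 1) = x1 at *
        generalize A (y 2) = x2 at *
        generalize q.θ = θ at *
        exact iso_id hA0 hA1 hAp e e3
      rw [map_mul, map_ofNat, map_mul] at hlt
      rw [key, map_div₀, map_mul, Valuation.map_neg, div_lt_iff₀ (zero_lt_iff.2 ((Valuation.ne_zero_iff _).2 hAp)), mul_right_comm,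
        mul_comm (_ * _) ((vl W) (_ * _))]
      exact mul_lt_mul_of_pos_left hlt (zero_lt_iff.2 ((Valuation.ne_zero_iff _).2 (mul_ne_zero hA0 hA2)))
    · exact (hE.false φ).elim)
  simp only [Units.val_mk0] at hXY
  refine ⟨X / A (a 0), Y, 1, by simp, ?_⟩
  apply mul_left_cancel₀ hA0
  rw [mul_zero]
  have : A (a 0) * (A (a 0) * (X / A (a 0)) ^ 2 + A (a 1) * Y ^ 2 + A (a 2) * 1 ^ 2) = X ^ 2 + A (a 0) * A (a 1) * Y ^ 2 + A (a 0) * A (a 2) := by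
    field_simp
  rw [this]
  linear_combination -hXY

lemma QE.eq_zero {K : Type} [Field K] [NumberField K] [Algebra k K] {c : k} (q : QE k K c) (hc : c ≠ 0) {x y : k}
    (h : algebraMap k K x + algebraMap k K y * q.θ = 0) : x = 0 ∧ y = 0 := by
  have h2 := congrArg q.σ h
  rw [map_add, map_mul, q.σ.commutes, q.σ.commutes, q.hσ, map_zero] at h2
  have hx : algebraMap k K x = 0 := by
    have : (2 : K) * algebraMap k K x = 0 := by linear_combination h + h2
    simpa using this
  have hθ : q.θ ≠ 0 := by
    intro h; have := q.sq; rw [h] at this; simp at this; exact hc (by simpa using this.symm)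
  rw [hx, zero_add] at h
  refine ⟨by simpa using hx, ?_⟩
  rcases mul_eq_zero.1 h with h | h
  · simpa using h
  · exact absurd h hθ

lemma hasse3 {a : Fin 3 → k} {b : k} (ha : ∀ i, TP (a i)) (hb : TP b) (h : ∀ v : Pl k, Rl (vl v) a b) :
    ∃ x, Qd a x = b := by
  have ha0 := (ha 0).ne
  have ha1 := (ha 1).ne
  have ha2 := (ha 2).ne
  have hb0 := hb.ne
  have hneg : ∀ φ : k →+* ℝ, φ (-(a 0 * a 1 * a 2 * b)) < 0 := by
    intro φ
    rw [map_neg, neg_lt_zero]; simp only [map_mul]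
    have := ha 0 φ
    have := ha 1 φ
    have := ha 2 φ
    have := hb φ
    positivity
  obtain ⟨K, _, _, _, ⟨q⟩⟩ := exists_QE k (-(a 0 * a 1 * a 2 * b)) (not_sq_neg hneg)
  obtain ⟨x, y, z, hne, hxyz⟩ := hasse3_iso ha hb h q
  obtain ⟨α0, β0, hx⟩ := q.rep x
  obtain ⟨α1, β1, hy⟩ := q.rep y
  obtain ⟨α2, β2, hz⟩ := q.rep z
  have hd : -(a 0 * a 1 * a 2 * b) ≠ 0 := by simp [ha0, ha1, ha2, hb0]
  obtain ⟨e1, e2⟩ := q.eq_zero hd (x := a 0 * α0 ^ 2 + a 1 * α1 ^ 2 + a 2 * α2 ^ 2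
      + (-(a 0 * a 1 * a 2 * b)) * (a 0 * β0 ^ 2 + a 1 * β1 ^ 2 + a 2 * β2 ^ 2))
      (y := 2 * (a 0 * α0 * β0 + a 1 * α1 * β1 + a 2 * α2 * β2)) (by
    have hθ := q.sq
    rw [hx, hy, hz] at hxyz
    rw [← hxyz]
    simp only [map_add, map_mul, map_neg, map_pow, map_ofNat] at hθ ⊢
    linear_combination (-(algebraMap k K (a 0) * algebraMap k K β0 ^ 2 + algebraMap k K (a 1) * algebraMap k K β1 ^ 2 + algebraMap k K (a 2) * algebraMap k K β2 ^ 2)) * hθ)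
  have e2' : a 0 * α0 * β0 + a 1 * α1 * β1 + a 2 * α2 * β2 = 0 := by simpa using e2
  have hQ : ∀ u v w : k, a 0 * u ^ 2 + a 1 * v ^ 2 + a 2 * w ^ 2 = 0 → u = 0 ∧ v = 0 ∧ w = 0 := by
    intro u v w h0
    have h1 : Qd a ![u, v, w] = 0 := by rw [← h0]; simp [Qd, Fin.sum_univ_three]
    have h2 : ∀ j, (![u, v, w] : Fin 3 → k) j = 0 := fun j => by
      by_contra hj; exact Qd_ne ha hj h1
    exact ⟨h2 0, h2 1, h2 2⟩
  obtain ⟨e, he⟩ : ∃ e, e = a 0 * β0 ^ 2 + a 1 * β1 ^ 2 + a 2 * β2 ^ 2 := ⟨_, rfl⟩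
  have he0 : e ≠ 0 := by
    intro h0
    rw [← he, h0, mul_zero, add_zero] at e1
    obtain ⟨rfl, rfl, rfl⟩ := hQ _ _ _ e1
    obtain ⟨rfl, rfl, rfl⟩ := hQ _ _ _ (he.symm.trans h0)
    simp at hx hy hz
    simp [hx, hy, hz] at hne
  refine ⟨fun i => ![(α1 * β2 - α2 * β1) * (a 1 * a 2), (α2 * β0 - α0 * β2) * (a 0 * a 2), (α0 * β1 - α1 * β0) * (a 0 * a 1)] i / (a 0 * a 1 * a 2 * e), ?_⟩
  rw [Qd_div, div_eq_iff (by simp [ha0, ha1, ha2, he0])]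
  simp [Qd, Fin.sum_univ_three]
  rw [← he] at e1
  have e1' : a 0 * α0 ^ 2 + a 1 * α1 ^ 2 + a 2 * α2 ^ 2 = a 0 * a 1 * a 2 * b * e := by linear_combination e1
  have : b * (a 0 * a 1 * a 2 * e) ^ 2 = a 0 * a 1 * a 2 * ((a 0 * α0 ^ 2 + a 1 * α1 ^ 2 + a 2 * α2 ^ 2) * (a 0 * β0 ^ 2 + a 1 * β1 ^ 2 + a 2 * β2 ^ 2) - (a 0 * α0 * β0 + a 1 * α1 * β1 + a 2 * α2 * β2) ^ 2) := by
    rw [e1', ← he, e2']; ring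
  rw [this]; ring

end NF
end HM

end

section
open scoped TensorProduct
open IsDedekindDomain
open scoped WithZero

namespace HM
section Loc
variable {k : Type} [Field k] {v : Valuation k ℤᵐ⁰}

lemma res_root (h : Good v) (h2 : v 2 = 1) {a0 a1 c : k} (h0 : v a0 = 1) (h1 : v a1 = 1) (hc : v c ≤ 1) :
    ∃ x y : k, v x ≤ 1 ∧ v y ≤ 1 ∧ v (a0 * x ^ 2 + a1 * y ^ 2 + c) < 1 := by
  classical
  have := h.finite_res
  let O := v.valuationSubring
  let κ := IsLocalRing.ResidueField O
  have : Fintype κ := Fintype.ofFinite _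
  let A0 : O := ⟨a0, h0.le⟩
  let A1 : O := ⟨a1, h1.le⟩
  let C : O := ⟨c, hc⟩
  let r : O →+* κ := IsLocalRing.residue O
  have hr : ∀ x : O, r x = 0 ↔ v (x : k) < 1 := by
    intro x
    have := residue_eq_iff (v := v) (x := (x : k)) (y := 0) x.2 (by simp)
    rw [sub_zero] at this
    rw [← this]
    have e : (⟨0, by simp⟩ : O) = 0 := rfl
    rw [show IsLocalRing.residue O ⟨0, _⟩ = 0 from map_zero r]
  have hA0 : r A0 ≠ 0 := by rw [Ne, hr]; simp [A0, h0]
  have hA1 : r A1 ≠ 0 := by rw [Ne, hr]; simp [A1, h1]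
  have h20 : (2 : κ) ≠ 0 := by
    have : r 2 ≠ 0 := by rw [Ne, hr, not_lt]; exact h2.ge
    rw [← map_ofNat r 2]
    exact this
  have hch : ringChar κ ≠ 2 := by
    intro hch
    apply h20
    have := ringChar.Nat.cast_ringChar (R := κ)
    rw [hch] at this
    simpa using this
  obtain ⟨x, y, hxy⟩ := FiniteField.exists_root_sum_quadratic (R := κ)
    (f := Polynomial.C (r A0) * Polynomial.X ^ 2 + Polynomial.C 0 * Polynomial.X + Polynomial.C 0)
    (g := Polynomial.C (r A1) * Polynomial.X ^ 2 + Polynomial.C 0 * Polynomial.X + Polynomial.C (r C))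
    (Polynomial.degree_quadratic hA0) (Polynomial.degree_quadratic hA1) (FiniteField.odd_card_of_char_ne_two hch)
  obtain ⟨X, rfl⟩ := IsLocalRing.residue_surjective x
  obtain ⟨Y, rfl⟩ := IsLocalRing.residue_surjective y
  refine ⟨X, Y, X.2, Y.2, ?_⟩
  have := (hr (A0 * X ^ 2 + A1 * Y ^ 2 + C)).1 (by
    rw [← hxy]; simp [r, add_assoc])
  simpa [A0, A1, C] using this

lemma univ3 (h : Good v) (h2 : v 2 = 1) {a0 a1 a2 β : k} (h0 : v a0 = 1) (h1 : v a1 = 1) (ha2 : v a2 = 1) (hβ : β ≠ 0) :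
    ∃ x y z : k, v (a0 * x ^ 2 + a1 * y ^ 2 + a2 * z ^ 2 - β) < v β := by
  have hvβ : v β ≠ 0 := (Valuation.ne_zero_iff v).2 hβ
  obtain ⟨s, hs⟩ := h.surj (WithZero.exp ((WithZero.log (v β) + 1) / 2))
  have hs0 : s ≠ 0 := by rw [← Valuation.ne_zero_iff v, hs]; simp
  obtain ⟨β', hβ'⟩ : ∃ β', β' = β / s ^ 2 := ⟨_, rfl⟩
  have hβs : β = s ^ 2 * β' := by rw [hβ']; field_simp
  have hval : v β' = WithZero.exp (WithZero.log (v β) - 2 * ((WithZero.log (v β) + 1) / 2)) := by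
    rw [hβ', map_div₀, map_pow, hs, ← WithZero.exp_nsmul, WithZero.exp_sub, WithZero.exp_log hvβ]; simp
  have hle : v β' ≤ 1 := by rw [hval, ← WithZero.exp_zero, WithZero.exp_le_exp]; omega
  have hge : WithZero.exp (-1 : ℤ) ≤ v β' := by rw [hval, WithZero.exp_le_exp]; omega
  obtain ⟨x, y, -, -, hxy⟩ := res_root h h2 h0 h1 (c := a2 - β') (v.map_sub_le ha2.le hle)
  have ha20 : a2 ≠ 0 := by rintro rfl; simp at ha2
  obtain ⟨t, ht⟩ : ∃ t, t = -(a0 * x ^ 2 + a1 * y ^ 2 + (a2 - β')) / (2 * a2) := ⟨_, rfl⟩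
  have hvt : v t ≤ WithZero.exp (-1 : ℤ) := by
    rw [ht, map_div₀, Valuation.map_neg, map_mul, h2, ha2, one_mul, div_one]
    exact lt_one_le_exp hxy
  refine ⟨s * x, s * y, s * (1 + t), ?_⟩
  have h20 := h.two
  have e : a0 * (s * x) ^ 2 + a1 * (s * y) ^ 2 + a2 * (s * (1 + t)) ^ 2 - β = s ^ 2 * (a2 * t ^ 2) := by
    have : 2 * a2 * t = -(a0 * x ^ 2 + a1 * y ^ 2 + (a2 - β')) := by rw [ht]; field_simp
    rw [hβs]; linear_combination s ^ 2 * this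
  rw [e, hβs, map_mul v (s ^ 2), map_mul v (s ^ 2)]
  have hs2 : v (s ^ 2) ≠ 0 := (Valuation.ne_zero_iff v).2 (pow_ne_zero _ hs0)
  refine mul_lt_mul_of_pos_left (lt_of_lt_of_le ?_ hge) (zero_lt_iff.2 hs2)
  rw [map_mul, ha2, one_mul, map_pow]
  calc v t ^ 2 ≤ (WithZero.exp (-1 : ℤ)) ^ 2 := by gcongr
    _ = WithZero.exp (2 • (-1 : ℤ)) := by rw [WithZero.exp_nsmul]
    _ < _ := by rw [WithZero.exp_lt_exp]; simp

lemma Qd_succ {m : ℕ} (a x : Fin (m + 1) → k) : Qd a x = a 0 * x 0 ^ 2 + Qd (Fin.tail a) (Fin.tail x) := by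
  simp [Qd, Fin.sum_univ_succ, Fin.tail]

lemma Rl_univ (h : Good v) (h2 : v 2 = 1) {m : ℕ} {a : Fin (m + 3) → k} (ha : ∀ i, v (a i) = 1) {β : k} (hβ : β ≠ 0) :
    Rl v a β := by
  obtain ⟨x, y, z, hx⟩ := univ3 h h2 (ha 0) (ha 1) (ha 2) hβ
  refine R1' v h.v4 hβ (x := Fin.cons x (Fin.cons y (Fin.cons z 0))) ?_
  rw [v_four, h2, one_pow, one_mul]
  convert hx using 3
  simp only [Qd_succ, Fin.tail_cons, Fin.cons_zero]
  simp [Qd, Fin.tail]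
  ring

lemma cont_sq (v : Valuation k ℤᵐ⁰) (a y : k) {δ : ℤᵐ⁰} (hδ : δ ≠ 0) : ∃ γ : ℤᵐ⁰, γ ≠ 0 ∧ ∀ x, v (x - y) < γ → v (a * (x ^ 2 - y ^ 2)) < δ := by
  by_cases ha : a = 0
  · exact ⟨1, one_ne_zero, fun x _ => by simpa [ha] using zero_lt_iff.2 hδ⟩
  have hva : v a ≠ 0 := (Valuation.ne_zero_iff v).2 ha
  have hM : v a * max 1 (v (2 * y)) ≠ 0 := mul_ne_zero hva (zero_lt_iff.1 (lt_max_of_lt_left zero_lt_one))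
  refine ⟨min 1 (δ / (v a * max 1 (v (2 * y)))), ?_, fun x hx => ?_⟩
  · exact zero_lt_iff.1 (lt_min zero_lt_one (zero_lt_iff.2 (div_ne_zero hδ hM)))
  obtain ⟨h1, h2⟩ := lt_min_iff.1 hx
  have h3 : v (x + y) ≤ max 1 (v (2 * y)) := by
    rw [show x + y = (x - y) + 2 * y by ring]
    exact (v.map_add _ _).trans (max_le_max h1.le le_rfl)
  rw [lt_div_iff₀ (zero_lt_iff.2 hM)] at h2
  refine lt_of_le_of_lt ?_ h2
  rw [show a * (x ^ 2 - y ^ 2) = (x - y) * (a * (x + y)) by ring, map_mul, map_mul]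
  gcongr

end Loc

section NF
variable {k : Type} [Field k] [NumberField k] [Nonempty (k →+* ℝ)]

lemma exists_small {a b : k} (ha : TP a) (hb : TP b) : ∃ ε : ℝ, 0 < ε ∧ ∀ (φ : k →+* ℝ) (x : k), |φ x| < ε → 0 < φ (b - a * x ^ 2) := by
  have := finite_real (k := k)
  have h1 : ∀ φ : k →+* ℝ, ∀ᶠ ε : ℝ in nhdsWithin 0 (Set.Ioi 0), ε ∈ Set.Ioo 0 (φ b / φ a) := fun φ =>
    Ioo_mem_nhdsGT (div_pos (hb φ) (ha φ))
  have h2 := (Filter.eventually_all.2 h1).and (Ioo_mem_nhdsGT (zero_lt_one (α := ℝ)))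
  obtain ⟨ε, hε, h01⟩ := h2.exists
  refine ⟨ε, h01.1, fun φ x hx => ?_⟩
  have h3 := (hε φ).2
  rw [lt_div_iff₀ (ha φ)] at h3
  rw [map_sub, map_mul, map_pow, sub_pos]
  refine lt_of_le_of_lt ?_ h3
  rw [mul_comm]
  have : φ x ^ 2 ≤ ε := by
    rw [← sq_abs]
    nlinarith [abs_nonneg (φ x), h01.1, h01.2]
  exact mul_le_mul_of_nonneg_right this (ha φ).le

lemma hasse_step {m : ℕ} {a : Fin (m + 4) → k} {b : k} (ha : ∀ i, TP (a i)) (hb : TP b) (h : ∀ v : Pl k, Rl (vl v) a b) :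
    ∃ x : k, TP (b - a 0 * x ^ 2) ∧ ∀ v : Pl k, Rl (vl v) (Fin.tail a) (b - a 0 * x ^ 2) := by
  classical
  have hb0 := hb.ne
  obtain ⟨S, hS2, hSa⟩ : ∃ S : Finset (Pl k), (∀ v ∉ S, vl v 2 = 1) ∧ ∀ v ∉ S, ∀ i, vl v (a i) = 1 := by
    obtain ⟨S2, h2⟩ := exists_S_unit (Units.mk0 (2 : k) two_ne_zero)
    choose Sa hSa using fun i => exists_S_unit (Units.mk0 (a i) (ha i).ne)
    refine ⟨S2 ∪ Finset.univ.biUnion Sa, fun v hv => ?_, fun v hv i => ?_⟩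
    · exact h2 v (fun h => hv (Finset.mem_union_left _ h))
    · exact hSa i v (fun h => hv (Finset.mem_union_right _ (Finset.mem_biUnion.2 ⟨i, Finset.mem_univ _, h⟩)))
  have h1 : ∀ v : Pl k, ∃ y : Fin (m + 4) → k, Qd (Fin.tail a) (Fin.tail y) ≠ 0 ∧
      vl v (Qd a y - b) < vl v 4 * vl v (Qd (Fin.tail a) (Fin.tail y)) := by
    intro v
    obtain ⟨x, hx1, hx⟩ := (h v).loc _ (good_vl v) hb0 1 (ha 1).ne
    have hT : Qd (Fin.tail a) (Fin.tail x) ≠ 0 := Qd_ne (j := 0) (fun i => ha i.succ) hx1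
    obtain ⟨t, ht, hlt⟩ := hx (vl v 4 * vl v (Qd (Fin.tail a) (Fin.tail x)))
      (mul_ne_zero (good_vl v).v4 ((Valuation.ne_zero_iff _).2 hT))
    have ht0 : t ≠ 0 := by rintro rfl; simp at ht
    have e : Qd (Fin.tail a) (Fin.tail fun i => x i / t) = Qd (Fin.tail a) (Fin.tail x) / t ^ 2 := Qd_div _ _ _
    refine ⟨fun i => x i / t, ?_, ?_⟩
    · rw [e]; exact div_ne_zero hT (pow_ne_zero _ ht0)
    · rw [e, map_div₀, map_pow, ht, one_pow, div_one]; exact hlt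
  choose y hT hy using h1
  have hδ : ∀ v : Pl k, vl v 4 * vl v (Qd (Fin.tail a) (Fin.tail (y v))) ≠ 0 := fun v =>
    mul_ne_zero (good_vl v).v4 ((Valuation.ne_zero_iff _).2 (hT v))
  choose γ hγ hγ' using fun v : Pl k => cont_sq (vl v) (a 0) (y v 0) (hδ v)
  obtain ⟨ε, hε, hε'⟩ := exists_small (ha 0) hb
  obtain ⟨x, hx, hxε⟩ := weak_approx_small S (fun v => y v 0) γ hγ ε hε
  have hTP : TP (b - a 0 * x ^ 2) := fun φ => hε' φ x (hxε φ)
  refine ⟨x, hTP, fun v => ?_⟩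
  by_cases hv : v ∈ S
  · have h2 : vl v (Qd (Fin.tail a) (Fin.tail (y v)) - (b - a 0 * x ^ 2)) < vl v 4 * vl v (Qd (Fin.tail a) (Fin.tail (y v))) := by
      have e : Qd (Fin.tail a) (Fin.tail (y v)) - (b - a 0 * x ^ 2) = (Qd a (y v) - b) + a 0 * (x ^ 2 - y v 0 ^ 2) := by
        rw [Qd_succ a]; ring
      rw [e]
      exact (vl v).map_add_lt (hy v) (hγ' v x (hx v hv))
    have h3 : vl v (b - a 0 * x ^ 2) = vl v (Qd (Fin.tail a) (Fin.tail (y v))) := by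
      have h4 : vl v (Qd (Fin.tail a) (Fin.tail (y v)) - (b - a 0 * x ^ 2)) < vl v (Qd (Fin.tail a) (Fin.tail (y v))) :=
        h2.trans_le (mul_le_of_le_one_left' (v_four_le _))
      rw [Valuation.map_sub_swap] at h4
      exact Valuation.map_eq_of_sub_lt _ h4
    refine R1' (vl v) (good_vl v).v4 hTP.ne ?_ (x := Fin.tail (y v))
    rw [h3]; exact h2
  · exact Rl_univ (good_vl v) (hS2 v hv) (fun i => hSa v hv _) hTP.ne

/-- Hasse principle for representation of numbers by totally positive diagonal forms. -/
theorem hasse (m : ℕ) : ∀ (a : Fin (m + 1) → k) (b : k), (∀ i, TP (a i)) → TP b → (∀ v : Pl k, Rl (vl v) a b) →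
    ∃ x, Qd a x = b := by
  induction m with
  | zero => intro a b; exact hasse1
  | succ m ih =>
    match m with
    | 0 => intro a b; exact hasse2
    | 1 => intro a b; exact hasse3
    | m + 2 =>
      intro a b ha hb h
      obtain ⟨x, h1, h2⟩ := hasse_step ha hb h
      obtain ⟨z, hz⟩ := ih (Fin.tail a) _ (fun i => ha _) h1 h2
      refine ⟨Fin.cons x z, ?_⟩
      rw [Qd_succ, Fin.tail_cons, hz]; simp

end NF
end HM

end

section
open scoped TensorProduct
open IsDedekindDomain
open scoped WithZero

namespace HM
section Rep
open Matrix
variable {K : Type} [Field K]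

/-- the diagonal form `a` represents the diagonal form `b` -/
def Rep (K : Type) [Field K] {m n : ℕ} (a : Fin m → K) (b : Fin n → K) : Prop :=
  ∃ M : Matrix (Fin m) (Fin n) K, Mᵀ * diagonal a * M = diagonal b

lemma Rep.trans {m n l : ℕ} {a : Fin m → K} {b : Fin n → K} {c : Fin l → K} (h : Rep K a b) (h' : Rep K b c) : Rep K a c := by
  obtain ⟨M, hM⟩ := h
  obtain ⟨N, hN⟩ := h'
  refine ⟨M * N, ?_⟩
  rw [transpose_mul, ← hN, ← hM]
  simp only [Matrix.mul_assoc]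

lemma Rep.map {L : Type} [Field L] (f : K →+* L) {m n : ℕ} {a : Fin m → K} {b : Fin n → K} (h : Rep K a b) :
    Rep L (fun i => f (a i)) (fun i => f (b i)) := by
  obtain ⟨M, hM⟩ := h
  refine ⟨M.map f, ?_⟩
  have := congrArg (fun N => N.map f) hM
  simp only [Matrix.map_mul, transpose_map, diagonal_map (map_zero f)] at this
  exact this

lemma Rep.symm {m : ℕ} {a b : Fin m → K} (h : Rep K a b) (hb : ∀ i, b i ≠ 0) : Rep K b a := by
  obtain ⟨M, hM⟩ := h
  have hd : IsUnit M.det := by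
    have := congrArg det hM
    rw [det_mul, det_mul, det_diagonal, det_diagonal] at this
    rw [isUnit_iff_ne_zero]
    intro h0
    rw [h0, mul_zero] at this
    exact (Finset.prod_ne_zero_iff.2 fun i _ => hb i) this.symm
  refine ⟨M⁻¹, ?_⟩
  rw [← hM, transpose_nonsing_inv]
  have hd' : IsUnit Mᵀ.det := by rwa [det_transpose]
  rw [Matrix.mul_assoc, Matrix.mul_assoc, mul_nonsing_inv _ hd, Matrix.mul_one, ← Matrix.mul_assoc,
    nonsing_inv_mul _ hd', Matrix.one_mul]

lemma rep_entry {m n : ℕ} (a : Fin m → K) (M : Matrix (Fin m) (Fin n) K) (i j : Fin n) :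
    (Mᵀ * diagonal a * M) i j = ∑ l, a l * M l i * M l j := by
  rw [Matrix.mul_apply]
  refine Finset.sum_congr rfl fun l _ => ?_
  rw [Matrix.mul_diagonal, transpose_apply]; ring

lemma rep_iff {m n : ℕ} {a : Fin m → K} {b : Fin n → K} : Rep K a b ↔
    ∃ M : Fin m → Fin n → K, ∀ i j, ∑ l, a l * M l i * M l j = if i = j then b i else 0 := by
  constructor
  · rintro ⟨M, hM⟩
    refine ⟨M, fun i j => ?_⟩
    rw [← rep_entry, hM, diagonal_apply]
  · rintro ⟨M, hM⟩
    refine ⟨Matrix.of M, ?_⟩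
    ext i j
    rw [rep_entry, diagonal_apply, ← hM]; rfl

lemma Rep.cancel (h2 : (2 : K) ≠ 0) {m n : ℕ} {a : Fin (m + 1) → K} {b : Fin (n + 1) → K} (h : Rep K a b) (hab : a 0 = b 0)
    (h0 : b 0 ≠ 0) : Rep K (Fin.tail a) (Fin.tail b) := by
  obtain ⟨M, hM⟩ := rep_iff.1 h
  obtain ⟨s, hs⟩ : ∃ s : K, -1 - 2 * s * M 0 0 + s ^ 2 * (1 - M 0 0 ^ 2) = 0 := by
    by_cases h1 : 1 - M 0 0 = 0
    · have e : M 0 0 = 1 := by linear_combination -h1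
      refine ⟨-1 / 2, ?_⟩
      rw [e]; field_simp; ring
    · refine ⟨1 / (1 - M 0 0), ?_⟩
      field_simp; ring
  rw [rep_iff]
  refine ⟨fun l j => M l.succ j.succ + s * M 0 j.succ * M l.succ 0, fun i j => ?_⟩
  have e1 := hM i.succ j.succ
  have e2 := hM i.succ 0
  have e3 := hM j.succ 0
  have e4 := hM 0 0
  rw [Fin.sum_univ_succ] at e1 e2 e3 e4
  rw [if_neg (Fin.succ_ne_zero _)] at e2 e3
  rw [if_pos rfl] at e4
  have : (if i.succ = j.succ then b i.succ else 0) = if i = j then Fin.tail b i else 0 := by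
    simp [Fin.tail]
  rw [this] at e1
  rw [← e1]
  have : ∑ l : Fin m, Fin.tail a l * (M l.succ i.succ + s * M 0 i.succ * M l.succ 0) * (M l.succ j.succ + s * M 0 j.succ * M l.succ 0)
    = ∑ l : Fin m, a l.succ * M l.succ i.succ * M l.succ j.succ + s * M 0 j.succ * ∑ l : Fin m, a l.succ * M l.succ i.succ * M l.succ 0
     + s * M 0 i.succ * ∑ l : Fin m, a l.succ * M l.succ j.succ * M l.succ 0 + s ^ 2 * M 0 i.succ * M 0 j.succ * ∑ l : Fin m, a l.succ * M l.succ 0 * M l.succ 0 := by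
    simp only [Finset.mul_sum, ← Finset.sum_add_distrib]
    refine Finset.sum_congr rfl fun l _ => ?_
    simp only [Fin.tail]; ring
  rw [this]
  rw [← hab] at e4
  linear_combination s * M 0 j.succ * e2 + s * M 0 i.succ * e3 + s ^ 2 * M 0 i.succ * M 0 j.succ * e4 + a 0 * M 0 i.succ * M 0 j.succ * hs

lemma Rep.cons {m n : ℕ} {a : Fin m → K} {b : Fin n → K} (h : Rep K a b) (c : K) :
    Rep K (Fin.cons c a : Fin (m + 1) → K) (Fin.cons c b : Fin (n + 1) → K) := by
  obtain ⟨M, hM⟩ := rep_iff.1 h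
  rw [rep_iff]
  refine ⟨Fin.cons (Fin.cons 1 0) (fun l => Fin.cons 0 (M l)), fun i j => ?_⟩
  rw [Fin.sum_univ_succ]
  refine Fin.cases ?_ (fun i => ?_) i <;> refine Fin.cases ?_ (fun j => ?_) j
  · simp
  · simp [(Fin.succ_ne_zero j).symm]
  · simp
  · simpa using hM i j

/-- bilinear form attached to a diagonal form -/
def Bd {m : ℕ} (a : Fin m → K) : LinearMap.BilinForm K (Fin m → K) :=
  LinearMap.mk₂ K (fun x y => ∑ l, a l * x l * y l)
    (fun x y z => by simp [mul_add, add_mul, Finset.sum_add_distrib])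
    (fun c x y => by simp only [Pi.smul_apply, smul_eq_mul, Finset.mul_sum]; exact Finset.sum_congr rfl fun _ _ => by ring)
    (fun x y z => by simp [mul_add, Finset.sum_add_distrib])
    (fun c x y => by simp only [Pi.smul_apply, smul_eq_mul, Finset.mul_sum]; exact Finset.sum_congr rfl fun _ _ => by ring)

lemma Bd_apply {m : ℕ} (a x y : Fin m → K) : Bd a x y = ∑ l, a l * x l * y l := rfl
lemma Bd_self {m : ℕ} (a x : Fin m → K) : Bd a x x = Qd a x := by
  rw [Bd_apply, Qd]; exact Finset.sum_congr rfl fun _ _ => by ring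
lemma Bd_symm {m : ℕ} (a x y : Fin m → K) : Bd a x y = Bd a y x := by
  rw [Bd_apply, Bd_apply]; exact Finset.sum_congr rfl fun _ _ => by ring

lemma rep_split [Invertible (2 : K)] {m : ℕ} {a : Fin (m + 1) → K} {x : Fin (m + 1) → K} (h0 : Qd a x ≠ 0) :
    ∃ y : Fin m → Fin (m + 1) → K, LinearIndependent K y ∧
      Rep K a (Fin.cons (Qd a x) (fun i => Qd a (y i)) : Fin (m + 1) → K) := by
  let f : Module.Dual K (Fin (m + 1) → K) := Bd a x
  have hf : f ≠ 0 := by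
    intro h
    apply h0
    rw [← Bd_self]
    show f x = 0
    rw [h]; rfl
  have hr := Module.Dual.finrank_ker_add_one_of_ne_zero hf
  rw [Module.finrank_fin_fun, add_left_inj] at hr
  let B' : LinearMap.BilinForm K (LinearMap.ker f) := (Bd a).restrict (LinearMap.ker f)
  have hB' : LinearMap.IsSymm B' := ⟨fun u w => Bd_symm a u w⟩
  obtain ⟨e, he⟩ := LinearMap.BilinForm.exists_orthogonal_basis hB'
  let e' := e.reindex (finCongr hr)
  have he' : ∀ i j, i ≠ j → Bd a (e' i : Fin (m + 1) → K) (e' j) = 0 := by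
    intro i j hij
    have := he (i := (finCongr hr).symm i) (j := (finCongr hr).symm j) (by simpa using hij)
    simpa [e', B'] using this
  refine ⟨fun i => (e' i : Fin (m + 1) → K), ?_, ?_⟩
  · exact e'.linearIndependent.map' (LinearMap.ker f).subtype (by simp)
  · rw [rep_iff]
    refine ⟨fun l => Fin.cons (x l) (fun i => (e' i : Fin (m + 1) → K) l), fun i j => ?_⟩
    refine Fin.cases ?_ (fun i => ?_) i <;> refine Fin.cases ?_ (fun j => ?_) j
    · simp [← Bd_self, Bd_apply]
    · have : f (e' j) = 0 := (e' j).2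
      simp only [Fin.cons_zero, Fin.cons_succ, if_neg (Fin.succ_ne_zero j).symm]
      exact this
    · have : f (e' i) = 0 := (e' i).2
      simp only [Fin.cons_zero, Fin.cons_succ, if_neg (Fin.succ_ne_zero i)]
      rw [← Bd_apply, Bd_symm]
      exact this
    · simp only [Fin.cons_succ, Fin.succ_inj]
      rw [← Bd_apply]
      split_ifs with hij
      · rw [hij, Bd_self]
      · exact he' i j hij

end Rep
end HM

end

section
open scoped TensorProduct
open IsDedekindDomain
open scoped WithZero

namespace HM
section Compl
variable {k : Type} [Field k] [NumberField k]

/-- valuation of the completion -/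
def vc (v : Pl k) : Valuation (v.adicCompletion k) ℤᵐ⁰ := Valued.v

lemma vc_coe (v : Pl k) (x : k) : vc v (algebraMap k (v.adicCompletion k) x) = vl v x :=
  HeightOneSpectrum.adicCompletion.valued_coe ..

lemma vc_surj (v : Pl k) {γ : ℤᵐ⁰} (hγ : γ ≠ 0) : ∃ g : k, g ≠ 0 ∧ vl v g = γ := by
  obtain ⟨g, hg⟩ := (good_vl v).surj γ
  exact ⟨g, by rintro rfl; simp at hg; exact hγ hg.symm, hg⟩

lemma vc_dense (v : Pl k) (X : v.adicCompletion k) {γ : ℤᵐ⁰} (hγ : γ ≠ 0) :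
    ∃ x : k, vc v (X - algebraMap k _ x) < γ := by
  obtain ⟨g, hg0, hg⟩ := vc_surj v hγ
  have hd : DenseRange (algebraMap k (v.adicCompletion k)) := HeightOneSpectrum.denseRange_algebraMap _ _
  let r := (Valued.v (R := v.adicCompletion k)).restrict (algebraMap k _ g)
  have ho := Valued.isOpen_ball (v.adicCompletion k) r
  have ho' : IsOpen {y | X - y ∈ {x : v.adicCompletion k | Valued.v.restrict x < r}} :=
    ho.preimage (continuous_const.sub continuous_id)
  obtain ⟨x, hx⟩ := hd.exists_mem_open ho' ⟨X, by
    simp only [Set.mem_setOf_eq, sub_self, r]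
    rw [Valuation.restrict_lt_iff]
    have := vc_coe v g
    rw [hg] at this
    show vc v 0 < vc v _
    rw [this, map_zero]
    exact zero_lt_iff.2 hγ⟩
  refine ⟨x, ?_⟩
  simp only [Set.mem_setOf_eq, r] at hx
  rw [Valuation.restrict_lt_iff] at hx
  have := vc_coe v g
  rw [hg] at this
  rw [← this]
  exact hx

lemma Rl_of_compl (v : Pl k) {m : ℕ} {a : Fin m → k} {b : k}
    {X : Fin m → v.adicCompletion k} (h : Qd (fun i => algebraMap k (v.adicCompletion k) (a i)) X = algebraMap k _ b) :
    Rl (vl v) a b := by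
  intro γ hγ
  have h1 : ∀ i, ∃ x : k, vc v (algebraMap k _ (a i) * ((algebraMap k _ x) ^ 2 - X i ^ 2)) < γ := by
    intro i
    obtain ⟨δ, hδ, h⟩ := cont_sq (vc v) (algebraMap k _ (a i)) (X i) hγ
    obtain ⟨x, hx⟩ := vc_dense v (X i) hδ
    exact ⟨x, h _ (by rwa [Valuation.map_sub_swap])⟩
  choose x hx using h1
  refine ⟨x, ?_⟩
  rw [← vc_coe, map_sub, ← h]
  have : algebraMap k (v.adicCompletion k) (Qd a x) - Qd (fun i => algebraMap k (v.adicCompletion k) (a i)) X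
     = ∑ i, algebraMap k _ (a i) * ((algebraMap k _ (x i)) ^ 2 - X i ^ 2) := by
    simp only [Qd, map_sum, map_mul, map_pow, ← Finset.sum_sub_distrib, mul_sub]
  rw [this]
  exact Valuation.map_sum_lt _ hγ fun i _ => hx i

lemma exists_pl : Nonempty (Pl k) := by
  obtain ⟨I, hI, hm⟩ := Ring.not_isField_iff_exists_prime.1 (NumberField.RingOfIntegers.not_isField k)
  exact ⟨⟨I, hm, hI⟩⟩

theorem hasse_space [Nonempty (k →+* ℝ)] (n : ℕ) : ∀ (m : ℕ) (a : Fin m → k) (b : Fin n → k), (∀ i, TP (a i)) → (∀ i, TP (b i)) →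
    (∀ v : Pl k, Rep (v.adicCompletion k) (fun i => algebraMap k (v.adicCompletion k) (a i)) (fun i => algebraMap k (v.adicCompletion k) (b i))) →
    Rep k a b := by
  have h2 : (2 : k) ≠ 0 := two_ne_zero
  letI : Invertible (2 : k) := invertibleOfNonzero h2
  induction n with
  | zero => intro m a b _ _ _; exact ⟨0, by ext i; exact i.elim0⟩
  | succ n ih =>
    intro m a b ha hb h
    have hloc : ∀ v : Pl k, Rl (vl v) a (b 0) := by
      intro v
      obtain ⟨M, hM⟩ := rep_iff.1 (h v)
      have := hM 0 0
      simp only [if_true] at this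
      refine Rl_of_compl v (X := fun l => M l 0) ?_
      rw [← this, Qd]
      exact Finset.sum_congr rfl fun _ _ => by ring
    cases m with
    | zero =>
      exfalso
      obtain ⟨v⟩ := exists_pl (k := k)
      obtain ⟨x, hx⟩ := hloc v (vl v (b 0)) (by simpa using (hb 0).ne)
      simp [Qd, Valuation.map_neg] at hx
    | succ m =>
      obtain ⟨x, hx⟩ := hasse m a (b 0) ha (hb 0) hloc
      have h0 : Qd a x ≠ 0 := by rw [hx]; exact (hb 0).ne
      obtain ⟨y, hy, hr⟩ := rep_split h0
      rw [hx] at hr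
      have hTP : ∀ i, TP (Qd a (y i)) := by
        intro i φ
        obtain ⟨j, hj⟩ := Function.ne_iff.1 (hy.ne_zero i)
        exact Qd_pos ha φ hj
      have := ih m (fun i => Qd a (y i)) (Fin.tail b) hTP (fun i => hb _) (fun v => by
        have e1 : Rep (v.adicCompletion k) _ _ := hr.map (algebraMap k (v.adicCompletion k))
        have e2 := (e1.symm (by
          intro i
          refine Fin.cases ?_ (fun i => ?_) i
          · simpa using (hb 0).ne
          · simpa using (hTP i).ne)).trans (h v)
        have e3 := e2.cancel (fun h => h2 ((algebraMap k (v.adicCompletion k)).injective (by rw [map_ofNat, map_zero]; exact h))) (by simp) (by simpa using (hb 0).ne)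
        exact e3)
      have e := this.cons (b 0)
      have e' := hr.trans e
      rwa [Fin.cons_self_tail] at e'
end Compl
end HM

end

section
open scoped TensorProduct
open IsDedekindDomain
open scoped WithZero

namespace HM
section Link
variable {K : Type} [Field K]

lemma bilin_diag {V : Type} [AddCommGroup V] [Module K V] (B : LinearMap.BilinForm K V) {n : ℕ} {u : Fin n → V} {a : Fin n → K}
    (h : ∀ i j, B (u i) (u j) = if i = j then a i else 0) (c : Fin n → K) : B (∑ i, c i • u i) (∑ i, c i • u i) = Qd a c := by
  simp only [map_sum, LinearMap.sum_apply, map_smul, LinearMap.smul_apply, smul_eq_mul, h, Qd]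
  refine Finset.sum_congr rfl fun i _ => ?_
  rw [Finset.sum_eq_single i]
  · simp; ring
  · intro j _ hj; simp [hj]
  · simp

/-- the basis `e` diagonalizes `Q` with values `a` -/
def Dg {V : Type} [AddCommGroup V] [Module K V] (Q : QuadraticForm K V) {n : ℕ} (e : Module.Basis (Fin n) K V) (a : Fin n → K) : Prop :=
  ∀ x, Q x = Qd a (e.repr x)

lemma Qd_add {n : ℕ} (a x y : Fin n → K) : Qd a (x + y) = Qd a x + Qd a y + 2 * Bd a x y := by
  simp only [Qd, Bd_apply, Pi.add_apply, Finset.mul_sum, ← Finset.sum_add_distrib]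
  exact Finset.sum_congr rfl fun _ _ => by ring

lemma Dg.polar {V : Type} [AddCommGroup V] [Module K V] {Q : QuadraticForm K V} {n : ℕ} {e : Module.Basis (Fin n) K V} {a : Fin n → K}
    (h : Dg Q e a) (x y : V) : QuadraticMap.polar Q x y = 2 * Bd a (e.repr x) (e.repr y) := by
  rw [QuadraticMap.polar, h, h, h, map_add, Finsupp.coe_add, Qd_add]; ring

lemma Bd_single {n : ℕ} (a : Fin n → K) (i j : Fin n) : Bd a (Pi.single i 1) (Pi.single j 1) = if i = j then a i else 0 := by
  rw [Bd_apply, Finset.sum_eq_single i]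
  · by_cases h : i = j
    · subst h; simp
    · simp [h]
  · intro l _ hl; simp [hl]
  · simp

lemma Bd_single' {n : ℕ} (a x : Fin n → K) (j : Fin n) : Bd a x (Pi.single j 1) = a j * x j := by
  rw [Bd_apply, Finset.sum_eq_single j]
  · simp
  · intro l _ hl; simp [hl]
  · simp

lemma Dg.val {V : Type} [AddCommGroup V] [Module K V] {Q : QuadraticForm K V} {n : ℕ} {e : Module.Basis (Fin n) K V} {a : Fin n → K}
    (h : Dg Q e a) (i : Fin n) : Q (e i) = a i := by
  rw [h, Module.Basis.repr_self, Finsupp.single_eq_pi_single, ← Bd_self, Bd_single, if_pos rfl]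

lemma Dg.nondeg (h2 : (2 : K) ≠ 0) {V : Type} [AddCommGroup V] [Module K V] {Q : QuadraticForm K V} {n : ℕ} {e : Module.Basis (Fin n) K V} {a : Fin n → K}
    (h : Dg Q e a) (ha : ∀ i, a i ≠ 0) : QLat.Nondeg Q := by
  intro x hx
  apply e.repr.injective
  ext i
  have := hx (e i)
  rw [h.polar, Module.Basis.repr_self, Finsupp.single_eq_pi_single, Bd_single'] at this
  simpa [h2, ha i] using this

lemma Dg.ne {V : Type} [AddCommGroup V] [Module K V] {Q : QuadraticForm K V} {n : ℕ} {e : Module.Basis (Fin n) K V} {a : Fin n → K}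
    (h : Dg Q e a) (hn : QLat.Nondeg Q) (i : Fin n) : a i ≠ 0 := by
  intro hi
  refine e.ne_zero i (hn _ fun y => ?_)
  rw [h.polar, Module.Basis.repr_self, Finsupp.single_eq_pi_single, Bd_symm, Bd_single', hi]
  simp

lemma exists_Dg (h2 : (2 : K) ≠ 0) {V : Type} [AddCommGroup V] [Module K V] [FiniteDimensional K V] (Q : QuadraticForm K V) :
    ∃ (e : Module.Basis (Fin (Module.finrank K V)) K V) (a : Fin (Module.finrank K V) → K), Dg Q e a := by
  let _ : Invertible (2 : K) := invertibleOfNonzero h2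
  obtain ⟨w, ⟨f⟩⟩ := Q.equivalent_weightedSumSquares
  refine ⟨Module.Basis.ofEquivFun f.toLinearEquiv, w, fun x => ?_⟩
  rw [← f.map_app, QuadraticMap.weightedSumSquares_apply, Qd]
  refine Finset.sum_congr rfl fun i _ => ?_
  simp [Module.Basis.ofEquivFun, sq]

lemma inj_of_isom {W V : Type} [AddCommGroup W] [Module K W] [AddCommGroup V] [Module K V]
    {Q' : QuadraticForm K W} {Q : QuadraticForm K V} (hn : QLat.Nondeg Q') (σ : W →ₗ[K] V) (h : ∀ x, Q (σ x) = Q' x) :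
    Function.Injective σ := by
  rw [← LinearMap.ker_eq_bot, LinearMap.ker_eq_bot']
  intro x hx
  refine hn x fun y => ?_
  rw [QuadraticMap.polar, ← h, ← h, ← h, map_add, hx, zero_add, map_zero]; ring

lemma spaceRep_iff (h2 : (2 : K) ≠ 0) {W V : Type} [AddCommGroup W] [Module K W] [AddCommGroup V] [Module K V]
    {Q' : QuadraticForm K W} {Q : QuadraticForm K V} (hn : QLat.Nondeg Q') {m n : ℕ} {e : Module.Basis (Fin m) K V} {a : Fin m → K}
    (he : Dg Q e a) {f : Module.Basis (Fin n) K W} {b : Fin n → K} (hf : Dg Q' f b) :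
    QLat.SpaceRep Q' Q ↔ Rep K a b := by
  rw [rep_iff]
  constructor
  · rintro ⟨σ, -, hσ⟩
    refine ⟨fun l i => e.repr (σ (f i)) l, fun i j => ?_⟩
    rw [← Bd_single b, ← Bd_apply a (e.repr (σ (f i))) (e.repr (σ (f j)))]
    apply mul_left_cancel₀ h2
    rw [← he.polar, ← Finsupp.single_eq_pi_single, ← Finsupp.single_eq_pi_single, ← f.repr_self, ← f.repr_self, ← hf.polar,
      QuadraticMap.polar, QuadraticMap.polar, ← hσ, ← hσ, ← hσ, map_add σ]
  · rintro ⟨M, hM⟩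
    let σ : W →ₗ[K] V := f.constr K (fun i => e.equivFun.symm (fun l => M l i))
    have hσ : ∀ x, Q (σ x) = Q' x := by
      intro x
      rw [he, hf, ← bilin_diag (Bd a) (u := fun i l => M l i) hM, ← Bd_self]
      have : (e.repr (σ x) : Fin m → K) = ∑ i, f.repr x i • fun l => M l i := by
        rw [← Module.Basis.equivFun_apply]
        simp only [σ, Module.Basis.constr_apply_fintype, map_sum, map_smul, LinearEquiv.apply_symm_apply, Module.Basis.equivFun_apply]
      rw [this]
    exact ⟨σ, inj_of_isom hn σ hσ, hσ⟩

end Link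

section BC
variable {F : Type} [Field F] [NumberField F]
open QGlob

lemma two_ne_compl (v : Pl F) : (2 : v.adicCompletion F) ≠ 0 := fun h =>
  (two_ne_zero : (2 : F) ≠ 0) ((algebraMap F (v.adicCompletion F)).injective (by rw [map_ofNat, map_zero]; exact h))

lemma exists_bc {V : Type} [AddCommGroup V] [Module F V] (Q : QuadraticForm F V) (v : Pl F) :
    ∃ B : LinearMap.BilinForm (Fv F v) (Vv F V v), (∀ x, B x x = Qv F Q v x) ∧ (∀ x y, B x y = B y x) ∧
      ∀ x y : V, 2 * B (toVv F v x) (toVv F v y) = algebraMap F (Fv F v) (QuadraticMap.polar Q x y) := by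
  let _ : Invertible (2 : F) := invertibleOfNonzero two_ne_zero
  let _ : Invertible (2 : Fv F v) := invertibleOfNonzero (two_ne_compl v)
  refine ⟨QuadraticMap.associated (Qv F Q v), fun x => QuadraticMap.associated_eq_self_apply _ _ x, fun x y => ?_, fun x y => ?_⟩
  · exact (QuadraticMap.associated_isSymm (Fv F v) (Qv F Q v)) x y
  have h : Qv F Q v = Q.baseChange (Fv F v) := rfl
  rw [h, QuadraticForm.associated_baseChange]
  have : LinearMap.BilinForm.baseChange (Fv F v) (QuadraticMap.associated Q) (toVv F v x) (toVv F v y) =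
     algebraMap F (Fv F v) (QuadraticMap.associated Q x y) := by
    simp [toVv, LinearMap.BilinForm.baseChange_tmul, Algebra.smul_def]
  have h3 := QuadraticMap.two_nsmul_associated F Q
  have h4 : 2 * QuadraticMap.associated Q x y = QuadraticMap.polar Q x y := by
    have := congrArg (fun B => B x y) h3
    simpa [two_mul, two_nsmul] using this
  rw [← h4, map_mul, map_ofNat, ← this]

end BC
end HM

end

section
open scoped TensorProduct
open IsDedekindDomain
open scoped WithZero

namespace HM
section BC2
variable {F : Type} [Field F] [NumberField F]
open QGlob QLat

section Gen
variable {K : Type} [Field K] {O : Subring K} {V : Type} [AddCommGroup V] [Module K V] {t : Set V}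

lemma ospan_eq (O : Subring K) (t : Set V) :
    ospan O t = (Submodule.span O t : Set V) := by
  ext x
  rw [SetLike.mem_coe, Submodule.mem_span_set']
  constructor
  · rintro ⟨m, c, g, hc, hg, rfl⟩
    exact ⟨m, fun i => ⟨c i, hc i⟩, fun i => ⟨g i, hg i⟩, rfl⟩
  · rintro ⟨m, c, g, rfl⟩
    exact ⟨m, fun i => (c i : K), fun i => g i, fun i => (c i).2, fun i => (g i).2, rfl⟩

lemma ospan_sub {x : V} (h : x ∈ t) : x ∈ ospan O t := by rw [ospan_eq]; exact Submodule.subset_span h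
lemma ospan_zero : (0 : V) ∈ ospan O t := by rw [ospan_eq]; exact zero_mem _
lemma ospan_add {x y : V} (h : x ∈ ospan O t) (h' : y ∈ ospan O t) : x + y ∈ ospan O t := by
  rw [ospan_eq] at *; exact add_mem h h'
lemma ospan_smul {c : K} (hc : c ∈ O) {x : V} (h : x ∈ ospan O t) : c • x ∈ ospan O t := by
  rw [ospan_eq] at *; exact Submodule.smul_mem _ (⟨c, hc⟩ : O) h
lemma ospan_sum {ι : Type} (s : Finset ι) (f : ι → V) (h : ∀ i ∈ s, f i ∈ ospan O t) : ∑ i ∈ s, f i ∈ ospan O t := by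
  rw [ospan_eq] at *; exact sum_mem h
lemma ospan_ind {p : V → Prop} (h1 : ∀ x ∈ t, p x) (h0 : p 0) (ha : ∀ x ∈ ospan O t, ∀ y ∈ ospan O t, p x → p y → p (x + y))
    (hs : ∀ c ∈ O, ∀ x ∈ ospan O t, p x → p (c • x)) {x : V} (hx : x ∈ ospan O t) : p x := by
  rw [ospan_eq] at *
  exact Submodule.span_induction (p := fun x _ => p x) h1 h0 (fun x y hx hy => ha x hx y hy) (fun c x hx => hs c c.2 x hx) hx
end Gen

lemma bc_diag {V : Type} [AddCommGroup V] [Module F V] (Q : QuadraticForm F V) (v : Pl F) {n : ℕ} {u : Fin n → V} {a : Fin n → F}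
    (h : ∀ i j, QuadraticMap.polar Q (u i) (u j) = if i = j then 2 * a i else 0) (c : Fin n → Fv F v) :
    Qv F Q v (∑ i, c i • toVv F v (u i)) = Qd (fun i => algebraMap F (Fv F v) (a i)) c := by
  obtain ⟨B, hB, hBs, hB2⟩ := exists_bc Q v
  rw [← hB]
  refine bilin_diag B (fun i j => ?_) c
  apply mul_left_cancel₀ (two_ne_compl v)
  rw [hB2, h]
  split_ifs
  · rw [map_mul, map_ofNat]
  · simp

lemma Dg.polar_basis {V : Type} [AddCommGroup V] [Module F V] {Q : QuadraticForm F V} {n : ℕ} {e : Module.Basis (Fin n) F V} {a : Fin n → F}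
    (h : Dg Q e a) (i j : Fin n) : QuadraticMap.polar Q (e i) (e j) = if i = j then 2 * a i else 0 := by
  rw [h.polar, e.repr_self, e.repr_self, Finsupp.single_eq_pi_single, Finsupp.single_eq_pi_single, Bd_single]
  split_ifs <;> simp

lemma Dg.bc {V : Type} [AddCommGroup V] [Module F V] {Q : QuadraticForm F V} {n : ℕ} {e : Module.Basis (Fin n) F V} {a : Fin n → F}
    (h : Dg Q e a) (v : Pl F) : Dg (Qv F Q v) (Algebra.TensorProduct.basis (Fv F v) e) (fun i => algebraMap F (Fv F v) (a i)) := by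
  intro x
  rw [← bc_diag Q v h.polar_basis]
  congr 1
  conv_lhs => rw [← (Algebra.TensorProduct.basis (Fv F v) e).sum_repr x]
  simp [toVv]

lemma alg_OF (v : Pl F) {x : F} (hx : x ∈ OF F) : algebraMap F (Fv F v) x ∈ Ov F v := by
  have h : vl v x ≤ 1 := by
    obtain ⟨y, hy⟩ : ∃ y : NumberField.RingOfIntegers F, algebraMap _ F y = x := ⟨⟨x, hx⟩, rfl⟩
    rw [← hy]
    exact v.valuation_le_one y
  show vc v _ ≤ 1
  rwa [vc_coe]

lemma mem_OF {x : F} (h : ∀ v : Pl F, vl v x ≤ 1) : x ∈ OF F := by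
  obtain ⟨y, hy⟩ := HeightOneSpectrum.mem_integers_of_valuation_le_one F x h
  rw [← hy]
  exact y.2

lemma mem_Ov {v : Pl F} {x : Fv F v} : x ∈ Ov F v ↔ vc v x ≤ 1 := Iff.rfl

section
variable {V : Type} [AddCommGroup V] [Module F V]

lemma toVv_add (v : Pl F) (x y : V) : toVv F v (x + y) = toVv F v x + toVv F v y := TensorProduct.tmul_add ..
lemma toVv_smul (v : Pl F) (c : F) (x : V) : toVv F v (c • x) = algebraMap F (Fv F v) c • toVv F v x := by
  simp only [toVv, TensorProduct.tmul_smul]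
  rw [algebraMap_smul]
lemma toVv_zero (v : Pl F) : toVv F v (0 : V) = 0 := TensorProduct.tmul_zero ..

lemma toVv_sum (v : Pl F) {ι : Type} (s : Finset ι) (f : ι → V) : toVv F v (∑ i ∈ s, f i) = ∑ i ∈ s, toVv F v (f i) := 
  TensorProduct.tmul_sum ..

lemma toVv_span (v : Pl F) (t : Set V) {x : V} (hx : x ∈ ospan (OF F) t) : toVv F v x ∈ ospan (Ov F v) (toVv F v '' t) := by
  refine ospan_ind (p := fun x => toVv F v x ∈ ospan (Ov F v) (toVv F v '' t)) ?_ ?_ ?_ ?_ hx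
  · intro x hx; exact ospan_sub ⟨x, hx, rfl⟩
  · rw [toVv_zero]; exact ospan_zero
  · intro x _ y _ hx hy; rw [toVv_add]; exact ospan_add hx hy
  · intro c hc x _ hx
    rw [toVv_smul]
    exact ospan_smul (alg_OF v hc) hx

lemma Lv_latticeOn (v : Pl F) {N : Set V} (hN : IsLatticeOn (OF F) N) : IsLatticeOn (Ov F v) (Lv F N v) := by
  classical
  obtain ⟨⟨t, rfl⟩, ht⟩ := hN
  have hLv : Lv F (ospan (OF F) (t : Set V)) v = ospan (Ov F v) (toVv F v '' (t : Set V)) := by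
    rw [Lv]
    apply subset_antisymm
    · intro x hx
      refine ospan_ind (p := fun x => x ∈ ospan (Ov F v) (toVv F v '' (t : Set V))) ?_ ospan_zero (fun x _ y _ hx hy => ospan_add hx hy)
        (fun c hc x _ hx => ospan_smul hc hx) hx
      rintro _ ⟨x, hx, rfl⟩
      exact toVv_span v _ hx
    · rw [ospan_eq, ospan_eq]
      exact Submodule.span_mono (Set.image_mono fun x hx => ospan_sub hx)
  refine ⟨⟨t.image (toVv F v), ?_⟩, ?_⟩
  · rw [hLv, Finset.coe_image]
  · rw [eq_top_iff]
    rintro x -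
    have h1 : ∀ y : V, toVv F v y ∈ Submodule.span (Fv F v) (Lv F (ospan (OF F) (t : Set V)) v) := by
      intro y
      have hy : y ∈ Submodule.span F (ospan (OF F) (t : Set V)) := by rw [ht]; trivial
      refine Submodule.span_induction (p := fun x _ => toVv F v x ∈ Submodule.span (Fv F v) (Lv F (ospan (OF F) (t : Set V)) v)) ?_ ?_ ?_ ?_ hy
      · intro x hx
        exact Submodule.subset_span (ospan_sub ⟨x, hx, rfl⟩)
      · rw [toVv_zero]; exact zero_mem _
      · intro x y _ _ hx hy; rw [toVv_add]; exact add_mem hx hy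
      · intro c x _ hx; rw [toVv_smul]; exact Submodule.smul_mem _ _ hx
    induction x using TensorProduct.induction_on with
    | zero => exact zero_mem _
    | add x y hx hy => exact add_mem hx hy
    | tmul c y =>
      have : (c ⊗ₜ[F] y : Vv F V v) = c • toVv F v y := by simp [toVv, TensorProduct.smul_tmul']
      rw [this]
      exact Submodule.smul_mem _ _ (h1 y)

lemma Qv_toVv (v : Pl F) (Q : QuadraticForm F V) (x : V) : Qv F Q v (toVv F v x) = algebraMap F (Fv F v) (Q x) := by
  obtain ⟨B, hB, hBs, hB2⟩ := exists_bc Q v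
  apply mul_left_cancel₀ (two_ne_compl v)
  rw [← hB, hB2, QuadraticMap.polar_self, two_nsmul, two_mul, map_add]

lemma Lv_integral (v : Pl F) {Q : QuadraticForm F V} {N : Set V} (hN : IsLatticeOn (OF F) N) (hI : IsIntegral (OF F) Q N) :
    IsIntegral (Ov F v) (Qv F Q v) (Lv F N v) := by
  obtain ⟨⟨t, ht⟩, -⟩ := hN
  obtain ⟨B, hB, hBs, hB2⟩ := exists_bc Q v
  have hadd : ∀ x ∈ N, ∀ y ∈ N, x + y ∈ N := by
    rw [ht]; intro x hx y hy; exact ospan_add hx hy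
  intro x hx
  rw [Lv] at hx
  have hpol : ∀ x ∈ ospan (Ov F v) (toVv F v '' N), ∀ y ∈ ospan (Ov F v) (toVv F v '' N), 2 * B x y ∈ Ov F v := by
    intro x hx y hy
    refine ospan_ind (p := fun x => 2 * B x y ∈ Ov F v) ?_ ?_ ?_ ?_ hx
    · rintro _ ⟨x, hx, rfl⟩
      refine ospan_ind (p := fun y => 2 * B (toVv F v x) y ∈ Ov F v) ?_ ?_ ?_ ?_ hy
      · rintro _ ⟨y, hy, rfl⟩
        rw [hB2]
        apply alg_OF
        exact sub_mem (sub_mem (hI _ (hadd x hx y hy)) (hI x hx)) (hI y hy)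
      · simp [zero_mem]
      · intro y _ z _ h1 h2; rw [map_add, mul_add]; exact add_mem h1 h2
      · intro c hc y _ h
        have : 2 * B (toVv F v x) (c • y) = c * (2 * B (toVv F v x) y) := by
          rw [map_smul, smul_eq_mul]; ring
        rw [this]; exact mul_mem hc h
    · simp [zero_mem]
    · intro x _ z _ h1 h2; rw [map_add, LinearMap.add_apply, mul_add]; exact add_mem h1 h2
    · intro c hc x _ h
      have : 2 * B (c • x) y = c * (2 * B x y) := by
        rw [map_smul, LinearMap.smul_apply, smul_eq_mul]; ring
      rw [this]; exact mul_mem hc h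
  have hB3 : ∀ x y, Qv F Q v (x + y) = Qv F Q v x + Qv F Q v y + 2 * B x y := by
    intro x y
    rw [← hB, ← hB, ← hB]
    simp only [map_add, LinearMap.add_apply]
    rw [hBs y x]; ring
  refine ospan_ind (p := fun x => Qv F Q v x ∈ Ov F v) ?_ ?_ ?_ ?_ hx
  · rintro _ ⟨x, hx, rfl⟩
    rw [Qv_toVv]; exact alg_OF v (hI x hx)
  · simp [zero_mem]
  · intro x hx y hy h1 h2
    rw [hB3]
    exact add_mem (add_mem h1 h2) (hpol _ hx _ hy)
  · intro c hc x _ h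
    rw [QuadraticMap.map_smul]
    exact mul_mem (mul_mem hc hc) h
end
end BC2
end HM

end

section
open scoped TensorProduct
open IsDedekindDomain
open scoped WithZero

namespace HM
section Sqrt
variable {k : Type} [Field k] [NumberField k]

/-- iteration converging to a root of `s² + s = μ` -/
def sit {K : Type} [Field K] (μ : K) : ℕ → K
  | 0 => 0
  | n + 1 => μ - sit μ n ^ 2

lemma sit_le {K : Type} [Field K] (v : Valuation K ℤᵐ⁰) {μ : K} (h : v μ < 1) (n : ℕ) : v (sit μ n) ≤ v μ := by
  induction n with
  | zero => simp [sit]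
  | succ n ih =>
    rw [sit]
    refine (v.map_sub _ _).trans (max_le le_rfl ?_)
    rw [map_pow, sq]
    calc v (sit μ n) * v (sit μ n) ≤ v μ * 1 := mul_le_mul' ih (ih.trans h.le)
      _ = v μ := mul_one _

lemma sit_diff {K : Type} [Field K] (v : Valuation K ℤᵐ⁰) {μ : K} (h : v μ < 1) (n : ℕ) :
    v (sit μ (n + 1) - sit μ n) ≤ WithZero.exp (-(n : ℤ)) := by
  induction n with
  | zero => simpa [sit] using h.le
  | succ n ih =>
    have e : sit μ (n + 1 + 1) - sit μ (n + 1) = -((sit μ (n + 1) - sit μ n) * (sit μ (n + 1) + sit μ n)) := by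
      rw [sit, sit]; ring
    rw [e, Valuation.map_neg, map_mul]
    have h1 : v (sit μ (n + 1) + sit μ n) ≤ WithZero.exp (-1 : ℤ) :=
      lt_one_le_exp (((v.map_add _ _).trans (max_le (sit_le v h _) (sit_le v h _))).trans_lt h)
    calc _ ≤ WithZero.exp (-(n : ℤ)) * WithZero.exp (-1 : ℤ) := mul_le_mul' ih h1
      _ = _ := by rw [← WithZero.exp_add]; congr 1; push_cast; ring

lemma sit_root (v : Pl k) {μ : v.adicCompletion k} (h : vc v μ < 1) : ∃ s : v.adicCompletion k, s ^ 2 + s = μ := by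
  have ht : Filter.Tendsto (fun n => sit μ (n + 1) - sit μ n) Filter.atTop (nhds 0) := by
    rw [(Valued.hasBasis_nhds_zero (v.adicCompletion k) ℤᵐ⁰).tendsto_right_iff]
    intro γ _
    obtain ⟨N, hN⟩ := exists_exp_lt (MonoidWithZeroHom.ValueGroup₀.embedding γ.1) (by
      rw [map_ne_zero]; exact γ.ne_zero)
    filter_upwards [Filter.eventually_ge_atTop N] with n hn
    have : Valued.v.restrict (sit μ (n + 1) - sit μ n) < γ.1 := by
      rw [Valuation.restrict_lt_iff_lt_embedding]
      exact (sit_diff (vc v) h n).trans_lt (hN n hn)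
    exact this
  have hc : CauchySeq (sit μ) := NonarchimedeanAddGroup.cauchySeq_of_tendsto_sub_nhds_zero ht
  obtain ⟨s, hs⟩ := cauchySeq_tendsto_of_complete hc
  refine ⟨s, ?_⟩
  have h1 : Filter.Tendsto (fun n => sit μ (n + 1)) Filter.atTop (nhds s) := hs.comp (Filter.tendsto_add_atTop_nat 1)
  have h2 : Filter.Tendsto (fun n => sit μ (n + 1)) Filter.atTop (nhds (μ - s ^ 2)) := tendsto_const_nhds.sub (hs.pow 2)
  have := tendsto_nhds_unique h1 h2
  linear_combination this

lemma sqrt_compl (v : Pl k) {c : v.adicCompletion k} (h : vc v (c - 1) < vc v 4) : ∃ t, t ^ 2 = c := by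
  have h4 : (4 : v.adicCompletion k) ≠ 0 := by
    have := mul_ne_zero (two_ne_compl v) (two_ne_compl v)
    norm_num at this ⊢
    exact this
  obtain ⟨s, hs⟩ := sit_root v (μ := (c - 1) / 4) (by
    rw [map_div₀]
    exact (div_lt_one₀ (zero_lt_iff.2 (by simpa using h4))).2 h)
  refine ⟨1 + 2 * s, ?_⟩
  field_simp at hs
  linear_combination hs

/-- Over `K = k_v`, a representation of `b` by (the extension of) `a` comes, up to squares, from `k`. -/
theorem descend [Nonempty (k →+* ℝ)] (v : Pl k) (n : ℕ) : ∀ (m : ℕ) (a : Fin m → k) (b : Fin n → v.adicCompletion k), (∀ i, TP (a i)) → (∀ i, b i ≠ 0) →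
    Rep (v.adicCompletion k) (fun i => algebraMap k (v.adicCompletion k) (a i)) b →
    ∃ (b0 : Fin n → k) (t : Fin n → v.adicCompletion k), (∀ i, TP (b0 i)) ∧ Rep k a b0 ∧ ∀ i, b i = t i ^ 2 * algebraMap k _ (b0 i) := by
  have h2 : (2 : k) ≠ 0 := two_ne_zero
  let _ : Invertible (2 : k) := invertibleOfNonzero h2
  induction n with
  | zero => intro m a b _ _ _; exact ⟨Fin.elim0, Fin.elim0, fun i => i.elim0, ⟨0, by ext i; exact i.elim0⟩, fun i => i.elim0⟩
  | succ n ih =>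
    intro m a b ha hb h
    have h4 : (4 : v.adicCompletion k) ≠ 0 := by
      have := mul_ne_zero (two_ne_compl v) (two_ne_compl v)
      norm_num at this ⊢
      exact this
    have hloc : ∃ x : Fin m → k, vc v (algebraMap k _ (Qd a x) - b 0) < vc v 4 * vc v (b 0) := by
      obtain ⟨M, hM⟩ := rep_iff.1 h
      have := hM 0 0
      simp only [if_true] at this
      have hγ : vc v 4 * vc v (b 0) ≠ 0 := mul_ne_zero (by simpa using h4) (by simpa using hb 0)
      have h1 : ∀ i, ∃ x : k, vc v (algebraMap k _ (a i) * ((algebraMap k _ x) ^ 2 - M i 0 ^ 2)) < vc v 4 * vc v (b 0) := by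
        intro i
        obtain ⟨δ, hδ, h⟩ := cont_sq (vc v) (algebraMap k _ (a i)) (M i 0) hγ
        obtain ⟨x, hx⟩ := vc_dense v (M i 0) hδ
        exact ⟨x, h _ (by rwa [Valuation.map_sub_swap])⟩
      choose x hx using h1
      refine ⟨x, ?_⟩
      have e : algebraMap k (v.adicCompletion k) (Qd a x) - b 0
         = ∑ i, algebraMap k _ (a i) * ((algebraMap k _ (x i)) ^ 2 - M i 0 ^ 2) := by
        rw [← this]
        simp only [Qd, map_sum, map_mul, map_pow, ← Finset.sum_sub_distrib, mul_sub]
        exact Finset.sum_congr rfl fun _ _ => by ring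
      rw [e]
      exact Valuation.map_sum_lt _ hγ fun i _ => hx i
    obtain ⟨x, hx⟩ := hloc
    obtain ⟨t, ht⟩ := sqrt_compl v (c := algebraMap k _ (Qd a x) / b 0) (by
      have : algebraMap k (v.adicCompletion k) (Qd a x) / b 0 - 1 = (algebraMap k _ (Qd a x) - b 0) / b 0 := by
        rw [sub_div, div_self (hb 0)]
      rw [this, map_div₀]
      exact (div_lt_iff₀ (zero_lt_iff.2 (by simpa using hb 0))).2 hx)
    have hxt : algebraMap k (v.adicCompletion k) (Qd a x) = t ^ 2 * b 0 := by rw [ht, div_mul_cancel₀ _ (hb 0)]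
    have ht0 : t ≠ 0 := by
      rintro rfl
      rw [hxt] at hx
      simp only [ne_eq, OfNat.ofNat_ne_zero, not_false_eq_true, zero_pow, zero_mul, zero_sub, Valuation.map_neg] at hx
      have h41 : vc v 4 ≤ 1 := by
        have := vc_coe v 4
        rw [map_ofNat] at this
        rw [this]
        have e := v.valuation_le_one (K := k) (4 : NumberField.RingOfIntegers k)
        exact e
      exact absurd hx (not_lt.2 (mul_le_of_le_one_left' h41))
    have h0 : Qd a x ≠ 0 := by
      intro h
      rw [h, map_zero] at hxt
      exact mul_ne_zero (pow_ne_zero 2 ht0) (hb 0) hxt.symm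
    cases m with
    | zero => simp [Qd] at h0
    | succ m =>
      obtain ⟨y, hy, hr⟩ := rep_split h0
      have hTP : ∀ i, TP (Qd a (y i)) := by
        intro i φ
        obtain ⟨j, hj⟩ := Function.ne_iff.1 (hy.ne_zero i)
        exact Qd_pos ha φ hj
      have hTPx : TP (Qd a x) := by
        intro φ
        have : x ≠ 0 := by rintro rfl; simp [Qd] at h0
        obtain ⟨j, hj⟩ := Function.ne_iff.1 this
        exact Qd_pos ha φ hj
      obtain ⟨b0, t', hb0, hR, hbt⟩ := ih m (fun i => Qd a (y i)) (Fin.tail b) hTP (fun i => hb _) (by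
        have e1 : Rep (v.adicCompletion k) _ _ := hr.map (algebraMap k (v.adicCompletion k))
        have e2 := (e1.symm (by
          intro i
          refine Fin.cases ?_ (fun i => ?_) i
          · simpa using h0
          · simpa using (hTP i).ne)).trans h
        have e0 : Rep (v.adicCompletion k) b (Fin.cons (algebraMap k _ (Qd a x)) (Fin.tail b) : Fin (n + 1) → _) := by
          rw [rep_iff]
          refine ⟨fun i j => if i = j then (Fin.cons t (fun _ => 1) : Fin (n + 1) → _) i else 0, fun i j => ?_⟩
          rw [Finset.sum_eq_single i]
          · by_cases hij : i = j
            · subst hij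
              refine Fin.cases ?_ (fun i => ?_) i
              · simp [hxt]; ring
              · simp [Fin.tail]
            · simp [hij]
          · intro l _ hl; simp [hl]
          · simp
        have e3 := (e2.trans e0).cancel (two_ne_compl v) (by simp) (by simpa using h0)
        exact e3)
      refine ⟨Fin.cons (Qd a x) b0, Fin.cons t⁻¹ t', ?_, hr.trans (hR.cons _), ?_⟩
      · intro i
        refine Fin.cases hTPx hb0 i
      · intro i
        refine Fin.cases ?_ (fun i => ?_) i
        · simp [hxt, ht0]
        · simpa [Fin.tail] using hbt i
end Sqrt
end HM

end

section
open scoped TensorProduct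
open IsDedekindDomain
open scoped WithZero

namespace HM
section P9
variable {F : Type} [Field F] [NumberField F]
open QGlob QLat

lemma clear_aux (v w : Pl F) (hw : w ≠ v) (z : F) (hz : z ≠ 0) :
    ∃ d : F, vl v d = 1 ∧ (∀ u : Pl F, vl u d ≤ 1) ∧ vl w (d * z) ≤ 1 := by
  have hle : ¬ w.asIdeal ≤ v.asIdeal := by
    intro hle
    apply hw
    ext1
    exact (w.isPrime.isMaximal w.ne_bot).eq_of_le v.isPrime.ne_top hle
  obtain ⟨π, hπw, hπv⟩ := SetLike.not_le_iff_exists.1 hle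
  have hz0 : vl w z ≠ 0 := (map_ne_zero _).2 hz
  obtain ⟨N, hN⟩ := exists_exp_lt _ (inv_ne_zero hz0)
  refine ⟨algebraMap _ F π ^ N, ?_, ?_, ?_⟩
  · rw [map_pow, (vl_int_eq_one v π).2 hπv, one_pow]
  · intro u; rw [map_pow]; exact pow_le_one' (vl_int u π) N
  · have e1 : vl w (algebraMap _ F π) ≤ WithZero.exp (-1 : ℤ) := by
      apply lt_one_le_exp
      refine lt_of_le_of_ne (vl_int w π) fun h => (vl_int_eq_one w π).1 h hπw
    have e2 : vl w (algebraMap _ F π) ^ N ≤ WithZero.exp (-(N : ℤ)) := by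
      refine (pow_le_pow_left' e1 N).trans (le_of_eq ?_)
      rw [← WithZero.exp_nsmul]; simp
    rw [map_mul, map_pow]
    have e3 := (e2.trans_lt (hN N le_rfl)).le
    calc _ ≤ (vl w z)⁻¹ * vl w z := mul_le_mul' e3 le_rfl
      _ = 1 := inv_mul_cancel₀ hz0

lemma clear_one (v : Pl F) (z : F) : ∃ d : F, vl v d = 1 ∧ (∀ w : Pl F, vl w d ≤ 1) ∧ ∀ w : Pl F, w ≠ v → vl w (d * z) ≤ 1 := by
  classical
  by_cases hz : z = 0
  · exact ⟨1, by simp, by simp, by simp [hz]⟩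
  have hfin : {w : Pl F | vl w z ≠ 1}.Finite := finite_ne_one (Units.mk0 z hz)
  have h1 : ∀ w : Pl F, ∃ d : F, vl v d = 1 ∧ (∀ u : Pl F, vl u d ≤ 1) ∧ (w ≠ v → vl w (d * z) ≤ 1) := by
    intro w
    by_cases hw : w = v
    · exact ⟨1, by simp, by simp, fun h => absurd hw h⟩
    · obtain ⟨d, h1, h2, h3⟩ := clear_aux v w hw z hz
      exact ⟨d, h1, h2, fun _ => h3⟩
  choose d hd1 hd2 hd3 using h1
  refine ⟨∏ w ∈ hfin.toFinset, d w, ?_, ?_, ?_⟩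
  · rw [map_prod]; exact Finset.prod_eq_one fun w _ => hd1 w
  · intro u; rw [map_prod]; exact Finset.prod_le_one' fun w _ => hd2 w u
  · intro u hu
    by_cases hzu : vl u z = 1
    · rw [map_mul, hzu, mul_one, map_prod]; exact Finset.prod_le_one' fun w _ => hd2 w u
    · have hm : u ∈ hfin.toFinset := hfin.mem_toFinset.2 hzu
      rw [← Finset.mul_prod_erase _ _ hm, mul_right_comm, map_mul, map_prod]
      exact mul_le_one' (hd3 u hu) (Finset.prod_le_one' fun w _ => hd2 w u)

lemma clear_fin (v : Pl F) (Z : Finset F) : ∃ d : F, vl v d = 1 ∧ (∀ w : Pl F, vl w d ≤ 1) ∧ ∀ z ∈ Z, ∀ w : Pl F, w ≠ v → vl w (d * z) ≤ 1 := by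
  classical
  induction Z using Finset.induction_on with
  | empty => exact ⟨1, by simp, by simp, by simp⟩
  | insert z Z _ ih =>
    obtain ⟨d, h1, h2, h3⟩ := ih
    obtain ⟨d', h1', h2', h3'⟩ := clear_one v z
    refine ⟨d * d', by simp [h1, h1'], fun w => by rw [map_mul]; exact mul_le_one' (h2 w) (h2' w), ?_⟩
    intro y hy w hw
    rcases Finset.mem_insert.1 hy with rfl | hy
    · rw [mul_assoc, map_mul]; exact mul_le_one' (h2 w) (h3' w hw)
    · rw [mul_right_comm, map_mul]; exact mul_le_one' (h3 y hy w hw) (h2' w)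

lemma Dg.scale {K : Type} [Field K] {V : Type} [AddCommGroup V] [Module K V] {Q : QuadraticForm K V} {n : ℕ} {e : Module.Basis (Fin n) K V} {a b t : Fin n → K}
    (h : Dg Q e a) (ht : ∀ i, t i ≠ 0) (hab : ∀ i, a i = t i ^ 2 * b i) : ∃ f : Module.Basis (Fin n) K V, Dg Q f b := by
  refine ⟨e.isUnitSMul (w := fun i => (t i)⁻¹) (fun i => (inv_ne_zero (ht i)).isUnit), fun x => ?_⟩
  rw [h, Qd, Qd]
  refine Finset.sum_congr rfl fun i _ => ?_
  rw [Module.Basis.repr_isUnitSMul, hab, Units.smul_def]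
  simp [inv_inv]
  ring

lemma exists_scale (v : Pl F) {W : Type} [AddCommGroup W] [Module (Fv F v) W] {t : Set W} {x : W}
    (hx : x ∈ Submodule.span (Fv F v) (ospan (Ov F v) t)) : ∃ p : F, p ≠ 0 ∧ vl v p ≤ 1 ∧ algebraMap F (Fv F v) p • x ∈ ospan (Ov F v) t := by
  refine Submodule.span_induction (p := fun x _ => ∃ p : F, p ≠ 0 ∧ vl v p ≤ 1 ∧ algebraMap F (Fv F v) p • x ∈ ospan (Ov F v) t) ?_ ?_ ?_ ?_ hx
  · intro x hx; exact ⟨1, one_ne_zero, by simp, by simpa using hx⟩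
  · exact ⟨1, one_ne_zero, by simp, by simpa using ospan_zero⟩
  · rintro x y _ _ ⟨p, hp, hp1, hpx⟩ ⟨q, hq, hq1, hqy⟩
    refine ⟨p * q, mul_ne_zero hp hq, by rw [map_mul]; exact mul_le_one' hp1 hq1, ?_⟩
    rw [smul_add, map_mul]
    refine ospan_add ?_ ?_
    · rw [mul_comm, mul_smul]; exact ospan_smul (by rw [mem_Ov, vc_coe]; exact hq1) hpx
    · rw [mul_smul]; exact ospan_smul (by rw [mem_Ov, vc_coe]; exact hp1) hqy
  · rintro c x _ ⟨p, hp, hp1, hpx⟩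
    obtain ⟨q, hq, hq1, hqc⟩ : ∃ q : F, q ≠ 0 ∧ vl v q ≤ 1 ∧ vc v (algebraMap F (Fv F v) q * c) ≤ 1 := by
      by_cases hc : vc v c ≤ 1
      · exact ⟨1, one_ne_zero, by simp, by simpa using hc⟩
      · rw [not_le] at hc
        have hc0 : vc v c ≠ 0 := (zero_lt_one.trans hc).ne'
        obtain ⟨q, hq, hq1⟩ := vc_surj v (inv_ne_zero hc0)
        refine ⟨q, hq, ?_, ?_⟩
        · rw [hq1]; exact inv_le_one_of_one_le₀ hc.le
        · rw [map_mul, vc_coe, hq1, inv_mul_cancel₀ hc0]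
    refine ⟨q * p, mul_ne_zero hq hp, by rw [map_mul]; exact mul_le_one' hq1 hp1, ?_⟩
    have : algebraMap F (Fv F v) (q * p) • c • x = (algebraMap F (Fv F v) q * c) • algebraMap F (Fv F v) p • x := by
      rw [smul_smul, smul_smul, map_mul]; congr 1; ring
    rw [this]
    exact ospan_smul (mem_Ov.2 hqc) hpx

lemma exists_scale_fin (v : Pl F) {W : Type} [AddCommGroup W] [Module (Fv F v) W] {t : Set W} {n : ℕ} (x : Fin n → W)
    (hx : Submodule.span (Fv F v) (ospan (Ov F v) t) = ⊤) : ∃ p : F, p ≠ 0 ∧ vl v p ≤ 1 ∧ ∀ i, algebraMap F (Fv F v) p • x i ∈ ospan (Ov F v) t := by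
  classical
  have h : ∀ i, ∃ p : F, p ≠ 0 ∧ vl v p ≤ 1 ∧ algebraMap F (Fv F v) p • x i ∈ ospan (Ov F v) t := fun i => exists_scale v (by rw [hx]; trivial)
  choose p hp hp1 hpx using h
  refine ⟨∏ i, p i, Finset.prod_ne_zero_iff.2 fun i _ => hp i, ?_, ?_⟩
  · rw [map_prod]; exact Finset.prod_le_one' fun i _ => hp1 i
  · intro i
    rw [← Finset.prod_erase_mul _ _ (Finset.mem_univ i), map_mul, mul_smul]
    refine ospan_smul ?_ (hpx i)
    rw [mem_Ov, vc_coe, map_prod]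
    exact Finset.prod_le_one' fun i _ => hp1 i

end P9
end HM

end

section
open scoped TensorProduct
open IsDedekindDomain
open scoped WithZero

namespace HM
section P9c
variable {F : Type} [Field F] [NumberField F]
open QGlob QLat

/-- the diagonal quadratic space -/
def QD {K : Type} [Field K] {n : ℕ} (b : Fin n → K) : QuadraticForm K (Fin n → K) := QuadraticMap.weightedSumSquares K b

lemma QD_apply {K : Type} [Field K] {n : ℕ} (b : Fin n → K) (x : Fin n → K) : QD b x = Qd b x := by
  rw [QD, QuadraticMap.weightedSumSquares_apply, Qd]
  exact Finset.sum_congr rfl fun _ _ => by rw [smul_eq_mul, sq]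

lemma Dg_QD {K : Type} [Field K] {n : ℕ} (b : Fin n → K) : Dg (QD b) (Pi.basisFun K (Fin n)) b := by
  intro x
  rw [QD_apply]
  congr 1

theorem loc_of_glob [Nonempty (F →+* ℝ)] {V : Type} [AddCommGroup V] [Module F V] {Q : QuadraticForm F V} {L : Set V} {n m : ℕ}
    {e : Module.Basis (Fin m) F V} {a : Fin m → F} (he : Dg Q e a) (ha : ∀ i, TP (a i)) (hglob : IsGlobADC F Q L n) (v : Pl F)
    {W : Type} [AddCommGroup W] [Module (Fv F v) W] {Q' : QuadraticForm (Fv F v) W} (hQ' : Nondeg Q')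
    {f0 : Module.Basis (Fin n) (Fv F v) W} {b : Fin n → Fv F v} (hf0 : Dg Q' f0 b)
    {N : Set W} (hN : IsLatticeOn (Ov F v) N) (hI : IsIntegral (Ov F v) Q' N) (hS : SpaceRep Q' (Qv F Q v)) :
    LatRep Q' (Qv F Q v) N (Lv F L v) := by
  classical
  have hb : ∀ i, b i ≠ 0 := hf0.ne hQ'
  obtain ⟨b0, r, hb0, hR, hbr⟩ := descend v n m a b ha hb ((spaceRep_iff (two_ne_compl v) hQ' (he.bc v) hf0).1 hS)
  have hr : ∀ i, r i ≠ 0 := by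
    intro i h
    apply hb i
    rw [hbr, h]; simp
  obtain ⟨f, hf⟩ := hf0.scale hr hbr
  obtain ⟨⟨t, ht⟩, hspan⟩ := hN
  subst ht
  obtain ⟨p, hp0, hp1, hp⟩ := exists_scale_fin v (fun i => f i) hspan
  -- embedding of the global diagonal space
  obtain ⟨ι, hι⟩ : ∃ ι : (Fin n → F) → W, ∀ h, ι h = ∑ i, algebraMap F (Fv F v) (h i) • f i := ⟨_, fun _ => rfl⟩
  have hιadd : ∀ x y, ι (x + y) = ι x + ι y := by
    intro x y; simp only [hι, Pi.add_apply, map_add, add_smul, Finset.sum_add_distrib]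
  have hιsmul : ∀ (c : F) x, ι (c • x) = algebraMap F (Fv F v) c • ι x := by
    intro c x; simp only [hι, Pi.smul_apply, smul_eq_mul, map_mul, mul_smul, Finset.smul_sum]
  have hι0 : ι 0 = 0 := by simp [hι]
  have hιQ : ∀ x, Q' (ι x) = algebraMap F (Fv F v) (Qd b0 x) := by
    intro x
    rw [hf]
    have : (f.repr (ι x) : Fin n → Fv F v) = fun i => algebraMap F (Fv F v) (x i) := by
      rw [hι, ← Module.Basis.equivFun_symm_apply, ← Module.Basis.equivFun_apply, LinearEquiv.apply_symm_apply]
    rw [this]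
    simp [Qd]
  have hιs : ∀ i, ι (Pi.single i p) = algebraMap F (Fv F v) p • f i := by
    intro i
    rw [hι, Finset.sum_eq_single i]
    · simp
    · intro j _ hj; simp [hj]
    · simp
  have happ : ∀ x : W, ∃ g : Fin n → F, ∀ i, vc v (f.repr x i - algebraMap F (Fv F v) (g i)) < vl v p := by
    intro x
    have : ∀ i, ∃ y : F, vc v (f.repr x i - algebraMap F (Fv F v) y) < vl v p := fun i =>
      vc_dense v _ ((map_ne_zero _).2 hp0)
    choose g hg using this
    exact ⟨g, hg⟩
  choose g hg using happ
  have hdec : ∀ x : W, ∃ c : Fin n → Fv F v, (∀ i, c i ∈ Ov F v) ∧ x = ι (g x) + ∑ i, c i • ι (Pi.single i p) := by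
    intro x
    have hpa : algebraMap F (Fv F v) p ≠ 0 := (map_ne_zero _).2 hp0
    refine ⟨fun i => (f.repr x i - algebraMap F (Fv F v) (g x i)) / algebraMap F (Fv F v) p, fun i => ?_, ?_⟩
    · rw [mem_Ov, map_div₀, vc_coe]
      exact div_le_one_of_le₀ (hg x i).le (zero_le)
    · simp only [hιs, smul_smul, div_mul_cancel₀ _ hpa, sub_smul]
      rw [hι, Finset.sum_sub_distrib, f.sum_repr]
      abel
  obtain ⟨G, hG⟩ : ∃ G : Finset (Fin n → F), G = t.image g ∪ Finset.univ.image (fun i => Pi.single i p) := ⟨_, rfl⟩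
  have hGs : ∀ i, (Pi.single i p : Fin n → F) ∈ G := by
    intro i; rw [hG]; exact Finset.mem_union_right _ (Finset.mem_image_of_mem _ (Finset.mem_univ i))
  have hGg : ∀ x ∈ t, g x ∈ G := by
    intro i hi; rw [hG]; exact Finset.mem_union_left _ (Finset.mem_image_of_mem _ hi)
  have hsN : ∀ i, ι (Pi.single i p) ∈ ospan (Ov F v) (t : Set W) := by
    intro i; rw [hιs]; exact hp i
  have hGN : ∀ h ∈ G, ι h ∈ ospan (Ov F v) (t : Set W) := by
    intro h hh
    rw [hG, Finset.mem_union, Finset.mem_image, Finset.mem_image] at hh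
    rcases hh with ⟨x, hx, rfl⟩ | ⟨i, _, rfl⟩
    · obtain ⟨c, hc, hxc⟩ := hdec x
      have : ι (g x) = x + (-1 : Fv F v) • ∑ i, c i • ι (Pi.single i p) := by
        conv_rhs => rw [hxc]
        simp
      rw [this]
      refine ospan_add (ospan_sub hx) (ospan_smul (neg_mem (one_mem _)) (ospan_sum _ _ fun i _ => ospan_smul (hc i) (hsN i)))
    · exact hsN i
  obtain ⟨D, hD1, hD2, hD3⟩ := clear_fin v (G.biUnion (fun h => Finset.univ.image h) ∪ Finset.univ.image b0)
  have hDG : ∀ h ∈ G, ∀ i, ∀ w : Pl F, w ≠ v → vl w (D * h i) ≤ 1 := fun h hh i w hw =>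
    hD3 _ (Finset.mem_union_left _ (Finset.mem_biUnion.2 ⟨h, hh, Finset.mem_image_of_mem _ (Finset.mem_univ i)⟩)) w hw
  have hDb : ∀ i, ∀ w : Pl F, w ≠ v → vl w (D * b0 i) ≤ 1 := fun i w hw =>
    hD3 _ (Finset.mem_union_right _ (Finset.mem_image_of_mem _ (Finset.mem_univ i))) w hw
  have hD0 : D ≠ 0 := by rintro rfl; simp at hD1
  have hDO : D ∈ OF F := mem_OF hD2
  have hle : ∀ (w : Pl F) (c : F), c ∈ OF F → vl w c ≤ 1 := fun w c hc => vl_int w (⟨c, hc⟩ : NumberField.RingOfIntegers F)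
  obtain ⟨T, hT⟩ : ∃ T : Finset (Fin n → F), T = G.image (fun h => D ^ 2 • h) := ⟨_, rfl⟩
  have hN0a : ∀ x ∈ ospan (OF F) (T : Set (Fin n → F)), ι x ∈ ospan (Ov F v) (t : Set W) := by
    intro x hx
    refine ospan_ind (p := fun x => ι x ∈ ospan (Ov F v) (t : Set W)) ?_ ?_ ?_ ?_ hx
    · intro x hx
      rw [hT, Finset.coe_image] at hx
      obtain ⟨h, hh, rfl⟩ := hx
      show ι (D ^ 2 • h) ∈ _
      rw [hιsmul]
      exact ospan_smul (alg_OF v (pow_mem hDO 2)) (hGN h hh)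
    · rw [hι0]; exact ospan_zero
    · intro x _ y _ hx hy; rw [hιadd]; exact ospan_add hx hy
    · intro c hc x _ hx; rw [hιsmul]; exact ospan_smul (alg_OF v hc) hx
  have hN0b : ∀ x ∈ ospan (OF F) (T : Set (Fin n → F)), ∀ w : Pl F, w ≠ v → ∀ i, vl w (x i) ≤ vl w D := by
    intro x hx w hw
    refine ospan_ind (p := fun x => ∀ i, vl w (x i) ≤ vl w D) ?_ ?_ ?_ ?_ hx
    · intro x hx i
      rw [hT, Finset.coe_image] at hx
      obtain ⟨h, hh, rfl⟩ := hx
      have : (D ^ 2 • h) i = D * (D * h i) := by simp; ring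
      show vl w ((D ^ 2 • h) i) ≤ _
      rw [this, map_mul]
      exact mul_le_of_le_one_right' (hDG h hh i w hw)
    · intro i; simp
    · intro x _ y _ hx hy i
      exact ((vl w).map_add _ _).trans (max_le (hx i) (hy i))
    · intro c hc x _ hx i
      rw [Pi.smul_apply, smul_eq_mul, map_mul]
      exact (mul_le_of_le_one_left' (hle w c hc)).trans (hx i)
  have hintgr : IsIntegral (OF F) (QD b0) (ospan (OF F) (T : Set (Fin n → F))) := by
    intro x hx
    refine mem_OF fun w => ?_
    rw [QD_apply]
    by_cases hw : w = v
    · subst hw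
      have := hI _ (hN0a x hx)
      rwa [hιQ, mem_Ov, vc_coe] at this
    · rw [Qd]
      refine (vl w).map_sum_le fun i _ => ?_
      have h1 := hN0b x hx w hw i
      have h2 := hDb i w hw
      rw [map_mul] at h2 ⊢
      rw [map_pow, sq]
      calc vl w (b0 i) * (vl w (x i) * vl w (x i)) ≤ vl w (b0 i) * (vl w D * vl w D) := mul_le_mul' le_rfl (mul_le_mul' h1 h1)
        _ = (vl w D * vl w (b0 i)) * vl w D := by rw [mul_comm, mul_assoc, mul_comm]
        _ ≤ 1 := mul_le_one' h2 (hD2 w)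
  have hlat : IsLatticeOn (OF F) (ospan (OF F) (T : Set (Fin n → F))) := by
    refine ⟨⟨T, rfl⟩, ?_⟩
    rw [eq_top_iff, ← (Pi.basisFun F (Fin n)).span_eq, Submodule.span_le]
    rintro _ ⟨i, rfl⟩
    have h1 : D ^ 2 • (Pi.single i p : Fin n → F) ∈ Submodule.span F (ospan (OF F) (T : Set (Fin n → F))) := by
      refine Submodule.subset_span (ospan_sub ?_)
      rw [hT, Finset.coe_image]
      exact ⟨_, hGs i, rfl⟩
    have h2 := Submodule.smul_mem _ (D ^ 2 * p)⁻¹ h1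
    have h3 : (D ^ 2 * p)⁻¹ • D ^ 2 • (Pi.single i p : Fin n → F) = Pi.basisFun F (Fin n) i := by
      rw [smul_smul, ← Pi.single_smul, Pi.basisFun_apply, smul_eq_mul]
      congr 1
      field_simp
    rw [h3] at h2
    exact h2
  have hdg := Dg_QD b0
  have hnd : Nondeg (QD b0) := hdg.nondeg two_ne_zero fun i => (hb0 i).ne
  have hpos : PosDef F (QD b0) := by
    intro φ x hx
    obtain ⟨j, hj⟩ := Function.ne_iff.1 hx
    rw [QD_apply]
    exact Qd_pos hb0 φ hj
  obtain ⟨τ, -, hτQ, hτL⟩ := hglob (Fin n → F) (QD b0) hnd hpos (by simp) _ hlat hintgr ((spaceRep_iff two_ne_zero hnd he hdg).2 hR)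
  -- the local representation
  obtain ⟨σ, hσ⟩ : ∃ σ : W →ₗ[Fv F v] Vv F V v, ∀ x, σ x = ∑ i, f.repr x i • toVv F v (τ (Pi.single i 1)) :=
    ⟨f.constr (Fv F v) (fun i => toVv F v (τ (Pi.single i 1))), fun x => by
      rw [Module.Basis.constr_apply_fintype]; simp [Module.Basis.equivFun_apply]⟩
  have hσQ : ∀ x, Qv F Q v (σ x) = Q' x := by
    intro x
    rw [hσ, hf, bc_diag]
    intro i j
    have := hdg.polar_basis i j
    rw [← this, QuadraticMap.polar, QuadraticMap.polar, ← hτQ, ← hτQ, ← hτQ, map_add τ, Pi.basisFun_apply, Pi.basisFun_apply]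
  have hσι : ∀ h, σ (ι h) = toVv F v (τ h) := by
    intro h
    have h1 : ∀ i, f.repr (ι h) i = algebraMap F (Fv F v) (h i) := by
      intro i
      have : (f.repr (ι h) : Fin n → Fv F v) = fun i => algebraMap F (Fv F v) (h i) := by
        rw [hι, ← Module.Basis.equivFun_symm_apply, ← Module.Basis.equivFun_apply, LinearEquiv.apply_symm_apply]
      rw [this]
    rw [hσ]
    simp only [h1, ← toVv_smul]
    rw [← toVv_sum]
    simp only [← map_smul]
    rw [← map_sum]
    congr 2
    ext j
    simp [Finset.sum_apply, Pi.single_apply]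
  have hGL : ∀ h ∈ G, σ (ι h) ∈ Lv F L v := by
    intro h hh
    have h1 : toVv F v (τ (D ^ 2 • h)) ∈ Lv F L v := by
      refine ospan_sub ⟨_, hτL ⟨_, ospan_sub ?_, rfl⟩, rfl⟩
      rw [hT, Finset.coe_image]
      exact ⟨h, hh, rfl⟩
    have h2 : σ (ι h) = (algebraMap F (Fv F v) (D ^ 2))⁻¹ • toVv F v (τ (D ^ 2 • h)) := by
      have h0 : algebraMap F (Fv F v) (D ^ 2) ≠ 0 := (map_ne_zero _).2 (pow_ne_zero 2 hD0)
      rw [map_smul, toVv_smul, smul_smul, inv_mul_cancel₀ h0, one_smul, hσι]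
    rw [h2]
    refine ospan_smul ?_ h1
    rw [mem_Ov, map_inv₀, vc_coe, map_pow, hD1]
    simp
  refine ⟨σ, inj_of_isom hQ' σ hσQ, hσQ, ?_⟩
  rintro _ ⟨x, hx, rfl⟩
  refine ospan_ind (p := fun x => σ x ∈ Lv F L v) ?_ ?_ ?_ ?_ hx
  · intro x hx
    obtain ⟨c, hc, hxc⟩ := hdec x
    rw [hxc, map_add, map_sum]
    refine ospan_add (hGL _ (hGg x hx)) (ospan_sum _ _ fun i _ => ?_)
    rw [map_smul]
    exact ospan_smul (hc i) (hGL _ (hGs i))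
  · rw [map_zero]; exact ospan_zero
  · intro x _ y _ hx hy; rw [map_add]; exact ospan_add hx hy
  · intro c hc x _ hx; rw [map_smul]; exact ospan_smul hc hx

end P9c
end HM

end

section
open scoped TensorProduct
open IsDedekindDomain
open scoped WithZero

namespace HM
section P10
variable {F : Type} [Field F] [NumberField F]
open QGlob QLat

lemma nonempty_real (hF : TotallyReal F) : Nonempty (F →+* ℝ) := by
  obtain ⟨v⟩ : Nonempty (NumberField.InfinitePlace F) := inferInstance
  exact ⟨NumberField.InfinitePlace.embedding_of_isReal (hF v)⟩

lemma Dg.tp {V : Type} [AddCommGroup V] [Module F V] {Q : QuadraticForm F V} (hQ : PosDef F Q) {m : ℕ}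
    {e : Module.Basis (Fin m) F V} {a : Fin m → F} (he : Dg Q e a) (i : Fin m) : TP (a i) := by
  intro φ
  rw [← he.val i]
  exact hQ φ _ (e.ne_zero i)

lemma fin_of_lattice {V : Type} [AddCommGroup V] [Module F V] {L : Set V} (hL : IsLatticeOn (OF F) L) : FiniteDimensional F V := by
  obtain ⟨⟨t, rfl⟩, hs⟩ := hL
  refine ⟨⟨t, ?_⟩⟩
  rw [eq_top_iff, ← hs, Submodule.span_le]
  intro x hx
  refine ospan_ind (p := fun x => x ∈ Submodule.span F (t : Set V)) (fun x hx => Submodule.subset_span hx) (zero_mem _)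
    (fun x _ y _ hx hy => add_mem hx hy) (fun c _ x _ hx => Submodule.smul_mem _ c hx) hx

theorem main (hF : TotallyReal F)
    {V : Type} [AddCommGroup V] [Module F V]
    (Q : QuadraticForm F V) (hQpos : PosDef F Q)
    (L : Set V) (hL : IsLatticeOn (OF F) L)
    (n : ℕ) (hn : 1 ≤ n) :
    IsGlobADC F Q L n ↔ (IsNRegular F Q L n ∧ IsLocADC F Q L n) := by
  have := nonempty_real hF
  have := fin_of_lattice hL
  obtain ⟨e, a, he⟩ := exists_Dg two_ne_zero Q
  have ha : ∀ i, TP (a i) := he.tp hQpos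
  constructor
  · intro hglob
    constructor
    · intro W _ _ Q' hQ' hpos hr N hN hI hloc
      have : FiniteDimensional F W := .of_finrank_pos (by omega)
      obtain ⟨f, b, hf⟩ := exists_Dg two_ne_zero Q'
      refine hglob W Q' hQ' hpos hr N hN hI ?_
      rw [spaceRep_iff two_ne_zero hQ' he hf]
      refine hasse_space _ _ a b ha (hf.tp hpos) fun v => ?_
      obtain ⟨σ, h1, h2, -⟩ := hloc v
      have hnd : Nondeg (Qv F Q' v) := (hf.bc v).nondeg (two_ne_compl v) fun i => (map_ne_zero _).2 (hf.ne hQ' i)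
      exact (spaceRep_iff (two_ne_compl v) hnd (he.bc v) (hf.bc v)).1 ⟨σ, h1, h2⟩
    · intro v W _ _ Q' hQ' hr N hN hI hS
      have : FiniteDimensional (Fv F v) W := .of_finrank_pos (by omega)
      obtain ⟨f, b, hf⟩ := exists_Dg (two_ne_compl v) Q'
      subst hr
      exact loc_of_glob he ha hglob v hQ' hf hN hI hS
  · rintro ⟨hreg, hloc⟩ W _ _ Q' hQ' hpos hr N hN hI hS
    have : FiniteDimensional F W := .of_finrank_pos (by omega)
    obtain ⟨f, b, hf⟩ := exists_Dg two_ne_zero Q'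
    refine hreg W Q' hQ' hpos hr N hN hI fun v => ?_
    have hnd : Nondeg (Qv F Q' v) := (hf.bc v).nondeg (two_ne_compl v) fun i => (map_ne_zero _).2 (hf.ne hQ' i)
    refine hloc v (Vv F W v) (Qv F Q' v) hnd ?_ _ (Lv_latticeOn v hN) (Lv_integral v hN hI) ?_
    · rw [Module.finrank_eq_card_basis (Algebra.TensorProduct.basis (Fv F v) f), Fintype.card_fin, hr]
    · rw [spaceRep_iff (two_ne_compl v) hnd (he.bc v) (hf.bc v)]
      exact ((spaceRep_iff two_ne_zero hQ' he hf).1 hS).map (algebraMap F (Fv F v))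
end P10
end HM

end

open QLat QGlob

/-- Let `F` be a totally real number field, `L` a positive definite
integral `O_F`-lattice and `n` a positive integer.  Then `L` is globally `n`-ADC if and
only if `L` is `n`-regular and locally `n`-ADC. -/
theorem globADC_iff_nRegular_and_locADC
    (F : Type) [Field F] [NumberField F] (hF : TotallyReal F)
    {V : Type} [AddCommGroup V] [Module F V]
    (Q : QuadraticForm F V) (hQ : Nondeg Q) (hQpos : PosDef F Q)
    (L : Set V) (hL : IsLatticeOn (OF F) L) (hLint : IsIntegral (OF F) Q L)
    (n : ℕ) (hn : 1 ≤ n) :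
    IsGlobADC F Q L n ↔ (IsNRegular F Q L n ∧ IsLocADC F Q L n) := by
  exact HM.main hF Q hQpos L hL n hn
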